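/- (Theorem 2.4 of the paper, stated via characteristic functions.) Fix α ∈ (0,1)∪(1,2) and set γ = 1/α. Let τ_j(y) = τ(F^j(y)) be the successive return times of y ∈ Y to Y. Then for every t ∈ ℝ, ∫_Y exp( i·t·n^{−γ}·d_α^{−γ}·(Σ_{j=0}^{n−1} τ_j(y) − n·ℓ_α) ) dμ_Y(y) → exp( −|t|^α·(1 − i·sgn(t)·tan(απ/2)) ) as n → ∞; that is, the normalized Birkhoff sums of the return time converge in distribution on (Y, μ_Y) to the one-sided α-stable law X_{α,1,1}. -/

import Mathlib

open Real Set MeasureTheory Filter Topology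

noncomputable section

/-- The common branch formula of the Thaler map:
`g(x) = (x^(1-γ) + (1+x)^(1-γ) − 1)^(1/(1-γ))` (real powers). -/
def thalerG (γ x : ℝ) : ℝ := (x ^ (1 - γ) + (1 + x) ^ (1 - γ) - 1) ^ (1 / (1 - γ))

/-- The Thaler map with branch point `xs`: `T 0 = 0`, `T x = g x` on `(0, xs]` and
`T x = g x − 1` on `(xs, 1]`. -/
def thalerT (γ xs : ℝ) (x : ℝ) : ℝ :=
  if x ≤ 0 then 0 else if x ≤ xs then thalerG γ x else thalerG γ x - 1

/-- The invariant density `h(x) = x^(-γ) + (x+1)^(-γ)`. -/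
def thalerH (γ x : ℝ) : ℝ := x ^ (-γ) + (x + 1) ^ (-γ)

/-- The measure `μ` on `[0,1]` with density `h` with respect to Lebesgue measure. -/
def thalerMu (γ : ℝ) : Measure ℝ :=
  (volume.restrict (Set.Icc (0 : ℝ) 1)).withDensity fun x => ENNReal.ofReal (thalerH γ x)

/-- The normalized restriction `μ_Y = μ|_Y / μ(Y)` of `μ` to `Y = (xs,1]`. -/
def thalerMuY (γ xs : ℝ) : Measure ℝ :=
  (thalerMu γ (Set.Ioc xs 1))⁻¹ • (thalerMu γ).restrict (Set.Ioc xs 1)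

/-- The first return time `τ(y) = inf{n ≥ 1 : T^n y ∈ Y}` to `Y = (xs, 1]`. -/
def thalerTau (γ xs : ℝ) (y : ℝ) : ℕ :=
  sInf {n : ℕ | 1 ≤ n ∧ (thalerT γ xs)^[n] y ∈ Set.Ioc xs 1}

/-- The first return map `F(y) = T^(τ(y))(y)`. -/
def thalerF (γ xs : ℝ) (y : ℝ) : ℝ := (thalerT γ xs)^[thalerTau γ xs y] y

/-- `g_α = Γ(1−α)·cos(απ/2)`. -/
def stableGa (α : ℝ) : ℝ := Real.Gamma (1 - α) * Real.cos (α * π / 2)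

/-- `d_α = α^α·((1−γ)/(2^(1−γ)−1))·g_α` with `γ = 1/α`. -/
def stableDa (α : ℝ) : ℝ := α ^ α * ((1 - α⁻¹) / (2 ^ (1 - α⁻¹) - 1)) * stableGa α

/-- `ℓ_α = 0` for `α ∈ (0,1)` and `ℓ_α = (1 − 2^(γ−1))⁻¹` for `α ∈ (1,2)`, `γ = 1/α`. -/
def stableLa (α : ℝ) : ℝ := if α < 1 then 0 else (1 - 2 ^ (α⁻¹ - 1))⁻¹

/-! ### Weighted averages of bounded sequences -/

theorem summable_weighted {a : ℕ → ℝ} {f : ℕ → ℂ} {B : ℝ} (ha : ∀ k, 0 ≤ a k)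
    (hs : Summable a) (hf : ∀ k, ‖f k‖ ≤ B) : Summable fun k => (a k : ℂ) * f k := by
  refine Summable.of_norm_bounded (hs.mul_right B) fun k => ?_
  rw [norm_mul, Complex.norm_real, Real.norm_of_nonneg (ha k)]
  exact mul_le_mul_of_nonneg_left (hf k) (ha k)

theorem norm_tsum_weighted_le {a : ℕ → ℝ} {f : ℕ → ℂ} {m B : ℝ} (ha : ∀ k, 0 ≤ a k)
    (hs : HasSum a m) (hf : ∀ k, ‖f k‖ ≤ B) : ‖∑' k, (a k : ℂ) * f k‖ ≤ m * B := by
  refine tsum_of_norm_bounded (hs.mul_right B) fun k => ?_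
  rw [norm_mul, Complex.norm_real, Real.norm_of_nonneg (ha k)]
  exact mul_le_mul_of_nonneg_left (hf k) (ha k)

theorem tsum_weighted_const {a : ℕ → ℝ} {m : ℝ} (hs : HasSum a m) (w : ℂ) :
    ∑' k, (a k : ℂ) * w = m * w :=
  ((Complex.hasSum_ofReal.mpr hs).mul_right w).tsum_eq

/-- Two averages with the same total mass `m` of values that are pairwise `K`-close are
`m * K`-close. -/
theorem norm_tsum_weighted_sub_le {a b : ℕ → ℝ} {f g : ℕ → ℂ} {m K : ℝ} (ha : ∀ k, 0 ≤ a k)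
    (hb : ∀ k, 0 ≤ b k) (hsa : HasSum a m) (hsb : HasSum b m) (hm : 0 < m)
    (hfg : ∀ k l, ‖f k - g l‖ ≤ K) :
    ‖∑' k, (a k : ℂ) * f k - ∑' k, (b k : ℂ) * g k‖ ≤ m * K := by
  have hf : ∀ k, ‖f k‖ ≤ K + ‖g 0‖ := fun k => by
    have := norm_add_le (f k - g 0) (g 0)
    rw [sub_add_cancel] at this
    linarith [hfg k 0]
  have hg : ∀ k, ‖g k‖ ≤ K + ‖f 0‖ := fun k => by
    have := norm_sub_le (f 0) (f 0 - g k)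
    rw [sub_sub_cancel] at this
    linarith [hfg 0 k]
  have hsf := summable_weighted ha hsa.summable hf
  have hsg := summable_weighted hb hsb.summable hg
  set A := ∑' k, (a k : ℂ) * f k with hA
  have h1 : ∀ l, ‖A - m * g l‖ ≤ m * K := fun l => by
    have : A - m * g l = ∑' k, (a k : ℂ) * (f k - g l) := by
      rw [hA, ← tsum_weighted_const hsa (g l), ← hsf.tsum_sub]
      · exact tsum_congr fun k => by ring
      · exact summable_weighted (B := ‖g l‖) ha hsa.summable fun k => le_rfl
    rw [this]
    exact norm_tsum_weighted_le ha hsa fun k => hfg k l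
  have h2 : (m : ℂ) * (A - ∑' k, (b k : ℂ) * g k) = ∑' l, (b l : ℂ) * (A - m * g l) := by
    rw [mul_sub, ← tsum_weighted_const hsb A, ← tsum_mul_left, ← Summable.tsum_sub]
    · exact tsum_congr fun k => by ring
    · exact summable_weighted (B := ‖A‖) hb hsb.summable fun k => le_rfl
    · exact hsg.mul_left _
  have h3 : m * ‖A - ∑' k, (b k : ℂ) * g k‖ ≤ m * (m * K) := by
    have := norm_tsum_weighted_le hb hsb h1
    rwa [← h2, norm_mul, Complex.norm_real, Real.norm_of_nonneg hm.le] at this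
  exact le_of_mul_le_mul_left h3 hm

/-! ### Return maps with full, uniformly contracting inverse branches -/

/-- The transfer operator with branch weights `p`, inverse branches `y`, twisted by `c`. -/
def branchTransfer (p y : ℕ → ℝ → ℝ) (c : ℕ → ℂ) (u : ℝ → ℂ) (z : ℝ) : ℂ :=
  ∑' k, (p k z : ℂ) * (c (k + 1) * u (y k z))

/-- A return map `F` on `Y` with return time `τ`, invariant probability measure `ν`, inverse
branches `y k` (on which `τ = k + 1`) contracting by `κ`, and Lipschitz weights `p k`
dominated by the summable sequence `q`. -/
structure ReturnSystem (ν : Measure ℝ) (Y : Set ℝ) (F : ℝ → ℝ) (τ : ℝ → ℕ)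
    (p y : ℕ → ℝ → ℝ) (q : ℕ → ℝ) (κ δ : ℝ) : Prop where
  measurableSet : MeasurableSet Y
  ae_mem : ∀ᵐ z ∂ν, z ∈ Y
  measurable_map : Measurable F
  measurable_time : Measurable τ
  abs_sub_le_one : ∀ z ∈ Y, ∀ z' ∈ Y, |z - z'| ≤ 1
  weight_nonneg : ∀ k, ∀ z ∈ Y, 0 ≤ p k z
  weight_hasSum : ∀ z ∈ Y, HasSum (fun k => p k z) 1
  branch_mem : ∀ k, ∀ z ∈ Y, y k z ∈ Y
  branch_contract : ∀ k, ∀ z ∈ Y, ∀ z' ∈ Y, |y k z - y k z'| ≤ κ * |z - z'|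
  rate_nonneg : 0 ≤ κ
  rate_lt_one : κ < 1
  weight_le : ∀ k, ∀ z ∈ Y, p k z ≤ q k
  weight_lipschitz : ∀ k, ∀ z ∈ Y, ∀ z' ∈ Y, |p k z - p k z'| ≤ q k * |z - z'|
  dominating_nonneg : ∀ k, 0 ≤ q k
  dominating_summable : Summable q
  minorant_pos : 0 < δ
  minorant_lt_one : δ < 1
  minorant_le : ∀ z ∈ Y, δ ≤ p 0 z
  duality : ∀ (c : ℕ → ℂ) (u Φ : ℝ → ℂ) (B : ℝ), (∀ k, ‖c k‖ ≤ B) → ContinuousOn u Y →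
    (∀ z ∈ Y, ‖u z‖ ≤ B) → Measurable Φ → (∀ z, ‖Φ z‖ ≤ 1) →
    ∫ z, c (τ z) * u z * Φ (F z) ∂ν = ∫ z, branchTransfer p y c u z * Φ z ∂ν

/-- `φ` has oscillation at most `K` and Lipschitz constant at most `K / b` on `Y`. -/
def OscLip (Y : Set ℝ) (b K : ℝ) (φ : ℝ → ℂ) : Prop :=
  ∀ z ∈ Y, ∀ z' ∈ Y, ‖φ z - φ z'‖ ≤ K * min 1 (|z - z'| / b)

theorem OscLip.osc_le {Y : Set ℝ} {b K : ℝ} {φ : ℝ → ℂ} (h : OscLip Y b K φ) (hK : 0 ≤ K)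
    {z z' : ℝ} (hz : z ∈ Y) (hz' : z' ∈ Y) : ‖φ z - φ z'‖ ≤ K :=
  (h z hz z' hz').trans (mul_le_of_le_one_right hK (min_le_left _ _))

theorem OscLip.lip_le {Y : Set ℝ} {b K : ℝ} {φ : ℝ → ℂ} (h : OscLip Y b K φ) (hK : 0 ≤ K)
    {z z' : ℝ} (hz : z ∈ Y) (hz' : z' ∈ Y) : ‖φ z - φ z'‖ ≤ K / b * |z - z'| := by
  have := (h z hz z' hz').trans (mul_le_mul_of_nonneg_left (min_le_right _ _) hK)
  rwa [mul_div_assoc', ← div_mul_eq_mul_div] at this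

theorem continuousOn_of_norm_sub_le {Y : Set ℝ} {C : ℝ} {φ : ℝ → ℂ}
    (h : ∀ z ∈ Y, ∀ z' ∈ Y, ‖φ z - φ z'‖ ≤ C * |z - z'|) : ContinuousOn φ Y := by
  have : LipschitzOnWith C.toNNReal φ Y := by
    refine LipschitzOnWith.of_dist_le_mul fun z hz z' hz' => ?_
    rw [dist_eq_norm, Real.dist_eq]
    exact (h z hz z' hz').trans (mul_le_mul_of_nonneg_right (le_coe_toNNReal C) (abs_nonneg _))
  exact this.continuousOn

namespace ReturnSystem

variable {ν : Measure ℝ} {Y : Set ℝ} {F : ℝ → ℝ} {τ : ℝ → ℕ} {p y : ℕ → ℝ → ℝ} {q : ℕ → ℝ}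
  {κ δ : ℝ}

theorem norm_twisted_sub_le (S : ReturnSystem ν Y F τ p y q κ δ) {c : ℕ → ℂ} {u : ℝ → ℂ}
    {B A A' : ℝ} (hB : 0 ≤ B) (hA' : 0 ≤ A') (hc : ∀ k, ‖c k‖ ≤ B) (hu : ∀ z ∈ Y, ‖u z‖ ≤ A)
    (hlip : ∀ z ∈ Y, ∀ z' ∈ Y, ‖u z - u z'‖ ≤ A' * |z - z'|) {z z' : ℝ} (hz : z ∈ Y)
    (hz' : z' ∈ Y) :
    ‖branchTransfer p y c u z - branchTransfer p y c u z'‖ ≤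
      B * (κ * A' + (∑' k, q k) * A) * |z - z'| := by
  have hA : 0 ≤ A := (norm_nonneg _).trans (hu z hz)
  have hb : ∀ w ∈ Y, ∀ k, ‖c (k + 1) * u (y k w)‖ ≤ B * A := fun w hw k => by
    rw [norm_mul]
    exact mul_le_mul (hc _) (hu _ (S.branch_mem k w hw)) (norm_nonneg _) hB
  have hs : ∀ w ∈ Y, Summable fun k => (p k w : ℂ) * (c (k + 1) * u (y k w)) := fun w hw =>
    summable_weighted (fun k => S.weight_nonneg k w hw) (S.weight_hasSum w hw).summable (hb w hw)
  rw [branchTransfer, branchTransfer, ← (hs z hz).tsum_sub (hs z' hz')]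
  have hsum : HasSum (fun k => p k z * (B * (κ * A' * |z - z'|)) + q k * (|z - z'| * (B * A)))
      (1 * (B * (κ * A' * |z - z'|)) + (∑' k, q k) * (|z - z'| * (B * A))) :=
    ((S.weight_hasSum z hz).mul_right _).add (S.dominating_summable.hasSum.mul_right _)
  refine (tsum_of_norm_bounded hsum fun k => ?_).trans (le_of_eq (by ring))
  have : (p k z : ℂ) * (c (k + 1) * u (y k z)) - (p k z' : ℂ) * (c (k + 1) * u (y k z')) =
      (p k z : ℂ) * (c (k + 1) * (u (y k z) - u (y k z'))) +
        ((p k z - p k z' : ℝ) : ℂ) * (c (k + 1) * u (y k z')) := by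
    push_cast; ring
  rw [this]
  refine (norm_add_le _ _).trans (add_le_add ?_ ?_)
  · rw [norm_mul, norm_mul, Complex.norm_real, Real.norm_of_nonneg (S.weight_nonneg k z hz)]
    refine mul_le_mul_of_nonneg_left (mul_le_mul (hc _) ?_ (norm_nonneg _) hB)
      (S.weight_nonneg k z hz)
    calc _ ≤ A' * |y k z - y k z'| := hlip _ (S.branch_mem k z hz) _ (S.branch_mem k z' hz')
      _ ≤ A' * (κ * |z - z'|) := mul_le_mul_of_nonneg_left (S.branch_contract k z hz z' hz') hA'
      _ = _ := by ring
  · rw [norm_mul, Complex.norm_real, ← mul_assoc]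
    exact mul_le_mul (S.weight_lipschitz k z hz z' hz') (hb z' hz' k) (norm_nonneg _)
      (mul_nonneg (S.dominating_nonneg k) (abs_nonneg _))

theorem summable_twisted (S : ReturnSystem ν Y F τ p y q κ δ) {c : ℕ → ℂ} {u : ℝ → ℂ}
    {B A : ℝ} (hc : ∀ k, ‖c k‖ ≤ B) (hu : ∀ z ∈ Y, ‖u z‖ ≤ A) {z : ℝ} (hz : z ∈ Y) :
    Summable fun k => (p k z : ℂ) * (c (k + 1) * u (y k z)) := by
  refine summable_weighted (B := B * A) (fun k => S.weight_nonneg k z hz)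
    (S.weight_hasSum z hz).summable fun k => ?_
  rw [norm_mul]
  exact mul_le_mul (hc _) (hu _ (S.branch_mem k z hz)) (norm_nonneg _)
    ((norm_nonneg _).trans (hc 0))

theorem transfer_sub_const (S : ReturnSystem ν Y F τ p y q κ δ) {u : ℝ → ℂ} {A : ℝ}
    (hu : ∀ z ∈ Y, ‖u z‖ ≤ A) (w : ℂ) {z : ℝ} (hz : z ∈ Y) :
    branchTransfer p y 1 (fun x => u x - w) z = branchTransfer p y 1 u z - w := by
  have h1 : ∀ k : ℕ, ‖(1 : ℕ → ℂ) k‖ ≤ 1 := fun k => by simp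
  have := tsum_weighted_const (S.weight_hasSum z hz) w
  rw [Complex.ofReal_one, one_mul] at this
  conv_rhs => rw [← this]
  rw [branchTransfer, branchTransfer, ← (S.summable_twisted h1 hu hz).tsum_sub]
  · exact tsum_congr fun k => by simp [mul_sub]
  · exact summable_weighted (B := ‖w‖) (fun k => S.weight_nonneg k z hz)
      (S.weight_hasSum z hz).summable fun k => le_rfl

/-- The oscillation of the transferred function is strictly smaller, up to the oscillation along
the branch with index `0`. -/
theorem norm_transfer_sub_le (S : ReturnSystem ν Y F τ p y q κ δ) {u : ℝ → ℂ} {K : ℝ}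
    (hu : ∀ z ∈ Y, ∀ z' ∈ Y, ‖u z - u z'‖ ≤ K) {z z' : ℝ} (hz : z ∈ Y) (hz' : z' ∈ Y) :
    ‖branchTransfer p y 1 u z - branchTransfer p y 1 u z'‖ ≤
      δ * ‖u (y 0 z) - u (y 0 z')‖ + (1 - δ) * K := by
  have hbd : ∀ w ∈ Y, ‖u w‖ ≤ K + ‖u z‖ := fun w hw => by
    have := norm_add_le (u w - u z) (u z)
    rw [sub_add_cancel] at this
    linarith [hu w hw z hz]
  let a : ℝ → ℕ → ℝ := fun w k => p k w - if k = 0 then δ else 0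
  have ha : ∀ w ∈ Y, ∀ k, 0 ≤ a w k := fun w hw k => by
    rcases eq_or_ne k 0 with rfl | hk
    · simpa [a] using S.minorant_le w hw
    · simpa [a, hk] using S.weight_nonneg k w hw
  have hsa : ∀ w ∈ Y, HasSum (a w) (1 - δ) := fun w hw =>
    (S.weight_hasSum w hw).sub (hasSum_ite_eq 0 δ)
  have hdec : ∀ w ∈ Y, branchTransfer p y 1 u w =
      δ * u (y 0 w) + ∑' k, (a w k : ℂ) * u (y k w) := fun w hw => by
    have h1 : HasSum (fun k => if k = 0 then (δ : ℂ) * u (y 0 w) else 0) (δ * u (y 0 w)) :=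
      hasSum_ite_eq 0 _
    have h2 : Summable fun k => (a w k : ℂ) * u (y k w) :=
      summable_weighted (ha w hw) (hsa w hw).summable fun k => hbd _ (S.branch_mem k w hw)
    rw [← h1.tsum_eq, ← h1.summable.tsum_add h2, branchTransfer]
    refine tsum_congr fun k => ?_
    rcases eq_or_ne k 0 with rfl | hk
    · simp [a]; ring
    · simp [a, hk]
  rw [hdec z hz, hdec z' hz']
  have h3 := norm_tsum_weighted_sub_le (f := fun k => u (y k z)) (g := fun k => u (y k z'))
    (ha z hz) (ha z' hz') (hsa z hz) (hsa z' hz') (sub_pos.mpr S.minorant_lt_one)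
    (fun k l => hu _ (S.branch_mem k z hz) _ (S.branch_mem l z' hz'))
  have h4 : δ * ‖u (y 0 z) - u (y 0 z')‖ = ‖(δ : ℂ) * (u (y 0 z) - u (y 0 z'))‖ := by
    rw [norm_mul, Complex.norm_real, Real.norm_of_nonneg S.minorant_pos.le]
  rw [h4]
  refine le_trans (le_of_eq ?_) ((norm_add_le _ _).trans (add_le_add_right h3 _))
  congr 1
  ring

theorem norm_transfer_sub_le_osc (S : ReturnSystem ν Y F τ p y q κ δ) {u : ℝ → ℂ} {K : ℝ}
    (hu : ∀ z ∈ Y, ∀ z' ∈ Y, ‖u z - u z'‖ ≤ K) {z z' : ℝ} (hz : z ∈ Y) (hz' : z' ∈ Y) :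
    ‖branchTransfer p y 1 u z - branchTransfer p y 1 u z'‖ ≤ K := by
  have h1 := S.norm_transfer_sub_le hu hz hz'
  have h2 := mul_le_mul_of_nonneg_left
    (hu _ (S.branch_mem 0 z hz) _ (S.branch_mem 0 z' hz')) S.minorant_pos.le
  linarith

theorem iterate_osc_le (S : ReturnSystem ν Y F τ p y q κ δ) {u : ℝ → ℂ} {K : ℝ}
    (hu : ∀ z ∈ Y, ∀ z' ∈ Y, ‖u z - u z'‖ ≤ K) (m : ℕ) :
    ∀ z ∈ Y, ∀ z' ∈ Y, ‖(branchTransfer p y 1)^[m] u z - (branchTransfer p y 1)^[m] u z'‖ ≤ K := by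
  induction m with
  | zero => exact hu
  | succ m ih =>
    intro z hz z' hz'
    rw [Function.iterate_succ_apply']
    exact S.norm_transfer_sub_le_osc ih hz hz'

theorem iterate_branch_mem (S : ReturnSystem ν Y F τ p y q κ δ) (N : ℕ) {z : ℝ} (hz : z ∈ Y) :
    (y 0)^[N] z ∈ Y := by
  induction N with
  | zero => exact hz
  | succ N ih => rw [Function.iterate_succ_apply']; exact S.branch_mem 0 _ ih

theorem iterate_branch_contract (S : ReturnSystem ν Y F τ p y q κ δ) (N : ℕ) {z z' : ℝ}
    (hz : z ∈ Y) (hz' : z' ∈ Y) : |(y 0)^[N] z - (y 0)^[N] z'| ≤ κ ^ N * |z - z'| := by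
  induction N with
  | zero => simp
  | succ N ih =>
    rw [Function.iterate_succ_apply', Function.iterate_succ_apply', pow_succ', mul_assoc]
    exact (S.branch_contract 0 _ (S.iterate_branch_mem N hz) _ (S.iterate_branch_mem N hz')).trans
      (mul_le_mul_of_nonneg_left ih S.rate_nonneg)

theorem norm_iterate_sub_le (S : ReturnSystem ν Y F τ p y q κ δ) {u : ℝ → ℂ} {K : ℝ}
    (hu : ∀ z ∈ Y, ∀ z' ∈ Y, ‖u z - u z'‖ ≤ K) (N : ℕ) :
    ∀ z ∈ Y, ∀ z' ∈ Y, ‖(branchTransfer p y 1)^[N] u z - (branchTransfer p y 1)^[N] u z'‖ ≤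
      δ ^ N * ‖u ((y 0)^[N] z) - u ((y 0)^[N] z')‖ + (1 - δ ^ N) * K := by
  induction N with
  | zero => intro z _ z' _; simp
  | succ N ih =>
    intro z hz z' hz'
    rw [Function.iterate_succ_apply']
    have h1 := S.norm_transfer_sub_le (S.iterate_osc_le hu N) hz hz'
    have h2 := mul_le_mul_of_nonneg_left
      (ih _ (S.branch_mem 0 z hz) _ (S.branch_mem 0 z' hz')) S.minorant_pos.le
    rw [Function.iterate_succ_apply, Function.iterate_succ_apply, pow_succ']
    linarith

/-- On functions whose Lipschitz constant is measured at a small enough scale, iterates of the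
transfer operator contract oscillations exponentially fast. -/
theorem exists_oscLip_iterate (S : ReturnSystem ν Y F τ p y q κ δ) :
    ∃ b C r : ℝ, 0 < b ∧ 0 ≤ C ∧ 0 < r ∧ r < 1 ∧ ∀ (φ : ℝ → ℂ) (K : ℝ), 0 ≤ K →
      OscLip Y b K φ → ∀ m, OscLip Y b (C * r ^ m * K) ((branchTransfer p y 1)^[m] φ) := by
  set Q := ∑' k, q k with hQ
  have hQ0 : 0 ≤ Q := tsum_nonneg S.dominating_nonneg
  have hκ := S.rate_lt_one
  obtain ⟨b, hb, hbQ⟩ : ∃ b : ℝ, 0 < b ∧ κ + b * Q ≤ (1 + κ) / 2 := by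
    refine ⟨(1 - κ) / (2 * (Q + 1)), by apply div_pos <;> linarith, ?_⟩
    have : (1 - κ) / (2 * (Q + 1)) * Q ≤ (1 - κ) / 2 := by
      rw [div_mul_eq_mul_div, div_le_div_iff₀ (by linarith) (by norm_num)]
      nlinarith
    linarith
  set κ₁ := (1 + κ) / 2 with hκ₁
  have hκ₁0 : 0 < κ₁ := by linarith [S.rate_nonneg]
  have hκ₁1 : κ₁ < 1 := by linarith
  have hone : ∀ k : ℕ, ‖(1 : ℕ → ℂ) k‖ ≤ 1 := fun k => by simp
  have hlip : ∀ (φ : ℝ → ℂ) (K : ℝ), 0 ≤ K → OscLip Y b K φ → ∀ z ∈ Y, ∀ z' ∈ Y,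
      ‖branchTransfer p y 1 φ z - branchTransfer p y 1 φ z'‖ ≤ κ₁ * K * (|z - z'| / b) := by
    intro φ K hK hφ z hz z' hz'
    have hbd : ∀ w ∈ Y, ‖φ w‖ ≤ K + ‖φ z‖ := fun w hw => by
      have := norm_add_le (φ w - φ z) (φ z)
      rw [sub_add_cancel] at this
      linarith [hφ.osc_le hK hw hz]
    have h := S.norm_twisted_sub_le (c := 1) (u := fun x => φ x - φ z) (A := K) (A' := K / b)
      zero_le_one (by positivity) hone (fun w hw => hφ.osc_le hK hw hz)
      (fun w hw w' hw' => by simpa using hφ.lip_le hK hw hw') hz hz'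
    rw [S.transfer_sub_const hbd _ hz, S.transfer_sub_const hbd _ hz', sub_sub_sub_cancel_right]
      at h
    refine h.trans ?_
    have : 1 * (κ * (K / b) + Q * K) * |z - z'| = (κ + b * Q) * K * (|z - z'| / b) := by
      field_simp
    rw [this]
    gcongr
  have hpres : ∀ (K : ℝ), 0 ≤ K → ∀ (φ : ℝ → ℂ), OscLip Y b K φ → ∀ m,
      OscLip Y b K ((branchTransfer p y 1)^[m] φ) := by
    intro K hK φ hφ m
    induction m with
    | zero => exact hφ
    | succ m ih =>
      intro z hz z' hz'
      rw [Function.iterate_succ_apply', mul_min_of_nonneg _ _ hK, mul_one]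
      refine le_min (S.norm_transfer_sub_le_osc (fun w hw w' hw' => ih.osc_le hK hw hw') hz hz') ?_
      refine (hlip _ K hK ih z hz z' hz').trans ?_
      exact mul_le_mul_of_nonneg_right (mul_le_of_le_one_left hK hκ₁1.le) (by positivity)
  obtain ⟨N, hN⟩ : ∃ N : ℕ, κ ^ N < b / 2 := exists_pow_lt_of_lt_one (by positivity) hκ
  have hNs : κ ^ (N + 1) ≤ b / 2 := by
    rw [pow_succ]
    exact (mul_le_of_le_one_right (pow_nonneg S.rate_nonneg _) hκ.le).trans hN.le
  set N' := N + 1 with hN'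
  set ρ := max κ₁ (1 - δ ^ N' / 2) with hρ
  have hδN : 0 < δ ^ N' := pow_pos S.minorant_pos _
  have hρ0 : 0 < ρ := hκ₁0.trans_le (le_max_left _ _)
  have hρ1 : ρ < 1 := max_lt hκ₁1 (by linarith)
  have hcontr : ∀ (K : ℝ), 0 ≤ K → ∀ (φ : ℝ → ℂ), OscLip Y b K φ →
      OscLip Y b (ρ * K) ((branchTransfer p y 1)^[N'] φ) := by
    intro K hK φ hφ z hz z' hz'
    rcases le_total (|z - z'| / b) 1 with hle | hle
    · rw [min_eq_right hle, hN', Function.iterate_succ_apply']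
      refine (hlip _ K hK (hpres K hK φ hφ N) z hz z' hz').trans ?_
      gcongr
      exact le_max_left _ _
    · rw [min_eq_left hle, mul_one]
      refine (S.norm_iterate_sub_le (fun w hw w' hw' => hφ.osc_le hK hw hw') N' z hz z'
        hz').trans ?_
      have h1 : ‖φ ((y 0)^[N'] z) - φ ((y 0)^[N'] z')‖ ≤ K * (1 / 2) := by
        refine (hφ _ (S.iterate_branch_mem N' hz) _ (S.iterate_branch_mem N' hz')).trans ?_
        refine mul_le_mul_of_nonneg_left ((min_le_right _ _).trans ?_) hK
        rw [div_le_iff₀ hb]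
        refine (S.iterate_branch_contract N' hz hz').trans ?_
        have := mul_le_mul hNs (S.abs_sub_le_one z hz z' hz') (abs_nonneg _) (by positivity)
        linarith
      have h2 := mul_le_mul_of_nonneg_left h1 hδN.le
      have h3 : (1 - δ ^ N' / 2) * K ≤ ρ * K :=
        mul_le_mul_of_nonneg_right (le_max_right _ _) hK
      linarith
  have hiter : ∀ (j : ℕ) (K : ℝ), 0 ≤ K → ∀ (φ : ℝ → ℂ), OscLip Y b K φ →
      OscLip Y b (ρ ^ j * K) ((branchTransfer p y 1)^[N' * j] φ) := by
    intro j
    induction j with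
    | zero => intro K _ φ hφ; simpa using hφ
    | succ j ih =>
      intro K hK φ hφ
      have := hcontr _ (by positivity) _ (ih K hK φ hφ)
      rwa [← Function.iterate_add_apply, ← mul_assoc, ← pow_succ',
        add_comm N' (N' * j), ← Nat.mul_succ] at this
  have hN'0 : (N' : ℝ) ≠ 0 := by positivity
  refine ⟨b, ρ⁻¹, ρ ^ (1 / (N' : ℝ)), hb, by positivity, by positivity,
    Real.rpow_lt_one hρ0.le hρ1 (by positivity), fun φ K hK hφ m => ?_⟩
  have h1 := hpres _ (by positivity) _ (hiter (m / N') K hK φ hφ) (m % N')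
  rw [← Function.iterate_add_apply, Nat.mod_add_div] at h1
  intro z hz z' hz'
  refine (h1 z hz z' hz').trans ?_
  gcongr
  rw [← Real.rpow_natCast, ← Real.rpow_natCast, ← Real.rpow_mul hρ0.le, ← Real.rpow_neg_one ρ,
    ← Real.rpow_add hρ0]
  refine Real.rpow_le_rpow_of_exponent_ge hρ0 hρ1.le ?_
  have h2 : m < N' * (m / N' + 1) := by
    have := Nat.mod_add_div m N'
    have := Nat.mod_lt m (by omega : N' > 0)
    rw [Nat.mul_succ]; omega
  have h3 : (m : ℝ) ≤ N' * ((m / N' : ℕ) + 1) := by exact_mod_cast h2.le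
  have h4 : 1 / (N' : ℝ) * m ≤ (m / N' : ℕ) + 1 := by
    rw [one_div, inv_mul_le_iff₀ (by positivity)]
    exact h3
  linarith

end ReturnSystem

theorem norm_exp_I_mul_sub_one_le_rpow {β : ℝ} (hβ0 : 0 < β) (hβ1 : β ≤ 1) (x : ℝ) :
    ‖Complex.exp (Complex.I * x) - 1‖ ≤ 2 * |x| ^ β := by
  rcases le_total |x| 1 with h | h
  · rcases eq_or_ne x 0 with rfl | hx
    · simp [Real.zero_rpow hβ0.ne']
    have h1 : ‖Complex.exp (Complex.I * x) - 1‖ ≤ |x| := by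
      simpa using Real.norm_exp_I_mul_ofReal_sub_one_le (x := x)
    have h2 : |x| ≤ |x| ^ β := by
      simpa using Real.rpow_le_rpow_of_exponent_ge (abs_pos.mpr hx) h hβ1
    linarith [abs_nonneg x]
  · have h1 : ‖Complex.exp (Complex.I * x) - 1‖ ≤ 2 := by
      refine (norm_sub_le _ _).trans ?_
      rw [mul_comm, Complex.norm_exp_ofReal_mul_I]
      norm_num
    have h2 : 1 ≤ |x| ^ β := Real.one_le_rpow h hβ0.le
    linarith

namespace ReturnSystem

variable {ν : Measure ℝ} {Y : Set ℝ} {F : ℝ → ℝ} {τ : ℝ → ℕ} {p y : ℕ → ℝ → ℝ} {q : ℕ → ℝ}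
  {κ δ : ℝ}

theorem integrable_of_continuousOn (S : ReturnSystem ν Y F τ p y q κ δ) [IsProbabilityMeasure ν]
    {u : ℝ → ℂ} {A : ℝ} (hu : ContinuousOn u Y) (hA : ∀ z ∈ Y, ‖u z‖ ≤ A) : Integrable u ν := by
  refine Integrable.of_bound (C := A) ?_ (S.ae_mem.mono hA)
  have := hu.aestronglyMeasurable (μ := ν) S.measurableSet
  rwa [Measure.restrict_eq_self_of_ae_mem S.ae_mem] at this

theorem integrable_mul_of_continuousOn (S : ReturnSystem ν Y F τ p y q κ δ)
    [IsProbabilityMeasure ν] {u Φ : ℝ → ℂ} {A : ℝ} (hu : ContinuousOn u Y)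
    (hA : ∀ z ∈ Y, ‖u z‖ ≤ A) (hΦ : Measurable Φ) (hΦ1 : ∀ z, ‖Φ z‖ ≤ 1) :
    Integrable (fun z => u z * Φ z) ν :=
  (S.integrable_of_continuousOn hu hA).mul_bdd hΦ.aestronglyMeasurable (ae_of_all _ hΦ1)

theorem norm_twisted_le (S : ReturnSystem ν Y F τ p y q κ δ) {c : ℕ → ℂ} {u : ℝ → ℂ} {w : ℕ → ℝ}
    {W A : ℝ} (hc : ∀ k, ‖c (k + 1)‖ ≤ w k) (hw : HasSum (fun k => q k * w k) W)
    (hu : ∀ z ∈ Y, ‖u z‖ ≤ A) {z : ℝ} (hz : z ∈ Y) :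
    ‖branchTransfer p y c u z‖ ≤ W * A := by
  refine tsum_of_norm_bounded (hw.mul_right A) fun k => ?_
  rw [norm_mul, norm_mul, Complex.norm_real, Real.norm_of_nonneg (S.weight_nonneg k z hz),
    mul_assoc (q k)]
  have hwk := (norm_nonneg _).trans (hc k)
  exact mul_le_mul (S.weight_le k z hz) (mul_le_mul (hc k) (hu _ (S.branch_mem k z hz))
    (norm_nonneg _) hwk) (by positivity) (S.dominating_nonneg k)

theorem twisted_one_sub_one (S : ReturnSystem ν Y F τ p y q κ δ) {c : ℕ → ℂ} {B : ℝ}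
    (hc : ∀ k, ‖c k‖ ≤ B) {z : ℝ} (hz : z ∈ Y) :
    branchTransfer p y c (fun _ => 1) z - 1 =
      branchTransfer p y (fun k => c k - 1) (fun _ => 1) z := by
  have h1 := S.summable_twisted (u := fun _ => 1) (A := 1) hc (fun _ _ => by simp) hz
  have h2 := Complex.hasSum_ofReal.mpr (S.weight_hasSum z hz)
  rw [Complex.ofReal_one] at h2
  refine (h1.hasSum.sub h2).tsum_eq.symm.trans (tsum_congr fun k => ?_)
  ring

theorem norm_twisted_one_sub_le (S : ReturnSystem ν Y F τ p y q κ δ) {c : ℕ → ℂ} {w : ℕ → ℝ}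
    {B W : ℝ} (hcB : ∀ k, ‖c k‖ ≤ B) (hc : ∀ k, ‖c (k + 1) - 1‖ ≤ w k)
    (hw : HasSum (fun k => q k * w k) W) {z z' : ℝ} (hz : z ∈ Y) (hz' : z' ∈ Y) :
    ‖branchTransfer p y c (fun _ => 1) z - branchTransfer p y c (fun _ => 1) z'‖ ≤
      W * |z - z'| := by
  have hs : ∀ x ∈ Y, Summable fun k => (p k x : ℂ) * ((c (k + 1) - 1) * 1) := fun x hx =>
    S.summable_twisted (c := fun k => c k - 1) (u := fun _ => 1) (A := 1) (B := B + 1)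
      (fun k => (norm_sub_le _ _).trans (by rw [norm_one]; linarith [hcB k]))
      (fun _ _ => by simp) hx
  rw [← sub_sub_sub_cancel_right _ _ 1, S.twisted_one_sub_one hcB hz,
    S.twisted_one_sub_one hcB hz', branchTransfer, branchTransfer, ← (hs z hz).tsum_sub (hs z' hz')]
  refine tsum_of_norm_bounded (hw.mul_right _) fun k => ?_
  have : (p k z : ℂ) * ((c (k + 1) - 1) * 1) - (p k z' : ℂ) * ((c (k + 1) - 1) * 1) =
      ((p k z - p k z' : ℝ) : ℂ) * (c (k + 1) - 1) := by
    push_cast; ring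
  rw [this, norm_mul, Complex.norm_real]
  calc _ ≤ q k * |z - z'| * w k := mul_le_mul (S.weight_lipschitz k z hz z' hz') (hc k)
        (norm_nonneg _) (mul_nonneg (S.dominating_nonneg k) (abs_nonneg _))
    _ = _ := by ring

set_option maxHeartbeats 1000000 in
/-- Along the orbit of a return system, the expectation of a product of the unimodular factors
`exp (i s (τ - ℓ))` is close to the power of the expectation of a single factor. -/
theorem exists_norm_integral_prod_sub_pow_le (S : ReturnSystem ν Y F τ p y q κ δ)
    [IsProbabilityMeasure ν] {β : ℝ} (ℓ : ℝ) (hβ0 : 0 < β) (hβ1 : β ≤ 1)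
    (hsum : Summable fun k : ℕ => q k * ((k : ℝ) + 1) ^ β) :
    ∃ C : ℝ, ∀ s : ℝ, s ≠ 0 → ∀ n : ℕ,
      ‖(∫ z, ∏ j ∈ Finset.range n,
          Complex.exp (Complex.I * ((s * ((τ (F^[j] z) : ℝ) - ℓ) : ℝ) : ℂ)) ∂ν) -
        (∫ z, Complex.exp (Complex.I * ((s * ((τ z : ℝ) - ℓ) : ℝ) : ℂ)) ∂ν) ^ n‖ ≤
      C * (|s| ^ β + n * (|s| ^ β) ^ 2) := by
  obtain ⟨b, C, r, hb, hC, hr0, hr1, hdecay⟩ := S.exists_oscLip_iterate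
  set W₀ : ℝ := 2 * (1 + |ℓ|) ^ β * ∑' k : ℕ, q k * ((k : ℝ) + 1) ^ β with hW₀
  have hW₀0 : 0 ≤ W₀ := mul_nonneg (by positivity) (tsum_nonneg fun k =>
    mul_nonneg (S.dominating_nonneg k) (by positivity))
  set H : ℝ := W₀ * (2 + b) with hH
  have hH0 : 0 ≤ H := by positivity
  set V : ℝ := C * H * (1 - r)⁻¹ with hV
  have h1r : 0 < 1 - r := by linarith
  have hV0 : 0 ≤ V := by positivity
  refine ⟨3 * V + (C * H + 2 * W₀ * V), fun s hs n => ?_⟩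
  set σ : ℝ := |s| ^ β with hσ
  have hσ0 : 0 < σ := Real.rpow_pos_of_pos (abs_pos.mpr hs) β
  let c : ℕ → ℂ := fun k => Complex.exp (Complex.I * ((s * ((k : ℝ) - ℓ) : ℝ) : ℂ))
  have hc : ∀ k, ‖c k‖ = 1 := fun k => by
    simp only [c]
    rw [mul_comm, Complex.norm_exp_ofReal_mul_I]
  have hc1 : ∀ k, ‖c k‖ ≤ 1 := fun k => (hc k).le
  have hone : ∀ k : ℕ, ‖(1 : ℕ → ℂ) k‖ ≤ 1 := fun k => by simp
  let w : ℕ → ℝ := fun k => 2 * (1 + |ℓ|) ^ β * ((k : ℝ) + 1) ^ β * σ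
  have hw : HasSum (fun k => q k * w k) (W₀ * σ) := by
    have := (hsum.hasSum.mul_left (2 * (1 + |ℓ|) ^ β)).mul_right σ
    have e : (fun k => q k * w k) =
        fun k : ℕ => 2 * (1 + |ℓ|) ^ β * (q k * ((k : ℝ) + 1) ^ β) * σ := by
      funext k; simp only [w]; ring
    rw [e]
    exact this
  have hcw : ∀ k, ‖c (k + 1) - 1‖ ≤ w k := fun k => by
    refine (norm_exp_I_mul_sub_one_le_rpow hβ0 hβ1 _).trans ?_
    rw [abs_mul, Real.mul_rpow (abs_nonneg _) (abs_nonneg _)]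
    have h1 : |((k + 1 : ℕ) : ℝ) - ℓ| ≤ (1 + |ℓ|) * ((k : ℝ) + 1) := by
      refine (abs_sub _ _).trans ?_
      rw [abs_of_nonneg (by positivity)]
      push_cast
      nlinarith [abs_nonneg ℓ, (Nat.cast_nonneg k : (0 : ℝ) ≤ k)]
    have h2 := Real.rpow_le_rpow (abs_nonneg _) h1 hβ0.le
    rw [Real.mul_rpow (by positivity) (by positivity)] at h2
    simp only [w]
    nlinarith
  set lam : ℂ := ∫ z, c (τ z) ∂ν with hlam
  have hlam1 : ‖lam‖ ≤ 1 := by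
    refine (norm_integral_le_of_norm_le_const (ae_of_all _ fun z => hc1 (τ z))).trans ?_
    simp
  have hone_cont : ContinuousOn (fun _ : ℝ => (1 : ℂ)) Y := continuousOn_const
  have htw_cont : ∀ (d : ℕ → ℂ) (B : ℝ) (u : ℝ → ℂ) (A A' : ℝ), 0 ≤ B → 0 ≤ A' → (∀ k, ‖d k‖ ≤ B) →
      (∀ z ∈ Y, ‖u z‖ ≤ A) → (∀ z ∈ Y, ∀ z' ∈ Y, ‖u z - u z'‖ ≤ A' * |z - z'|) →
      ContinuousOn (branchTransfer p y d u) Y := fun d B u A A' hB hA' hd hu hl =>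
    continuousOn_of_norm_sub_le fun z hz z' hz' => S.norm_twisted_sub_le hB hA' hd hu hl hz hz'
  have hbd1 : ∀ z ∈ Y, ‖branchTransfer p y c (fun _ => 1) z - 1‖ ≤ W₀ * σ := fun z hz => by
    rw [S.twisted_one_sub_one hc1 hz]
    simpa using S.norm_twisted_le (u := fun _ => 1) (A := 1) hcw hw (fun _ _ => by simp) hz
  have hlip1 : ∀ z ∈ Y, ∀ z' ∈ Y, ‖branchTransfer p y c (fun _ => 1) z -
      branchTransfer p y c (fun _ => 1) z'‖ ≤ W₀ * σ * |z - z'| := fun z hz z' hz' =>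
    S.norm_twisted_one_sub_le hc1 hcw hw hz hz'
  have hcont1 : ContinuousOn (branchTransfer p y c (fun _ => 1)) Y :=
    continuousOn_of_norm_sub_le hlip1
  have hbd1' : ∀ z ∈ Y, ‖branchTransfer p y c (fun _ => 1) z‖ ≤ W₀ * σ + 1 := fun z hz => by
    have := norm_add_le (branchTransfer p y c (fun _ => 1) z - 1) 1
    rw [sub_add_cancel, norm_one] at this
    linarith [hbd1 z hz]
  have hint1 : Integrable (branchTransfer p y c (fun _ => 1)) ν :=
    S.integrable_of_continuousOn hcont1 hbd1'
  have hlam_eq : lam = ∫ z, branchTransfer p y c (fun _ => 1) z ∂ν := by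
    have := S.duality c (fun _ => 1) (fun _ => 1) 1 hc1 hone_cont (fun _ _ => by simp)
      measurable_const (fun _ => by simp)
    simpa using this
  have hlam_sub : ‖lam - 1‖ ≤ W₀ * σ := by
    have h1 : lam - 1 = ∫ z, (branchTransfer p y c (fun _ => 1) z - 1) ∂ν := by
      rw [integral_sub hint1 (integrable_const _), ← hlam_eq]; simp
    rw [h1]
    refine (norm_integral_le_of_norm_le_const (S.ae_mem.mono hbd1)).trans ?_
    simp
  let ψ : ℝ → ℂ := fun z => branchTransfer p y c (fun _ => 1) z - lam
  have hψ : OscLip Y b (H * σ) ψ := by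
    intro z hz z' hz'
    simp only [ψ]
    rw [sub_sub_sub_cancel_right, mul_min_of_nonneg _ _ (by positivity), mul_one]
    refine le_min ?_ ?_
    · have h1 := norm_sub_le (branchTransfer p y c (fun _ => 1) z - 1)
        (branchTransfer p y c (fun _ => 1) z' - 1)
      rw [sub_sub_sub_cancel_right] at h1
      have : H * σ = 2 * (W₀ * σ) + b * (W₀ * σ) := by rw [hH]; ring
      have : 0 ≤ b * (W₀ * σ) := by positivity
      linarith [hbd1 z hz, hbd1 z' hz']
    · refine (hlip1 z hz z' hz').trans ?_
      rw [mul_div_assoc', le_div_iff₀ hb]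
      have : H * σ * |z - z'| = W₀ * σ * |z - z'| * b + 2 * (W₀ * σ * |z - z'|) := by
        rw [hH]; ring
      have : 0 ≤ W₀ * σ * |z - z'| := by positivity
      linarith
  have hHσ : 0 ≤ H * σ := by positivity
  have hiter := hdecay ψ (H * σ) hHσ hψ
  have hK0 : ∀ m, 0 ≤ C * r ^ m * (H * σ) := fun m => by positivity
  have hbdd : ∀ m, ∃ A, ∀ z ∈ Y, ‖(branchTransfer p y 1)^[m] ψ z‖ ≤ A := fun m => by
    rcases Y.eq_empty_or_nonempty with rfl | ⟨z₀, hz₀⟩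
    · exact ⟨0, fun z hz => absurd hz (notMem_empty z)⟩
    refine ⟨C * r ^ m * (H * σ) + ‖(branchTransfer p y 1)^[m] ψ z₀‖, fun z hz => ?_⟩
    have := norm_add_le ((branchTransfer p y 1)^[m] ψ z - (branchTransfer p y 1)^[m] ψ z₀)
      ((branchTransfer p y 1)^[m] ψ z₀)
    rw [sub_add_cancel] at this
    linarith [(hiter m).osc_le (hK0 m) hz hz₀]
  have hicont : ∀ m, ContinuousOn ((branchTransfer p y 1)^[m] ψ) Y := fun m =>
    continuousOn_of_norm_sub_le fun z hz z' hz' => (hiter m).lip_le (hK0 m) hz hz'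
  have hmean : ∀ m, ∫ z, (branchTransfer p y 1)^[m] ψ z ∂ν = 0 := by
    intro m
    induction m with
    | zero =>
      simp only [Function.iterate_zero, id_eq, ψ]
      rw [integral_sub hint1 (integrable_const _), ← hlam_eq]; simp
    | succ m ih =>
      obtain ⟨A, hA⟩ := hbdd m
      have := S.duality 1 ((branchTransfer p y 1)^[m] ψ) (fun _ => 1) (max 1 A)
        (fun k => (hone k).trans (le_max_left _ _)) (hicont m)
        (fun z hz => (hA z hz).trans (le_max_right _ _)) measurable_const (fun _ => by simp)
      simp only [mul_one, Pi.one_apply, one_mul] at this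
      rw [Function.iterate_succ_apply', ← this, ih]
  have hsup : ∀ m, ∀ z ∈ Y, ‖(branchTransfer p y 1)^[m] ψ z‖ ≤ C * r ^ m * (H * σ) := by
    intro m z hz
    obtain ⟨A, hA⟩ := hbdd m
    have hi := S.integrable_of_continuousOn (hicont m) hA
    have h1 : (branchTransfer p y 1)^[m] ψ z =
        ∫ x, ((branchTransfer p y 1)^[m] ψ z - (branchTransfer p y 1)^[m] ψ x) ∂ν := by
      rw [integral_sub (integrable_const _) hi, hmean m]; simp
    rw [h1]
    refine (norm_integral_le_of_norm_le_const (S.ae_mem.mono fun x hx =>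
      (hiter m).osc_le (hK0 m) hz hx)).trans ?_
    simp
  obtain ⟨M, hM⟩ : ∃ M : ℕ, r ^ M < σ := exists_pow_lt_of_lt_one hσ0 hr1
  -- the approximate solution of the Poisson equation
  let v : ℝ → ℂ := fun z => ∑ m ∈ Finset.range M, (branchTransfer p y 1)^[m] ψ z
  have hgeom : ∑ m ∈ Finset.range M, C * r ^ m * (H * σ) ≤ V * σ := by
    have h1 : ∑ m ∈ Finset.range M, r ^ m ≤ (1 - r)⁻¹ := by
      rw [← tsum_geometric_of_lt_one hr0.le hr1]
      exact (summable_geometric_of_lt_one hr0.le hr1).sum_le_tsum _ fun m _ => by positivity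
    calc _ = (C * H * σ) * ∑ m ∈ Finset.range M, r ^ m := by
          rw [Finset.mul_sum]; exact Finset.sum_congr rfl fun m _ => by ring
      _ ≤ (C * H * σ) * (1 - r)⁻¹ := mul_le_mul_of_nonneg_left h1 (by positivity)
      _ = _ := by rw [hV]; ring
  have hv : ∀ z ∈ Y, ‖v z‖ ≤ V * σ := fun z hz =>
    (norm_sum_le_of_le _ fun m _ => hsup m z hz).trans hgeom
  have hvlip : ∀ z ∈ Y, ∀ z' ∈ Y, ‖v z - v z'‖ ≤ V * σ / b * |z - z'| := by
    intro z hz z' hz'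
    simp only [v]
    rw [← Finset.sum_sub_distrib]
    refine (norm_sum_le_of_le _ fun m _ => (hiter m).lip_le (hK0 m) hz hz').trans ?_
    rw [← Finset.sum_mul, ← Finset.sum_div]
    gcongr
  have hvcont : ContinuousOn v Y := continuousOn_of_norm_sub_le hvlip
  have hPv : ∀ z ∈ Y, branchTransfer p y 1 v z = v z - ψ z + (branchTransfer p y 1)^[M] ψ z := by
    intro z hz
    have h1 : branchTransfer p y 1 v z =
        ∑ m ∈ Finset.range M, (branchTransfer p y 1)^[m + 1] ψ z := by
      simp only [branchTransfer, v, Finset.mul_sum]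
      rw [Summable.tsum_finsetSum]
      · exact Finset.sum_congr rfl fun m _ => by rw [Function.iterate_succ_apply']; rfl
      · intro m _
        obtain ⟨A, hA⟩ := hbdd m
        exact S.summable_twisted hone hA hz
    have h2 := Finset.sum_range_succ' (fun m => (branchTransfer p y 1)^[m] ψ z) M
    rw [Finset.sum_range_succ] at h2
    simp only [Function.iterate_zero, id_eq] at h2
    rw [h1, eq_sub_of_add_eq h2.symm]
    simp only [v]
    ring
  let u : ℝ → ℂ := fun z => 1 + v z
  have hubd : ∀ z ∈ Y, ‖u z‖ ≤ 1 + V * σ := fun z hz => by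
    refine (norm_add_le _ _).trans ?_
    rw [norm_one]
    linarith [hv z hz]
  have hucont : ContinuousOn u Y := continuousOn_const.add hvcont
  have hulip : ∀ z ∈ Y, ∀ z' ∈ Y, ‖u z - u z'‖ ≤ V * σ / b * |z - z'| := fun z hz z' hz' => by
    simp only [u]
    rw [add_sub_add_left_eq_sub]
    exact hvlip z hz z' hz'
  set ε : ℝ := (C * H + 2 * W₀ * V) * σ ^ 2 with hε
  have hdefect : ∀ z ∈ Y, ‖branchTransfer p y c u z - lam * u z‖ ≤ ε := by
    intro z hz
    have e1 : branchTransfer p y c u z =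
        branchTransfer p y c (fun _ => 1) z + branchTransfer p y 1 v z +
          branchTransfer p y (fun k => c k - 1) v z := by
      have s1 := S.summable_twisted (u := fun _ => 1) (A := 1) hc1 (fun _ _ => by simp) hz
      have s2 := S.summable_twisted hone hv hz
      have s3 := S.summable_twisted (c := fun k => c k - 1) (B := 2)
        (fun k => (norm_sub_le _ _).trans (by rw [hc, norm_one]; norm_num)) hv hz
      simp only [branchTransfer]
      rw [← s1.tsum_add s2, ← (s1.add s2).tsum_add s3]
      refine tsum_congr fun k => ?_
      simp only [u, Pi.one_apply]
      ring
    have e2 : branchTransfer p y c u z - lam * u z = (branchTransfer p y 1)^[M] ψ z +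
        branchTransfer p y (fun k => c k - 1) v z - (lam - 1) * v z := by
      rw [e1, hPv z hz]
      simp only [u, ψ]
      ring
    rw [e2]
    have b1 := hsup M z hz
    have b2 := S.norm_twisted_le (c := fun k => c k - 1) hcw hw hv hz
    have b3 : ‖(lam - 1) * v z‖ ≤ W₀ * σ * (V * σ) := by
      rw [norm_mul]
      exact mul_le_mul hlam_sub (hv z hz) (norm_nonneg _) (by positivity)
    have b4 : C * r ^ M * (H * σ) ≤ C * σ * (H * σ) := by gcongr
    have b5 := norm_sub_le ((branchTransfer p y 1)^[M] ψ z +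
        branchTransfer p y (fun k => c k - 1) v z) ((lam - 1) * v z)
    have b6 := norm_add_le ((branchTransfer p y 1)^[M] ψ z)
        (branchTransfer p y (fun k => c k - 1) v z)
    have b7 : ε = C * σ * (H * σ) + W₀ * σ * (V * σ) + W₀ * σ * (V * σ) := by rw [hε]; ring
    linarith
  let Φ : ℕ → ℝ → ℂ := fun j z => ∏ i ∈ Finset.range j, c (τ (F^[i] z))
  have hΦm : ∀ j, Measurable (Φ j) := fun j => by
    refine Finset.measurable_prod _ fun i _ => ?_
    exact (measurable_of_countable c).comp (S.measurable_time.comp (S.measurable_map.iterate i))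
  have hΦ1 : ∀ j z, ‖Φ j z‖ ≤ 1 := fun j z => by
    simp only [Φ, norm_prod, hc, Finset.prod_const_one, le_refl]
  have hPu_cont : ContinuousOn (branchTransfer p y c u) Y :=
    htw_cont c 1 u _ _ zero_le_one (by positivity) hc1 hubd hulip
  have hPu_bd : ∀ z ∈ Y, ‖branchTransfer p y c u z‖ ≤ ε + 1 * (1 + V * σ) := fun z hz => by
    have h1 := norm_add_le (branchTransfer p y c u z - lam * u z) (lam * u z)
    rw [sub_add_cancel] at h1
    have h2 : ‖lam * u z‖ ≤ 1 * (1 + V * σ) := by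
      rw [norm_mul]
      exact mul_le_mul hlam1 (hubd z hz) (norm_nonneg _) zero_le_one
    linarith [hdefect z hz]
  let a : ℕ → ℂ := fun j => ∫ z, u z * Φ j z ∂ν
  have hstep : ∀ j, ‖a (j + 1) - lam * a j‖ ≤ ε := by
    intro j
    have h1 : a (j + 1) = ∫ z, branchTransfer p y c u z * Φ j z ∂ν := by
      have hd := S.duality c u (Φ j) (1 + V * σ)
        (fun k => (hc1 k).trans (by linarith [mul_nonneg hV0 hσ0.le])) hucont hubd (hΦm j) (hΦ1 j)
      rw [← hd]
      refine integral_congr_ae (ae_of_all _ fun z => ?_)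
      simp only [Φ, Finset.prod_range_succ']
      simp only [Function.iterate_succ_apply, Function.iterate_zero, id_eq]
      ring
    have h2 : a (j + 1) - lam * a j =
        ∫ z, (branchTransfer p y c u z - lam * u z) * Φ j z ∂ν := by
      rw [h1]
      simp only [a]
      rw [← integral_const_mul, ← integral_sub
        (S.integrable_mul_of_continuousOn hPu_cont hPu_bd (hΦm j) (hΦ1 j))
        ((S.integrable_mul_of_continuousOn hucont hubd (hΦm j) (hΦ1 j)).const_mul _)]
      exact integral_congr_ae (ae_of_all _ fun z => by simp only; ring)
    rw [h2]
    refine (norm_integral_le_of_norm_le_const (C := ε) (S.ae_mem.mono fun z hz => ?_)).trans ?_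
    · rw [norm_mul]
      have := mul_le_mul (hdefect z hz) (hΦ1 j z) (norm_nonneg _)
        ((norm_nonneg _).trans (hdefect z hz))
      linarith
    · simp
  have hpow : ∀ j : ℕ, ‖a j - lam ^ j * a 0‖ ≤ j * ε := by
    intro j
    induction j with
    | zero => simp
    | succ j ih =>
      have h1 : a (j + 1) - lam ^ (j + 1) * a 0 =
          (a (j + 1) - lam * a j) + lam * (a j - lam ^ j * a 0) := by ring
      rw [h1]
      refine (norm_add_le _ _).trans ?_
      rw [norm_mul]
      have := mul_le_mul hlam1 ih (norm_nonneg _) zero_le_one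
      push_cast
      linarith [hstep j]
  have hvΦ : ∀ j, ‖∫ z, v z * Φ j z ∂ν‖ ≤ V * σ := fun j => by
    refine (norm_integral_le_of_norm_le_const (C := V * σ) (S.ae_mem.mono fun z hz => ?_)).trans ?_
    · rw [norm_mul]
      have := mul_le_mul (hv z hz) (hΦ1 j z) (norm_nonneg _) (by positivity)
      linarith
    · simp
  have ha : ∀ j, a j = ∫ z, Φ j z ∂ν + ∫ z, v z * Φ j z ∂ν := fun j => by
    simp only [a, u, add_mul, one_mul]
    refine integral_add ?_ (S.integrable_mul_of_continuousOn hvcont hv (hΦm j) (hΦ1 j))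
    exact Integrable.of_bound (hΦm j).aestronglyMeasurable 1 (ae_of_all _ (hΦ1 j))
  have ha0 : a 0 = 1 + ∫ z, v z * Φ 0 z ∂ν := by
    rw [ha 0]; simp [Φ]
  change ‖∫ z, Φ n z ∂ν - lam ^ n‖ ≤ _
  have hfin : ∫ z, Φ n z ∂ν - lam ^ n = (a n - lam ^ n * a 0) - (∫ z, v z * Φ n z ∂ν) +
      lam ^ n * ∫ z, v z * Φ 0 z ∂ν := by
    rw [ha0, ha n]; ring
  rw [hfin]
  have t1 := norm_add_le ((a n - lam ^ n * a 0) - (∫ z, v z * Φ n z ∂ν))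
    (lam ^ n * ∫ z, v z * Φ 0 z ∂ν)
  have t2 := norm_sub_le (a n - lam ^ n * a 0) (∫ z, v z * Φ n z ∂ν)
  have t3 : ‖lam ^ n * ∫ z, v z * Φ 0 z ∂ν‖ ≤ 1 * (V * σ) := by
    rw [norm_mul, norm_pow]
    exact mul_le_mul (pow_le_one₀ (norm_nonneg _) hlam1) (hvΦ 0) (norm_nonneg _) zero_le_one
  have t4 : (3 * V + (C * H + 2 * W₀ * V)) * (σ + n * σ ^ 2) =
      n * ε + 2 * (V * σ) + (V * σ + (C * H + 2 * W₀ * V) * σ + 3 * V * (n * σ ^ 2)) := by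
    rw [hε]; ring
  have t5 : 0 ≤ V * σ + (C * H + 2 * W₀ * V) * σ + 3 * V * (n * σ ^ 2) := by positivity
  linarith [hpow n, hvΦ n]

end ReturnSystem

/-! ### Characteristic functions of regularly varying laws -/

lemma integrableOn_min_rpow {p q : ℝ} (hp : -1 < p) (hq : q < -1) :
    IntegrableOn (fun u : ℝ => min (u ^ p) (u ^ q)) (Ioi 0) := by
  have hm : Measurable fun u : ℝ => min (u ^ p) (u ^ q) :=
    (measurable_id.pow_const p).min (measurable_id.pow_const q)
  rw [← Ioc_union_Ioi_eq_Ioi (zero_le_one (α := ℝ))]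
  refine IntegrableOn.union ?_ ?_
  · have h1 : IntegrableOn (fun u : ℝ => u ^ p) (Ioc 0 1) :=
      (intervalIntegrable_iff_integrableOn_Ioc_of_le zero_le_one).1
        (intervalIntegral.intervalIntegrable_rpow' hp)
    refine Integrable.mono' h1 hm.aestronglyMeasurable ?_
    filter_upwards [ae_restrict_mem measurableSet_Ioc] with u hu
    rw [Real.norm_of_nonneg (le_min (rpow_nonneg hu.1.le _) (rpow_nonneg hu.1.le _))]
    exact min_le_left _ _
  · have h1 : IntegrableOn (fun u : ℝ => u ^ q) (Ioi 1) :=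
      integrableOn_Ioi_rpow_of_lt hq zero_lt_one
    refine Integrable.mono' h1 hm.aestronglyMeasurable ?_
    filter_upwards [ae_restrict_mem measurableSet_Ioi] with u hu
    have hu0 : (0 : ℝ) ≤ u := zero_le_one.trans (le_of_lt hu)
    rw [Real.norm_of_nonneg (le_min (rpow_nonneg hu0 _) (rpow_nonneg hu0 _))]
    exact min_le_right _ _

/-- The Laplace transform of `u ^ (s - 1)` on the open right half-plane. -/
lemma integral_exp_neg_mul_rpow_Ioi {s : ℝ} (hs : 0 < s) {r : ℂ} (hr : 0 < r.re) :
    ∫ u in Ioi (0 : ℝ), Complex.exp (-(r * u)) * ((u ^ (s - 1) : ℝ) : ℂ)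
      = r ^ (-(s : ℂ)) * (Real.Gamma s : ℂ) := by
  set ρ : Measure ℝ := (volume.restrict (Ioi (0 : ℝ))).withDensity
    (fun u => ENNReal.ofReal (u ^ (s - 1))) with hρ
  have hmeas : Measurable fun u : ℝ => (u ^ (s - 1)).toNNReal :=
    (measurable_id.pow_const (s - 1)).real_toNNReal
  have hmgf : ∀ z : ℂ, ProbabilityTheory.complexMGF id ρ z =
      ∫ u in Ioi (0 : ℝ), Complex.exp (z * u) * ((u ^ (s - 1) : ℝ) : ℂ) := by
    intro z
    rw [ProbabilityTheory.complexMGF, hρ]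
    have : (fun u : ℝ => ENNReal.ofReal (u ^ (s - 1)))
        = fun u => ((u ^ (s - 1)).toNNReal : ENNReal) := rfl
    rw [this, integral_withDensity_eq_integral_smul hmeas]
    refine setIntegral_congr_fun measurableSet_Ioi fun u hu => ?_
    simp only [id, NNReal.smul_def, Complex.real_smul]
    rw [Real.coe_toNNReal _ (rpow_nonneg (le_of_lt hu) _), mul_comm]
  have hset : ∀ x : ℝ, x < 0 → x ∈ ProbabilityTheory.integrableExpSet id ρ := by
    intro x hx
    simp only [ProbabilityTheory.integrableExpSet, mem_ofPred_eq, hρ]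
    have : (fun u : ℝ => ENNReal.ofReal (u ^ (s - 1)))
        = fun u => ((u ^ (s - 1)).toNNReal : ENNReal) := rfl
    rw [this, integrable_withDensity_iff_integrable_smul hmeas]
    have h1 := integrableOn_rpow_mul_exp_neg_mul_rpow (p := 1) (s := s - 1) (b := -x)
      (by linarith) zero_lt_one (by linarith)
    refine (integrableOn_congr_fun (fun u hu => ?_) measurableSet_Ioi).1 h1
    simp only [id, NNReal.smul_def, rpow_one, neg_neg, smul_eq_mul]
    rw [Real.coe_toNNReal _ (rpow_nonneg (le_of_lt hu) _)]
  have hintg : ∀ z : ℂ, 0 < z.re →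
      (-z).re ∈ interior (ProbabilityTheory.integrableExpSet id ρ) := by
    intro z hz
    refine mem_interior.2 ⟨Iio 0, fun x hx => hset x hx, isOpen_Iio, ?_⟩
    simpa using hz
  let U : Set ℂ := {z | 0 < z.re}
  have hU : IsOpen U := isOpen_lt continuous_const Complex.continuous_re
  have hf : AnalyticOnNhd ℂ (fun z => ProbabilityTheory.complexMGF id ρ (-z)) U := by
    intro z hz
    exact (ProbabilityTheory.analyticAt_complexMGF (hintg z hz)).fun_comp analyticAt_id.neg
  have hg : AnalyticOnNhd ℂ (fun z : ℂ => z ^ (-(s : ℂ)) * (Real.Gamma s : ℂ)) U := by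
    intro z hz
    exact (analyticAt_id.cpow analyticAt_const (Or.inl hz)).mul analyticAt_const
  have hconv : IsPreconnected U := (convex_halfSpace_re_gt 0).isPreconnected
  have hreal : ∀ x : ℝ, 0 < x → ProbabilityTheory.complexMGF id ρ (-(x : ℂ))
      = (x : ℂ) ^ (-(s : ℂ)) * (Real.Gamma s : ℂ) := by
    intro x hx
    have h := Complex.integral_cpow_mul_exp_neg_mul_Ioi (a := (s : ℂ)) (r := x) (by simpa) hx
    rw [hmgf, ← Complex.Gamma_ofReal]
    rw [one_div, Complex.inv_cpow _ _ (by rw [Complex.arg_ofReal_of_nonneg hx.le]; exact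
      pi_pos.ne), ← Complex.cpow_neg] at h
    rw [← h]
    refine setIntegral_congr_fun measurableSet_Ioi fun u hu => ?_
    rw [Complex.ofReal_cpow (le_of_lt hu), mul_comm, neg_mul]
    push_cast
    rfl
  have hfreq : ∃ᶠ z in 𝓝[≠] (1 : ℂ), ProbabilityTheory.complexMGF id ρ (-z)
      = z ^ (-(s : ℂ)) * (Real.Gamma s : ℂ) := by
    have ht : Tendsto (fun x : ℝ => (x : ℂ)) (𝓝[>] 1) (𝓝[≠] (1 : ℂ)) := by
      refine tendsto_nhdsWithin_iff.2 ⟨?_, ?_⟩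
      · have : Tendsto (fun x : ℝ => (x : ℂ)) (𝓝 1) (𝓝 ((1 : ℝ) : ℂ)) :=
          Complex.continuous_ofReal.tendsto 1
        simpa using this.mono_left nhdsWithin_le_nhds
      · filter_upwards [self_mem_nhdsWithin] with x hx
        simp only [mem_compl_iff, mem_singleton_iff]
        intro h
        have : x = 1 := by exact_mod_cast h
        exact (ne_of_gt hx) this
    refine ht.frequently (Eventually.frequently ?_)
    filter_upwards [self_mem_nhdsWithin] with x hx
    exact hreal x (zero_lt_one.trans hx)
  have := AnalyticOnNhd.eqOn_of_preconnected_of_frequently_eq hf hg hconv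
    (show (1 : ℂ) ∈ U by simp [U]) hfreq hr
  simp only [hmgf] at this
  simpa [neg_mul] using this

lemma norm_exp_neg_sub_one_le {w : ℂ} (hw : 0 ≤ w.re) : ‖Complex.exp (-w) - 1‖ ≤ ‖w‖ := by
  have hconv : Convex ℝ {z : ℂ | z.re ≤ 0} := convex_halfSpace_re_le 0
  have := hconv.norm_image_sub_le_of_norm_hasDerivWithin_le (f := Complex.exp)
    (f' := Complex.exp) (C := 1) (x := 0) (y := -w)
    (fun z _ => (Complex.hasDerivAt_exp z).hasDerivWithinAt)
    (fun z hz => by rw [Complex.norm_exp]; exact Real.exp_le_one_iff.2 hz)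
    (by simp) (by simpa using hw)
  simpa using this

lemma norm_exp_neg_sub_one_le_two {w : ℂ} (hw : 0 ≤ w.re) : ‖Complex.exp (-w) - 1‖ ≤ 2 := by
  have h1 : ‖Complex.exp (-w)‖ ≤ 1 := by
    rw [Complex.norm_exp]; exact Real.exp_le_one_iff.2 (by simpa using hw)
  calc ‖Complex.exp (-w) - 1‖ ≤ ‖Complex.exp (-w)‖ + ‖(1 : ℂ)‖ := norm_sub_le _ _
    _ ≤ 2 := by rw [norm_one]; linarith

lemma hasDerivAt_neg_rpow_div {α u : ℝ} (hα : α ≠ 0) (hu : 0 < u) :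
    HasDerivAt (fun x : ℝ => ((-(x ^ (-α)) / α : ℝ) : ℂ)) ((u ^ (-α - 1) : ℝ) : ℂ) u := by
  have h := ((Real.hasDerivAt_rpow_const (p := -α) (Or.inl hu.ne')).neg.div_const α).ofReal_comp
  convert! h using 1
  congr 1
  field_simp

lemma tendsto_mul_neg_rpow_div_zero {α e C : ℝ} {f : ℝ → ℂ} (he : α < e)
    (hf : ∀ u : ℝ, 0 < u → ‖f u‖ ≤ C * u ^ e) :
    Tendsto (f * fun x : ℝ => ((-(x ^ (-α)) / α : ℝ) : ℂ)) (𝓝[>] 0) (𝓝 0) := by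
  have hC : Tendsto (fun u : ℝ => C / |α| * u ^ (e - α)) (𝓝[>] 0) (𝓝 0) := by
    have : Tendsto (fun u : ℝ => C / |α| * u ^ (e - α)) (𝓝 0) (𝓝 (C / |α| * 0 ^ (e - α))) :=
      ((Real.continuous_rpow_const (by linarith)).const_mul _).tendsto 0
    rw [Real.zero_rpow (by linarith), mul_zero] at this
    exact this.mono_left nhdsWithin_le_nhds
  refine squeeze_zero_norm' ?_ hC
  filter_upwards [self_mem_nhdsWithin] with u hu
  have hu : 0 < u := hu
  rw [Pi.mul_apply, norm_mul, Complex.norm_real, Real.norm_eq_abs, abs_div, abs_neg,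
    abs_of_nonneg (rpow_nonneg hu.le _), sub_eq_add_neg, rpow_add hu]
  calc ‖f u‖ * (u ^ (-α) / |α|) ≤ C * u ^ e * (u ^ (-α) / |α|) := by
        gcongr; exact hf u hu
    _ = _ := by ring

lemma tendsto_mul_neg_rpow_div_atTop {α e C : ℝ} {f : ℝ → ℂ} (he : e < α)
    (hf : ∀ u : ℝ, 0 < u → ‖f u‖ ≤ C * u ^ e) :
    Tendsto (f * fun x : ℝ => ((-(x ^ (-α)) / α : ℝ) : ℂ)) atTop (𝓝 0) := by
  have hC : Tendsto (fun u : ℝ => C / |α| * u ^ (-(α - e))) atTop (𝓝 0) := by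
    simpa using (tendsto_rpow_neg_atTop (by linarith : 0 < α - e)).const_mul (C / |α|)
  refine squeeze_zero_norm' ?_ hC
  filter_upwards [eventually_gt_atTop 0] with u hu
  rw [Pi.mul_apply, norm_mul, Complex.norm_real, Real.norm_eq_abs, abs_div, abs_neg,
    abs_of_nonneg (rpow_nonneg hu.le _), show -(α - e) = e + -α by ring, rpow_add hu]
  calc ‖f u‖ * (u ^ (-α) / |α|) ≤ C * u ^ e * (u ^ (-α) / |α|) := by
        gcongr; exact hf u hu
    _ = _ := by ring

/-- A function with growth between `u ^ e` and `u ^ (e + 1)` is integrable against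
`u ^ (-p)` for `e + 1 < p < e + 2`. -/
lemma integrableOn_mul_rpow_neg {e p C : ℝ} {f : ℝ → ℂ} (h1 : e + 1 < p) (h2 : p < e + 2)
    (hc : Measurable f) (hf : ∀ u : ℝ, 0 < u → ‖f u‖ ≤ C * u ^ e)
    (hf' : ∀ u : ℝ, 0 < u → ‖f u‖ ≤ C * u ^ (e + 1)) :
    IntegrableOn (fun u : ℝ => f u * ((u ^ (-p) : ℝ) : ℂ)) (Ioi 0) := by
  have hm : Measurable fun u : ℝ => f u * ((u ^ (-p) : ℝ) : ℂ) :=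
    hc.mul (Complex.measurable_ofReal.comp (measurable_id.pow_const _))
  refine Integrable.mono' ((integrableOn_min_rpow (p := e + 1 - p) (q := e - p)
    (by linarith) (by linarith)).const_mul C) hm.aestronglyMeasurable ?_
  filter_upwards [ae_restrict_mem measurableSet_Ioi] with u hu
  have hu : 0 < u := hu
  have hC : 0 ≤ C := by
    have := (norm_nonneg _).trans (hf 1 one_pos)
    simpa using this
  rw [norm_mul, Complex.norm_real, Real.norm_of_nonneg (rpow_nonneg hu.le _),
    mul_min_of_nonneg _ _ hC, sub_eq_add_neg, sub_eq_add_neg, rpow_add hu (e + 1) (-p),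
    rpow_add hu e (-p)]
  refine le_min ?_ ?_
  · rw [← mul_assoc]; gcongr; exact hf' u hu
  · rw [← mul_assoc]; gcongr; exact hf u hu

lemma integral_exp_neg_sub_one_mul_rpow {α : ℝ} (h0 : 0 < α) (h1 : α < 1) {r : ℂ}
    (hr : 0 < r.re) :
    ∫ u in Ioi (0 : ℝ), (Complex.exp (-(r * u)) - 1) * ((u ^ (-α - 1) : ℝ) : ℂ)
      = -(r ^ (α : ℂ) * (Real.Gamma (1 - α) : ℂ) / α) := by
  have hr0 : r ≠ 0 := by rintro rfl; simp at hr
  have hre : ∀ u : ℝ, 0 < u → 0 ≤ (r * u).re := fun u hu => by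
    simpa using mul_nonneg hr.le hu.le
  have hb1 : ∀ u : ℝ, 0 < u → ‖Complex.exp (-(r * u)) - 1‖ ≤ (2 + ‖r‖) * u ^ (0 + 1 : ℝ) := by
    intro u hu
    refine (norm_exp_neg_sub_one_le (hre u hu)).trans ?_
    rw [norm_mul, Complex.norm_real, Real.norm_of_nonneg hu.le, zero_add, rpow_one]
    nlinarith
  have hb0 : ∀ u : ℝ, 0 < u → ‖Complex.exp (-(r * u)) - 1‖ ≤ (2 + ‖r‖) * u ^ (0 : ℝ) := by
    intro u hu
    refine (norm_exp_neg_sub_one_le_two (hre u hu)).trans ?_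
    rw [rpow_zero]; linarith [norm_nonneg r]
  have hd : ∀ u ∈ Ioi (0 : ℝ), HasDerivAt (fun x : ℝ => Complex.exp (-(r * x)) - 1)
      (-r * Complex.exp (-(r * u))) u := by
    intro u _
    have h := (((Complex.ofRealCLM.hasDerivAt (x := u)).const_mul r).neg.cexp).sub_const 1
    simp only [Complex.ofRealCLM_apply, Complex.ofReal_one, mul_one] at h
    convert! h using 1
    simp only [Pi.neg_apply]
    ring
  have hval := integral_exp_neg_mul_rpow_Ioi (s := 1 - α) (by linarith) hr
  have hne : r ^ (-((1 - α : ℝ) : ℂ)) * (Real.Gamma (1 - α) : ℂ) ≠ 0 := by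
    refine mul_ne_zero ?_ ?_
    · rw [Ne, Complex.cpow_eq_zero_iff]; tauto
    · exact_mod_cast (Real.Gamma_pos_of_pos (by linarith : 0 < 1 - α)).ne'
  have hi : IntegrableOn (fun u : ℝ => Complex.exp (-(r * u)) * ((u ^ (1 - α - 1) : ℝ) : ℂ))
      (Ioi 0) := by
    by_contra hcon
    exact hne (hval ▸ integral_undef hcon)
  have key := integral_Ioi_mul_deriv_eq_deriv_mul (a := (0 : ℝ)) (a' := (0 : ℂ)) (b' := (0 : ℂ))
    hd (fun u hu => hasDerivAt_neg_rpow_div h0.ne' hu) ?_ ?_ ?_ ?_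
  · rw [key]
    have : (fun u : ℝ => -r * Complex.exp (-(r * u)) * ((-(u ^ (-α)) / α : ℝ) : ℂ)) =
        fun u : ℝ =>
        r / α * (Complex.exp (-(r * u)) * ((u ^ (1 - α - 1) : ℝ) : ℂ)) := by
      funext u
      rw [show 1 - α - 1 = -α by ring]
      push_cast
      ring
    rw [this, integral_const_mul, hval]
    have : r ^ (α : ℂ) = r * r ^ (-((1 - α : ℝ) : ℂ) : ℂ) := by
      nth_rewrite 2 [← Complex.cpow_one r]
      rw [← Complex.cpow_add _ _ hr0]
      congr 1
      push_cast; ring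
    rw [this]
    ring
  · have := integrableOn_mul_rpow_neg (e := 0) (p := α + 1) (by linarith) (by linarith)
      (by fun_prop) hb0 hb1
    rw [neg_add'] at this
    exact this
  · have : ((fun u : ℝ => -r * Complex.exp (-(r * u))) * fun u : ℝ => ((-(u ^ (-α)) / α : ℝ) : ℂ))
        = fun u : ℝ =>
        r / α * (Complex.exp (-(r * u)) * ((u ^ (1 - α - 1) : ℝ) : ℂ)) := by
      funext u
      rw [Pi.mul_apply, show 1 - α - 1 = -α by ring]
      push_cast
      ring
    rw [this]
    exact hi.const_mul _
  · exact tendsto_mul_neg_rpow_div_zero (e := 0 + 1) (by linarith) hb1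
  · exact tendsto_mul_neg_rpow_div_atTop (e := 0) (by linarith) hb0

lemma norm_exp_I_mul_sub_one_le_two (u : ℝ) : ‖Complex.exp (Complex.I * u) - 1‖ ≤ 2 := by
  have := norm_exp_neg_sub_one_le_two (w := -(Complex.I * u)) (by simp)
  rwa [neg_neg] at this

lemma norm_exp_I_mul_sub_one_le' (u : ℝ) : ‖Complex.exp (Complex.I * u) - 1‖ ≤ |u| := by
  have := norm_exp_neg_sub_one_le (w := -(Complex.I * u)) (by simp)
  rw [neg_neg] at this
  simpa using this

/-- The Lévy integral of the one-sided stable law of index `α < 1`. -/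
lemma integral_exp_I_sub_one_mul_rpow {α : ℝ} (h0 : 0 < α) (h1 : α < 1) :
    ∫ u in Ioi (0 : ℝ), (Complex.exp (Complex.I * u) - 1) * ((u ^ (-α - 1) : ℝ) : ℂ)
      = -((-Complex.I) ^ (α : ℂ) * (Real.Gamma (1 - α) : ℂ) / α) := by
  have hlim : Tendsto (fun ε : ℝ => (ε : ℂ) - Complex.I) (𝓝[>] 0) (𝓝 (-Complex.I)) := by
    have : Tendsto (fun ε : ℝ => (ε : ℂ) - Complex.I) (𝓝 0) (𝓝 (((0 : ℝ) : ℂ) - Complex.I)) :=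
      Continuous.tendsto (by fun_prop) 0
    simp only [Complex.ofReal_zero, zero_sub] at this
    exact this.mono_left nhdsWithin_le_nhds
  have hR : Tendsto (fun ε : ℝ => -(((ε : ℂ) - Complex.I) ^ (α : ℂ) *
      (Real.Gamma (1 - α) : ℂ) / α)) (𝓝[>] 0)
      (𝓝 (-((-Complex.I) ^ (α : ℂ) * (Real.Gamma (1 - α) : ℂ) / α))) := by
    have hc : ContinuousAt (fun z : ℂ => z ^ (α : ℂ)) (-Complex.I) :=
      continuousAt_cpow_const (Or.inr (by simp))
    exact (((hc.tendsto.comp hlim).mul_const _).div_const _).neg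
  refine tendsto_nhds_unique ?_ hR
  have hdct : Tendsto (fun ε : ℝ => ∫ u in Ioi (0 : ℝ),
      (Complex.exp (-(((ε : ℂ) - Complex.I) * u)) - 1) * ((u ^ (-α - 1) : ℝ) : ℂ)) (𝓝[>] 0)
      (𝓝 (∫ u in Ioi (0 : ℝ), (Complex.exp (Complex.I * u) - 1) *
        ((u ^ (-α - 1) : ℝ) : ℂ))) := by
    have hintg := (integrableOn_min_rpow (p := -α) (q := -α - 1) (by linarith)
      (by linarith)).const_mul 2
    refine tendsto_integral_filter_of_dominated_convergence _ ?_ ?_ hintg ?_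
    · refine Eventually.of_forall fun ε => Measurable.aestronglyMeasurable ?_
      exact Measurable.mul (by fun_prop)
        (Complex.measurable_ofReal.comp (measurable_id.pow_const _))
    · filter_upwards [Ioo_mem_nhdsGT (zero_lt_one (α := ℝ))] with ε hε
      filter_upwards [ae_restrict_mem measurableSet_Ioi] with u hu
      have hu : 0 < u := hu
      have hre : 0 ≤ (((ε : ℂ) - Complex.I) * u).re := by
        simpa using mul_nonneg hε.1.le hu.le
      have hn : ‖(ε : ℂ) - Complex.I‖ ≤ 2 := by
        refine (norm_sub_le _ _).trans ?_
        rw [Complex.norm_real, Complex.norm_I, Real.norm_of_nonneg hε.1.le]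
        linarith [hε.2]
      rw [norm_mul, Complex.norm_real, Real.norm_of_nonneg (rpow_nonneg hu.le _),
        mul_min_of_nonneg _ _ zero_le_two]
      refine le_min ?_ ?_
      · have : u ^ (-α) = u * u ^ (-α - 1) := by
          nth_rewrite 2 [← rpow_one u]
          rw [← rpow_add hu]; congr 1; ring
        rw [this, ← mul_assoc]
        gcongr
        refine (norm_exp_neg_sub_one_le hre).trans ?_
        rw [norm_mul, Complex.norm_real, Real.norm_of_nonneg hu.le]
        gcongr
      · gcongr
        exact norm_exp_neg_sub_one_le_two hre
    · refine Eventually.of_forall fun u => ?_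
      have hc : Continuous fun z : ℂ =>
          (Complex.exp (-(z * u)) - 1) * ((u ^ (-α - 1) : ℝ) : ℂ) := by
        fun_prop
      have := (hc.tendsto (-Complex.I)).comp hlim
      simpa [Function.comp_def] using this
  refine hdct.congr' ?_
  filter_upwards [self_mem_nhdsWithin] with ε hε
  exact integral_exp_neg_sub_one_mul_rpow h0 h1 (by simpa using hε)

lemma norm_exp_I_mul_sub_one_sub_le (u : ℝ) :
    ‖Complex.exp (Complex.I * u) - 1 - Complex.I * u‖ ≤ 2 * |u| := by
  refine (norm_sub_le _ _).trans ?_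
  have := norm_exp_I_mul_sub_one_le' u
  simp only [norm_mul, Complex.norm_I, one_mul, Complex.norm_real, Real.norm_eq_abs]
  linarith

lemma norm_exp_I_mul_sub_one_sub_le_sq {u : ℝ} (hu : 0 ≤ u) :
    ‖Complex.exp (Complex.I * u) - 1 - Complex.I * u‖ ≤ u ^ 2 := by
  have hd : ∀ x ∈ Icc (0 : ℝ) u, HasDerivWithinAt
      (fun x : ℝ => Complex.exp (Complex.I * x) - 1 - Complex.I * x)
      (Complex.I * (Complex.exp (Complex.I * x) - 1)) (Icc 0 u) x := by
    intro x _
    have h0 := (Complex.ofRealCLM.hasDerivAt (x := x)).const_mul Complex.I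
    have h := (h0.cexp.sub_const 1).sub h0
    simp only [Complex.ofRealCLM_apply, Complex.ofReal_one, mul_one] at h
    convert! h.hasDerivWithinAt using 1
    ring
  have := (convex_Icc (0 : ℝ) u).norm_image_sub_le_of_norm_hasDerivWithin_le (C := u) hd
    (fun x hx => by
      rw [norm_mul, Complex.norm_I, one_mul]
      refine (norm_exp_I_mul_sub_one_le' x).trans ?_
      rw [abs_of_nonneg hx.1]; exact hx.2) (left_mem_Icc.2 hu) (right_mem_Icc.2 hu)
  simpa [abs_of_nonneg hu, pow_two] using this

/-- The compensated Lévy integral of the one-sided stable law of index `1 < α < 2`. -/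
lemma integral_exp_I_sub_one_sub_mul_rpow {α : ℝ} (h0 : 1 < α) (h1 : α < 2) :
    ∫ u in Ioi (0 : ℝ), (Complex.exp (Complex.I * u) - 1 - Complex.I * u) *
        ((u ^ (-α - 1) : ℝ) : ℂ)
      = -((-Complex.I) ^ (α : ℂ) * (Real.Gamma (1 - α) : ℂ) / α) := by
  have hb1 : ∀ u : ℝ, 0 < u →
      ‖Complex.exp (Complex.I * u) - 1 - Complex.I * u‖ ≤ 2 * u ^ (1 : ℝ) := by
    intro u hu
    have := norm_exp_I_mul_sub_one_sub_le u
    rw [abs_of_pos hu] at this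
    rwa [rpow_one]
  have hb2 : ∀ u : ℝ, 0 < u →
      ‖Complex.exp (Complex.I * u) - 1 - Complex.I * u‖ ≤ 2 * u ^ (1 + 1 : ℝ) := by
    intro u hu
    have := norm_exp_I_mul_sub_one_sub_le_sq hu.le
    rw [one_add_one_eq_two, rpow_two]
    nlinarith
  have hd : ∀ x ∈ Ioi (0 : ℝ), HasDerivAt
      (fun x : ℝ => Complex.exp (Complex.I * x) - 1 - Complex.I * x)
      (Complex.I * (Complex.exp (Complex.I * x) - 1)) x := by
    intro x _
    have h0 := (Complex.ofRealCLM.hasDerivAt (x := x)).const_mul Complex.I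
    have h := (h0.cexp.sub_const 1).sub h0
    simp only [Complex.ofRealCLM_apply, Complex.ofReal_one, mul_one] at h
    convert! h using 1
    ring
  have hprev := integral_exp_I_sub_one_mul_rpow (α := α - 1) (by linarith) (by linarith)
  have heq : ((fun x : ℝ => Complex.I * (Complex.exp (Complex.I * x) - 1)) *
      fun x : ℝ => ((-(x ^ (-α)) / α : ℝ) : ℂ)) = fun x : ℝ => -(Complex.I / α) *
        ((Complex.exp (Complex.I * x) - 1) * ((x ^ (-(α - 1) - 1) : ℝ) : ℂ)) := by
    funext u
    rw [Pi.mul_apply, show -(α - 1) - 1 = -α by ring]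
    push_cast
    ring
  have key := integral_Ioi_mul_deriv_eq_deriv_mul (a := (0 : ℝ)) (a' := (0 : ℂ)) (b' := (0 : ℂ))
    hd (fun u hu => hasDerivAt_neg_rpow_div (α := α) (by linarith) hu) ?_ ?_ ?_ ?_
  · have heq' : (fun x : ℝ => Complex.I * (Complex.exp (Complex.I * x) - 1) *
      ((-(x ^ (-α)) / α : ℝ) : ℂ)) = _ := heq
    rw [key, heq', integral_const_mul, hprev]
    have hG : Real.Gamma (1 - (α - 1)) = (1 - α) * Real.Gamma (1 - α) := by
      rw [← Real.Gamma_add_one (by linarith)]; congr 1; ring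
    have hI : (-Complex.I) ^ (α : ℂ) = (-Complex.I) ^ ((α - 1 : ℝ) : ℂ) * (-Complex.I) := by
      nth_rewrite 3 [← Complex.cpow_one (-Complex.I)]
      rw [← Complex.cpow_add _ _ (by simp)]
      congr 1
      push_cast; ring
    rw [hG, hI]
    have hα : (α : ℂ) ≠ 0 := by exact_mod_cast (by linarith : α ≠ 0)
    have hα1 : (α : ℂ) - 1 ≠ 0 := by exact_mod_cast (by linarith : α - 1 ≠ 0)
    push_cast
    field_simp
    ring
  · have := integrableOn_mul_rpow_neg (e := 1) (p := α + 1) (by linarith) (by linarith)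
      (by fun_prop) hb1 hb2
    rw [neg_add'] at this
    exact this
  · rw [heq]
    refine Integrable.const_mul ?_ _
    have := integrableOn_mul_rpow_neg (e := 0) (p := α) (C := 2)
      (f := fun u : ℝ => Complex.exp (Complex.I * u) - 1) (by linarith) (by linarith)
      (by fun_prop) (fun u hu => by simpa using norm_exp_I_mul_sub_one_le_two u)
      (fun u hu => by
        have := norm_exp_I_mul_sub_one_le' u
        rw [abs_of_pos hu] at this
        rw [zero_add, rpow_one]; linarith)
    rwa [show -(α - 1) - 1 = -α by ring]
  · exact tendsto_mul_neg_rpow_div_zero (e := 1 + 1) (by linarith) hb2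
  · exact tendsto_mul_neg_rpow_div_atTop (e := 1) (by linarith) hb1

lemma floor_div_mem_Ico {s : ℝ} (hs : 0 < s) {u : ℝ} {k : ℕ}
    (hu : u ∈ Ico (s * k) (s * (k + 1))) : ⌊u / s⌋₊ = k := by
  have h0 : 0 ≤ u / s := div_nonneg ((by positivity : 0 ≤ s * (k : ℝ)).trans hu.1) hs.le
  rw [Nat.floor_eq_iff h0, le_div_iff₀ hs, div_lt_iff₀ hs]
  constructor
  · linarith [hu.1]
  · linarith [hu.2]

lemma iUnion_Ico_mul_eq_Ici {s : ℝ} (hs : 0 < s) :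
    ⋃ k : ℕ, Ico (s * (k : ℝ)) (s * (k + 1)) = Ici 0 := by
  ext u
  simp only [mem_iUnion, mem_Ico, mem_Ici]
  constructor
  · rintro ⟨k, h1, _⟩
    exact (by positivity : 0 ≤ s * (k : ℝ)).trans h1
  · intro hu
    refine ⟨⌊u / s⌋₊, ?_, ?_⟩
    · have := Nat.floor_le (div_nonneg hu hs.le)
      rw [le_div_iff₀ hs] at this; linarith
    · have := Nat.lt_floor_add_one (u / s)
      rw [div_lt_iff₀ hs] at this; linarith

lemma pairwise_disjoint_Ico_mul {s : ℝ} (hs : 0 < s) :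
    Pairwise (Function.onFun Disjoint fun k : ℕ => Ico (s * (k : ℝ)) (s * (k + 1))) := by
  intro i j hij
  refine Set.disjoint_left.2 fun u hi hj => hij ?_
  rw [← floor_div_mem_Ico hs hi, ← floor_div_mem_Ico hs hj]

/-- Riemann-sum asymptotics for a regularly varying sequence of weights. -/
lemma tendsto_rpow_mul_tsum_mul {α A C e : ℝ} {P : ℕ → ℝ} {φ : ℝ → ℂ}
    (hP : Tendsto (fun k : ℕ => P k * ((k : ℝ) + 1) ^ (α + 1)) atTop (𝓝 A))
    (hφ : Continuous φ) (he : e < α) (he' : α < e + 1)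
    (hb : ∀ u : ℝ, 0 < u → ‖φ u‖ ≤ C * u ^ e)
    (hb' : ∀ u : ℝ, 0 < u → ‖φ u‖ ≤ C * u ^ (e + 1)) :
    Tendsto (fun s : ℝ => ((s ^ (-α) : ℝ) : ℂ) * ∑' k : ℕ, (P k : ℂ) * φ (s * (k + 1)))
      (𝓝[>] 0) (𝓝 (A * ∫ u in Ioi (0 : ℝ), φ u * ((u ^ (-α - 1) : ℝ) : ℂ))) := by
  obtain ⟨D, hD⟩ : ∃ D, ∀ k : ℕ, |P k * ((k : ℝ) + 1) ^ (α + 1)| ≤ D := by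
    obtain ⟨D, hD⟩ := hP.norm.bddAbove_range
    exact ⟨D, fun k => hD ⟨k, rfl⟩⟩
  have hD0 : 0 ≤ D := (abs_nonneg _).trans (hD 0)
  have hC : 0 ≤ C := by
    have := (norm_nonneg _).trans (hb 1 one_pos)
    simpa using this
  let f : ℝ → ℝ → ℂ := fun s u =>
    ((s ^ (-α - 1) : ℝ) : ℂ) * ((P ⌊u / s⌋₊ : ℂ) * φ (s * ((⌊u / s⌋₊ : ℝ) + 1)))
  have hfm : ∀ s, Measurable (f s) := by
    intro s
    have hfl : Measurable fun u : ℝ => ⌊u / s⌋₊ :=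
      Nat.measurable_floor.comp (measurable_id.div_const s)
    have h1 : Measurable fun k : ℕ => (P k : ℂ) * φ (s * ((k : ℝ) + 1)) := measurable_from_nat
    exact (h1.comp hfl).const_mul _
  have hw : ∀ s : ℝ, 0 < s → ∀ u : ℝ, 0 < u → u ≤ s * ((⌊u / s⌋₊ : ℝ) + 1) := by
    intro s hs u _
    have := Nat.lt_floor_add_one (u / s)
    rw [div_lt_iff₀ hs] at this; linarith
  have hPw : ∀ s : ℝ, 0 < s → ∀ k : ℕ, s ^ (-α - 1) * P k =
      P k * ((k : ℝ) + 1) ^ (α + 1) * (s * ((k : ℝ) + 1)) ^ (-α - 1) := by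
    intro s hs k
    have hk : (0 : ℝ) < (k : ℝ) + 1 := by positivity
    rw [mul_rpow hs.le hk.le, show -α - 1 = -(α + 1) by ring, rpow_neg hk.le]
    have : ((k : ℝ) + 1) ^ (α + 1) ≠ 0 := (rpow_pos_of_pos hk _).ne'
    field_simp
  have hbound : ∀ s : ℝ, 0 < s → ∀ u : ℝ, 0 < u →
      ‖f s u‖ ≤ D * C * min (u ^ (e - α)) (u ^ (e - α - 1)) := by
    intro s hs u hu
    have hwu := hw s hs u hu
    set k := ⌊u / s⌋₊ with hk
    set w := s * ((k : ℝ) + 1) with hwdef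
    have hw0 : 0 < w := hu.trans_le hwu
    have hnorm : ‖f s u‖ = |P k * ((k : ℝ) + 1) ^ (α + 1)| * w ^ (-α - 1) * ‖φ w‖ := by
      simp only [f, ← hk, ← hwdef]
      rw [← mul_assoc, norm_mul, ← Complex.ofReal_mul, hPw s hs k, Complex.norm_real,
        Real.norm_eq_abs, abs_mul, ← hwdef, abs_of_nonneg (rpow_nonneg hw0.le (-α - 1))]
    have h1 : ∀ x : ℝ, x < α + 1 → ‖φ w‖ ≤ C * w ^ x →
        ‖f s u‖ ≤ D * C * u ^ (x - α - 1) := by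
      intro x hx hφw
      rw [hnorm]
      calc |P k * ((k : ℝ) + 1) ^ (α + 1)| * w ^ (-α - 1) * ‖φ w‖
          ≤ D * w ^ (-α - 1) * (C * w ^ x) := by
            gcongr
            exact hD k
        _ = D * C * w ^ (x - α - 1) := by
            rw [show x - α - 1 = -α - 1 + x by ring, rpow_add hw0]; ring
        _ ≤ D * C * u ^ (x - α - 1) := by
            have := rpow_le_rpow_of_nonpos hu hwu (by linarith : x - α - 1 ≤ 0)
            gcongr
    rw [mul_min_of_nonneg _ _ (mul_nonneg hD0 hC)]
    refine le_min ?_ (h1 e (by linarith) (hb w hw0))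
    have := h1 (e + 1) (by linarith) (hb' w hw0)
    rwa [show e + 1 - α - 1 = e - α by ring] at this
  have hdom : IntegrableOn (fun u : ℝ => D * C * min (u ^ (e - α)) (u ^ (e - α - 1))) (Ioi 0) :=
    (integrableOn_min_rpow (by linarith) (by linarith)).const_mul _
  have hfi : ∀ s : ℝ, 0 < s → IntegrableOn (f s) (Ioi 0) := by
    intro s hs
    refine Integrable.mono' hdom (hfm s).aestronglyMeasurable ?_
    filter_upwards [ae_restrict_mem measurableSet_Ioi] with u hu
    exact hbound s hs u hu
  have hsum : ∀ s : ℝ, 0 < s → ∫ u in Ioi (0 : ℝ), f s u =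
      ((s ^ (-α) : ℝ) : ℂ) * ∑' k : ℕ, (P k : ℂ) * φ (s * (k + 1)) := by
    intro s hs
    rw [← integral_Ici_eq_integral_Ioi, ← iUnion_Ico_mul_eq_Ici hs,
      integral_iUnion (fun _ => measurableSet_Ico) (pairwise_disjoint_Ico_mul hs)
        (by rw [iUnion_Ico_mul_eq_Ici hs, integrableOn_Ici_iff_integrableOn_Ioi]; exact hfi s hs),
      ← tsum_mul_left]
    refine tsum_congr fun k => ?_
    have : ∫ u in Ico (s * (k : ℝ)) (s * (k + 1)), f s u =
        ∫ _ in Ico (s * (k : ℝ)) (s * (k + 1)), ((s ^ (-α - 1) : ℝ) : ℂ) *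
          ((P k : ℂ) * φ (s * ((k : ℝ) + 1))) := by
      refine setIntegral_congr_fun measurableSet_Ico fun u hu => ?_
      simp only [f, floor_div_mem_Ico hs hu]
    rw [this, setIntegral_const, Measure.real, Real.volume_Ico,
      show s * ((k : ℝ) + 1) - s * k = s by ring, ENNReal.toReal_ofReal hs.le,
      Complex.real_smul, ← mul_assoc, ← Complex.ofReal_mul]
    congr 3
    nth_rewrite 1 [← rpow_one s]
    rw [← rpow_add hs]
    congr 1
    ring
  have hmain : Tendsto (fun s : ℝ => ∫ u in Ioi (0 : ℝ), f s u) (𝓝[>] 0)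
      (𝓝 (∫ u in Ioi (0 : ℝ), (A : ℂ) * (φ u * ((u ^ (-α - 1) : ℝ) : ℂ)))) := by
    refine tendsto_integral_filter_of_dominated_convergence _
      (Eventually.of_forall fun s => (hfm s).aestronglyMeasurable) ?_ hdom ?_
    · filter_upwards [self_mem_nhdsWithin] with s hs
      filter_upwards [ae_restrict_mem measurableSet_Ioi] with u hu
      exact hbound s hs u hu
    · filter_upwards [ae_restrict_mem measurableSet_Ioi] with u hu
      have hu : 0 < u := hu
      have hfl : Tendsto (fun s : ℝ => ⌊u / s⌋₊) (𝓝[>] 0) atTop := by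
        refine tendsto_nat_floor_atTop.comp ?_
        exact (tendsto_inv_nhdsGT_zero.const_mul_atTop hu).congr fun s => (div_eq_mul_inv u s).symm
      have hwt : Tendsto (fun s : ℝ => s * ((⌊u / s⌋₊ : ℝ) + 1)) (𝓝[>] 0) (𝓝 u) := by
        have hup : Tendsto (fun s : ℝ => u + s) (𝓝[>] 0) (𝓝 u) := by
          have : Tendsto (fun s : ℝ => u + s) (𝓝 0) (𝓝 (u + 0)) :=
            Continuous.tendsto (by fun_prop) 0
          rw [add_zero] at this
          exact this.mono_left nhdsWithin_le_nhds
        refine tendsto_of_tendsto_of_tendsto_of_le_of_le' tendsto_const_nhds hup ?_ ?_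
        · filter_upwards [self_mem_nhdsWithin] with s hs
          exact hw s hs u hu
        · filter_upwards [self_mem_nhdsWithin] with s hs
          have hs : 0 < s := hs
          have := Nat.floor_le (div_nonneg hu.le hs.le)
          rw [le_div_iff₀ hs] at this; linarith
      have h1 := hP.comp hfl
      have h2 := hwt.rpow_const (p := -α - 1) (Or.inl hu.ne')
      have h3 := (hφ.tendsto u).comp hwt
      have h4 := ((Complex.continuous_ofReal.tendsto _).comp (h1.mul h2)).mul h3
      have hlim : ((A * u ^ (-α - 1) : ℝ) : ℂ) * φ u =
          (A : ℂ) * (φ u * ((u ^ (-α - 1) : ℝ) : ℂ)) := by push_cast; ring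
      rw [hlim] at h4
      refine h4.congr' ?_
      filter_upwards [self_mem_nhdsWithin] with s hs
      have := hPw s hs ⌊u / s⌋₊
      simp only [Function.comp_apply, f]
      rw [← mul_assoc, ← Complex.ofReal_mul, this]
  rw [integral_const_mul] at hmain
  refine hmain.congr' ?_
  filter_upwards [self_mem_nhdsWithin] with s hs
  exact hsum s hs

lemma summable_mul_exp_I {P : ℕ → ℝ} (hs : Summable P) (x : ℕ → ℝ) (hP0 : ∀ k, 0 ≤ P k) :
    Summable fun k => (P k : ℂ) * Complex.exp (Complex.I * (x k : ℂ)) := by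
  refine Summable.of_norm_bounded hs fun k => ?_
  rw [norm_mul, mul_comm Complex.I, Complex.norm_exp_ofReal_mul_I, mul_one, Complex.norm_real,
    Real.norm_of_nonneg (hP0 k)]

/-- Second-order remainder produced by centring. -/
lemma tendsto_rpow_mul_exp_centering {α ℓ : ℝ} (h2 : α < 2) :
    Tendsto (fun s : ℝ => ((s ^ (-α) : ℝ) : ℂ) *
      ((1 + Complex.I * ((s * ℓ : ℝ) : ℂ)) * Complex.exp (-(Complex.I * ((s * ℓ : ℝ) : ℂ))) - 1))
      (𝓝[>] 0) (𝓝 0) := by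
  have hlim : Tendsto (fun s : ℝ => ℓ ^ 2 * s ^ (2 - α)) (𝓝[>] 0) (𝓝 0) := by
    have : Tendsto (fun s : ℝ => ℓ ^ 2 * s ^ (2 - α)) (𝓝 0) (𝓝 (ℓ ^ 2 * 0 ^ (2 - α))) :=
      ((Real.continuous_rpow_const (by linarith)).const_mul _).tendsto 0
    rw [Real.zero_rpow (by linarith), mul_zero] at this
    exact this.mono_left nhdsWithin_le_nhds
  have hmain : ∀ x : ℝ, ‖(1 + Complex.I * (x : ℂ)) * Complex.exp (-(Complex.I * (x : ℂ))) - 1‖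
      ≤ x ^ 2 := by
    intro x
    have hfac : (1 + Complex.I * (x : ℂ)) * Complex.exp (-(Complex.I * (x : ℂ))) - 1 =
        -(Complex.exp (-(Complex.I * (x : ℂ))) *
          (Complex.exp (Complex.I * x) - 1 - Complex.I * x)) := by
      rw [mul_sub, mul_sub, ← Complex.exp_add, neg_add_cancel, Complex.exp_zero]; ring
    have hn : ‖Complex.exp (-(Complex.I * (x : ℂ)))‖ = 1 := by
      rw [Complex.norm_exp]; simp
    rw [hfac, norm_neg, norm_mul, hn, one_mul]
    rcases le_total 0 x with hx | hx
    · exact norm_exp_I_mul_sub_one_sub_le_sq hx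
    · have := norm_exp_I_mul_sub_one_sub_le_sq (neg_nonneg.2 hx)
      rw [← RCLike.norm_conj] at this
      simp only [map_sub, map_mul, map_one, Complex.ofReal_neg, ← Complex.exp_conj, map_neg,
        Complex.conj_I, Complex.conj_ofReal, neg_mul_neg, neg_sq] at this
      exact this
  refine squeeze_zero_norm' ?_ hlim
  filter_upwards [self_mem_nhdsWithin] with s hs
  have hs : 0 < s := hs
  rw [norm_mul, Complex.norm_real, Real.norm_of_nonneg (rpow_nonneg hs.le _)]
  calc _ ≤ s ^ (-α) * (s * ℓ) ^ 2 := by gcongr; exact hmain _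
    _ = ℓ ^ 2 * s ^ (2 - α) := by
      rw [show (2 : ℝ) - α = -α + 2 by ring, rpow_add hs, rpow_two]; ring

/-- The behaviour at `0` of the characteristic function of a centred discrete law with
regularly varying mass function. -/
lemma tendsto_rpow_mul_charFun_sub_one {α A ℓ : ℝ} {P : ℕ → ℝ} (hα0 : 0 < α)
    (hP0 : ∀ k, 0 ≤ P k) (hP1 : HasSum P 1)
    (hP : Tendsto (fun k : ℕ => P k * ((k : ℝ) + 1) ^ (α + 1)) atTop (𝓝 A))
    (hℓ : (α < 1 ∧ ℓ = 0) ∨ (1 < α ∧ α < 2 ∧ HasSum (fun k : ℕ => ((k : ℝ) + 1) * P k) ℓ)) :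
    Tendsto (fun s : ℝ => ((s ^ (-α) : ℝ) : ℂ) *
      ((∑' k : ℕ, (P k : ℂ) * Complex.exp (Complex.I * ((s * ((k : ℝ) + 1 - ℓ) : ℝ) : ℂ))) - 1))
      (𝓝[>] 0) (𝓝 (A * -((-Complex.I) ^ (α : ℂ) * (Real.Gamma (1 - α) : ℂ) / α))) := by
  have hP1c : HasSum (fun k => (P k : ℂ)) 1 := by
    simpa using Complex.hasSum_ofReal.2 hP1
  rcases hℓ with ⟨h1, rfl⟩ | ⟨h1, h2, hm⟩
  · have key := tendsto_rpow_mul_tsum_mul (φ := fun u : ℝ => Complex.exp (Complex.I * u) - 1)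
      (e := 0) (C := 2) hP (by fun_prop) hα0 (by linarith)
      (fun u _ => by simpa using norm_exp_I_mul_sub_one_le_two u)
      (fun u hu => by
        have := norm_exp_I_mul_sub_one_le' u
        rw [abs_of_pos hu] at this
        rw [zero_add, rpow_one]; linarith)
    rw [integral_exp_I_sub_one_mul_rpow hα0 h1] at key
    refine key.congr fun s => ?_
    congr 1
    have hsE := summable_mul_exp_I hP1.summable (fun k : ℕ => s * ((k : ℝ) + 1 - 0)) hP0
    have hsub := (hsE.hasSum.sub hP1c).tsum_eq
    rw [← hsub]
    refine tsum_congr fun k => ?_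
    rw [sub_zero]; ring
  · have key := tendsto_rpow_mul_tsum_mul
      (φ := fun u : ℝ => Complex.exp (Complex.I * u) - 1 - Complex.I * u)
      (e := 1) (C := 2) hP (by fun_prop) h1 (by linarith)
      (fun u hu => by
        have := norm_exp_I_mul_sub_one_sub_le u
        rw [abs_of_pos hu] at this
        rwa [rpow_one])
      (fun u hu => by
        have := norm_exp_I_mul_sub_one_sub_le_sq hu.le
        rw [one_add_one_eq_two, rpow_two]
        nlinarith)
    rw [integral_exp_I_sub_one_sub_mul_rpow h1 h2] at key
    have hexp : Tendsto (fun s : ℝ => Complex.exp (-(Complex.I * ((s * ℓ : ℝ) : ℂ)))) (𝓝[>] 0)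
        (𝓝 1) := by
      have : Tendsto (fun s : ℝ => Complex.exp (-(Complex.I * ((s * ℓ : ℝ) : ℂ)))) (𝓝 0)
          (𝓝 (Complex.exp (-(Complex.I * (((0 : ℝ) * ℓ : ℝ) : ℂ))))) :=
        Continuous.tendsto (by fun_prop) 0
      simp only [zero_mul, Complex.ofReal_zero, mul_zero, neg_zero, Complex.exp_zero] at this
      exact this.mono_left nhdsWithin_le_nhds
    have hfin := (key.mul hexp).add (tendsto_rpow_mul_exp_centering (ℓ := ℓ) h2)
    rw [mul_one, add_zero] at hfin
    refine hfin.congr fun s => ?_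
    have hmc : HasSum (fun k : ℕ => (((k : ℝ) + 1) * P k : ℝ) : ℕ → ℂ) (ℓ : ℂ) := by
      exact_mod_cast hm
    have hsE := summable_mul_exp_I hP1.summable (fun k : ℕ => s * ((k : ℝ) + 1)) hP0
    have hsum1 : HasSum (fun k : ℕ => (P k : ℂ) *
        (Complex.exp (Complex.I * ((s * ((k : ℝ) + 1) : ℝ) : ℂ)) - 1 -
          Complex.I * ((s * ((k : ℝ) + 1) : ℝ) : ℂ)))
        ((∑' k : ℕ, (P k : ℂ) * Complex.exp (Complex.I * ((s * ((k : ℝ) + 1) : ℝ) : ℂ))) - 1 -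
          Complex.I * s * ℓ) := by
      convert! (hsE.hasSum.sub hP1c).sub (hmc.mul_left (Complex.I * s)) using 2 with k
      push_cast
      ring
    have hE : ∑' k : ℕ, (P k : ℂ) * Complex.exp (Complex.I * ((s * ((k : ℝ) + 1 - ℓ) : ℝ) : ℂ)) =
        (∑' k : ℕ, (P k : ℂ) * Complex.exp (Complex.I * ((s * ((k : ℝ) + 1) : ℝ) : ℂ))) *
          Complex.exp (-(Complex.I * ((s * ℓ : ℝ) : ℂ))) := by
      rw [← tsum_mul_right]
      refine tsum_congr fun k => ?_
      rw [mul_assoc, ← Complex.exp_add]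
      congr 2
      push_cast; ring
    rw [hsum1.tsum_eq, hE]
    push_cast
    ring

lemma neg_I_cpow_ofReal (α : ℝ) : (-Complex.I) ^ (α : ℂ) =
    (Real.cos (α * π / 2) : ℂ) - Complex.I * (Real.sin (α * π / 2) : ℂ) := by
  rw [Complex.cpow_def_of_ne_zero (by simp), Complex.log_neg_I,
    show -((π : ℂ) / 2) * Complex.I * α = ((-(α * π / 2) : ℝ) : ℂ) * Complex.I by push_cast; ring,
    Complex.exp_mul_I, ← Complex.ofReal_cos, ← Complex.ofReal_sin, Real.cos_neg, Real.sin_neg]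
  push_cast
  ring

/-- Powers of the characteristic function at the stable scale converge to the one-sided stable
characteristic function. -/
lemma tendsto_charFun_pow {α A ℓ d : ℝ} {P : ℕ → ℝ} (hα0 : 0 < α)
    (hP0 : ∀ k, 0 ≤ P k) (hP1 : HasSum P 1)
    (hP : Tendsto (fun k : ℕ => P k * ((k : ℝ) + 1) ^ (α + 1)) atTop (𝓝 A))
    (hℓ : (α < 1 ∧ ℓ = 0) ∨ (1 < α ∧ α < 2 ∧ HasSum (fun k : ℕ => ((k : ℝ) + 1) * P k) ℓ))
    (hd : 0 < d) (hdA : d = A / α * (Real.Gamma (1 - α) * Real.cos (α * π / 2)))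
    (hcos : Real.cos (α * π / 2) ≠ 0) (t : ℝ) :
    Tendsto (fun n : ℕ => (∑' k : ℕ, (P k : ℂ) * Complex.exp (Complex.I *
        ((t * ((n : ℝ) ^ (-α⁻¹) * d ^ (-α⁻¹)) * ((k : ℝ) + 1 - ℓ) : ℝ) : ℂ))) ^ n) atTop
      (𝓝 (Complex.exp (-((|t| ^ α : ℝ) : ℂ) *
        (1 - Complex.I * ((Real.sign t : ℝ) : ℂ) * ((Real.tan (α * π / 2) : ℝ) : ℂ))))) := by
  have hpos : ∀ t : ℝ, 0 < t →
      Tendsto (fun n : ℕ => (∑' k : ℕ, (P k : ℂ) * Complex.exp (Complex.I *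
        ((t * ((n : ℝ) ^ (-α⁻¹) * d ^ (-α⁻¹)) * ((k : ℝ) + 1 - ℓ) : ℝ) : ℂ))) ^ n) atTop
      (𝓝 (Complex.exp (-((t ^ α : ℝ) : ℂ) *
        (1 - Complex.I * ((Real.tan (α * π / 2) : ℝ) : ℂ))))) := by
    intro t ht
    set sn : ℕ → ℝ := fun n => t * ((n : ℝ) ^ (-α⁻¹) * d ^ (-α⁻¹)) with hsn
    set lam : ℝ → ℂ := fun s => ∑' k : ℕ, (P k : ℂ) *
      Complex.exp (Complex.I * ((s * ((k : ℝ) + 1 - ℓ) : ℝ) : ℂ)) with hlam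
    have hs0 : Tendsto sn atTop (𝓝[>] 0) := by
      refine tendsto_nhdsWithin_iff.2 ⟨?_, ?_⟩
      · have h1 : Tendsto (fun n : ℕ => (n : ℝ) ^ (-α⁻¹)) atTop (𝓝 0) :=
          (tendsto_rpow_neg_atTop (inv_pos.2 hα0)).comp tendsto_natCast_atTop_atTop
        have := (h1.mul_const (d ^ (-α⁻¹))).const_mul t
        simpa using this
      · filter_upwards [eventually_gt_atTop 0] with n hn
        have : (0 : ℝ) < n := by exact_mod_cast hn
        simp only [mem_Ioi, hsn]
        positivity
    have h1 := (tendsto_rpow_mul_charFun_sub_one hα0 hP0 hP1 hP hℓ).comp hs0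
    have h2 : Tendsto (fun n : ℕ => (n : ℂ) * (lam (sn n) - 1)) atTop
        (𝓝 (-((t ^ α : ℝ) : ℂ) * (1 - Complex.I * ((Real.tan (α * π / 2) : ℝ) : ℂ)))) := by
      have h3 := h1.const_mul (((t ^ α / d : ℝ)) : ℂ)
      have hval : (((t ^ α / d : ℝ)) : ℂ) *
          (A * -((-Complex.I) ^ (α : ℂ) * (Real.Gamma (1 - α) : ℂ) / α)) =
          -((t ^ α : ℝ) : ℂ) * (1 - Complex.I * ((Real.tan (α * π / 2) : ℝ) : ℂ)) := by
        have hdc : ((d : ℝ) : ℂ) ≠ 0 := by exact_mod_cast hd.ne'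
        have hαc : ((α : ℝ) : ℂ) ≠ 0 := by exact_mod_cast hα0.ne'
        have hcc : ((Real.cos (α * π / 2) : ℝ) : ℂ) ≠ 0 := by exact_mod_cast hcos
        have hdc' : ((d : ℝ) : ℂ) = A / α * (Real.Gamma (1 - α) * (Real.cos (α * π / 2) : ℝ)) := by
          rw [hdA]; push_cast; ring
        have hprod : (A : ℂ) * (Real.Gamma (1 - α)) = d * α / (Real.cos (α * π / 2) : ℝ) := by
          rw [hdc']; field_simp
        rw [neg_I_cpow_ofReal, Real.tan_eq_sin_div_cos, Complex.ofReal_div, Complex.ofReal_div]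
        calc _ = -((t ^ α : ℝ) : ℂ) / d * (A * Real.Gamma (1 - α)) *
              (((Real.cos (α * π / 2) : ℝ) : ℂ) - Complex.I * ((Real.sin (α * π / 2) : ℝ) : ℂ)) / α := by
                ring
          _ = _ := by
                rw [hprod]; field_simp
      rw [hval] at h3
      refine h3.congr' ?_
      filter_upwards [eventually_gt_atTop 0] with n hn
      have hn : (0 : ℝ) < n := by exact_mod_cast hn
      have hsn' : t ^ α / d * (sn n) ^ (-α) = n := by
        have e1 : (sn n) ^ (-α) = t ^ (-α) * (n * d) := by
          simp only [hsn]
          rw [mul_rpow ht.le (by positivity), mul_rpow (by positivity) (by positivity),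
            ← rpow_mul hn.le, ← rpow_mul hd.le]
          have : -α⁻¹ * -α = 1 := by field_simp
          rw [this, rpow_one, rpow_one]
        rw [e1, rpow_neg ht.le]
        have : t ^ α ≠ 0 := (rpow_pos_of_pos ht _).ne'
        field_simp
      simp only [Function.comp_apply]
      rw [← mul_assoc, ← Complex.ofReal_mul, hsn']
      simp [hlam]
    have h4 := Complex.tendsto_one_add_pow_exp_of_tendsto h2
    refine h4.congr fun n => ?_
    rw [add_sub_cancel]
  rcases lt_trichotomy t 0 with ht | rfl | ht
  · have h := hpos (-t) (by linarith)
    have h' := (Complex.continuous_conj.tendsto _).comp h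
    have e1 : ∀ n : ℕ, (starRingEnd ℂ) ((∑' k : ℕ, (P k : ℂ) * Complex.exp (Complex.I *
        ((-t * ((n : ℝ) ^ (-α⁻¹) * d ^ (-α⁻¹)) * ((k : ℝ) + 1 - ℓ) : ℝ) : ℂ))) ^ n) =
        (∑' k : ℕ, (P k : ℂ) * Complex.exp (Complex.I *
        ((t * ((n : ℝ) ^ (-α⁻¹) * d ^ (-α⁻¹)) * ((k : ℝ) + 1 - ℓ) : ℝ) : ℂ))) ^ n := by
      intro n
      rw [map_pow, Complex.conj_tsum]
      congr 1
      refine tsum_congr fun k => ?_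
      rw [map_mul, Complex.conj_ofReal, ← Complex.exp_conj, map_mul, Complex.conj_I,
        Complex.conj_ofReal]
      congr 2
      push_cast; ring
    have e2 : (starRingEnd ℂ) (Complex.exp (-(((-t) ^ α : ℝ) : ℂ) *
        (1 - Complex.I * ((Real.tan (α * π / 2) : ℝ) : ℂ)))) =
        Complex.exp (-((|t| ^ α : ℝ) : ℂ) *
        (1 - Complex.I * ((Real.sign t : ℝ) : ℂ) * ((Real.tan (α * π / 2) : ℝ) : ℂ))) := by
      rw [← Complex.exp_conj, abs_of_neg ht, Real.sign_of_neg ht]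
      simp only [map_mul, map_neg, map_sub, map_one, Complex.conj_I, Complex.conj_ofReal]
      congr 1
      push_cast; ring
    rw [e2] at h'
    exact h'.congr e1
  · have : ∀ n : ℕ, (∑' k : ℕ, (P k : ℂ) * Complex.exp (Complex.I *
        (((0 : ℝ) * ((n : ℝ) ^ (-α⁻¹) * d ^ (-α⁻¹)) * ((k : ℝ) + 1 - ℓ) : ℝ) : ℂ))) ^ n = 1 := by
      intro n
      have h1 : ∑' k : ℕ, (P k : ℂ) = 1 := by
        have : HasSum (fun k => (P k : ℂ)) 1 := by
          simpa using Complex.hasSum_ofReal.2 hP1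
        exact this.tsum_eq
      simp [h1]
    simp only [this, abs_zero, Real.zero_rpow hα0.ne']
    simp
  · have h := hpos t ht
    rw [abs_of_pos ht, Real.sign_of_pos ht]
    simpa using h

/-! ### The branches of the Thaler map -/

section Branch

variable {γ : ℝ}

lemma thalerG_base_pos (hγ1 : γ ≠ 1) {x : ℝ} (hx : x ∈ Ioc (0 : ℝ) 1) :
    0 < x ^ (1 - γ) + (1 + x) ^ (1 - γ) - 1 := by
  have h1 : 0 < x ^ (1 - γ) := rpow_pos_of_pos hx.1 _
  have h2 : 0 < (1 + x) ^ (1 - γ) := rpow_pos_of_pos (by linarith [hx.1]) _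
  rcases lt_or_gt_of_ne hγ1 with h | h
  · have : 1 < (1 + x) ^ (1 - γ) := one_lt_rpow (by linarith [hx.1]) (by linarith)
    linarith
  · have : 1 ≤ x ^ (1 - γ) := one_le_rpow_of_pos_of_le_one_of_nonpos hx.1 hx.2 (by linarith)
    linarith

lemma thalerG_pos (hγ1 : γ ≠ 1) {x : ℝ} (hx : x ∈ Ioc (0 : ℝ) 1) : 0 < thalerG γ x :=
  rpow_pos_of_pos (thalerG_base_pos hγ1 hx) _

lemma thalerG_rpow (hγ1 : γ ≠ 1) {x : ℝ} (hx : x ∈ Ioc (0 : ℝ) 1) :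
    thalerG γ x ^ (1 - γ) = x ^ (1 - γ) + (1 + x) ^ (1 - γ) - 1 := by
  rw [thalerG, ← rpow_mul (thalerG_base_pos hγ1 hx).le,
    one_div_mul_cancel (sub_ne_zero.2 hγ1.symm), rpow_one]

lemma hasDerivAt_thalerG (hγ1 : γ ≠ 1) {x : ℝ} (hx : x ∈ Ioc (0 : ℝ) 1) :
    HasDerivAt (thalerG γ) (thalerG γ x ^ γ * thalerH γ x) x := by
  have ha : (1 - γ) ≠ 0 := sub_ne_zero.2 hγ1.symm
  have hB := thalerG_base_pos hγ1 hx
  have h1 : HasDerivAt (fun x : ℝ => x ^ (1 - γ)) ((1 - γ) * x ^ (1 - γ - 1)) x :=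
    Real.hasDerivAt_rpow_const (Or.inl hx.1.ne')
  have h2 : HasDerivAt (fun x : ℝ => (1 + x) ^ (1 - γ)) (1 * (1 - γ) * (1 + x) ^ (1 - γ - 1)) x :=
    ((hasDerivAt_id x).const_add 1).rpow_const (Or.inl (by simp; linarith [hx.1]))
  have h3 := ((h1.add h2).sub_const 1).rpow_const (p := 1 / (1 - γ)) (Or.inl hB.ne')
  convert! h3 using 1
  rw [show (1 : ℝ) - γ - 1 = -γ by ring, thalerH, thalerG, ← rpow_mul hB.le,
    show 1 / (1 - γ) - 1 = 1 / (1 - γ) * γ by field_simp; ring, add_comm x 1]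
  simp only [Pi.add_apply]
  field_simp

lemma continuousOn_thalerG (hγ1 : γ ≠ 1) : ContinuousOn (thalerG γ) (Ioc 0 1) := fun _ hx =>
  (hasDerivAt_thalerG hγ1 hx).continuousAt.continuousWithinAt

lemma thalerH_pos {x : ℝ} (hx : 0 < x) : 0 < thalerH γ x :=
  add_pos (rpow_pos_of_pos hx _) (rpow_pos_of_pos (by linarith) _)

lemma monotoneOn_thalerG_div (hγ0 : 0 < γ) (hγ1 : γ ≠ 1) :
    MonotoneOn (fun x => thalerG γ x / x) (Ioc 0 1) := by
  have hd : ∀ x ∈ Ioc (0 : ℝ) 1, HasDerivAt (fun x => thalerG γ x / x)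
      ((thalerG γ x ^ γ * thalerH γ x * x - thalerG γ x * 1) / x ^ 2) x := fun x hx =>
    (hasDerivAt_thalerG hγ1 hx).div (hasDerivAt_id x) hx.1.ne'
  refine monotoneOn_of_deriv_nonneg (convex_Ioc 0 1)
    (fun x hx => (hd x hx).continuousAt.continuousWithinAt)
    (fun x hx => (hd x (interior_subset hx)).differentiableAt.differentiableWithinAt) ?_
  intro x hx
  have hx := interior_subset hx
  rw [(hd x hx).deriv]
  refine div_nonneg ?_ (sq_nonneg x)
  have hg := thalerG_pos hγ1 hx
  have hfac : thalerG γ x = thalerG γ x ^ γ * thalerG γ x ^ (1 - γ) := by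
    rw [← rpow_add hg]; simp
  have hx1 : 0 < x + 1 := by linarith [hx.1]
  have hh : thalerH γ x * x = x ^ (1 - γ) + (1 + x) ^ (1 - γ) - (1 + x) ^ (-γ) := by
    rw [thalerH, sub_eq_add_neg 1 γ, rpow_add hx.1, rpow_add (by linarith : 0 < 1 + x), rpow_one,
      rpow_one, add_comm x 1]
    ring
  have hle : (1 + x) ^ (-γ) ≤ 1 :=
    rpow_le_one_of_one_le_of_nonpos (by linarith [hx.1]) (by linarith)
  have : thalerG γ x ^ γ * thalerH γ x * x - thalerG γ x * 1 =
      thalerG γ x ^ γ * (1 - (1 + x) ^ (-γ)) := by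
    nth_rewrite 2 [hfac]
    rw [thalerG_rpow hγ1 hx, mul_assoc, hh]; ring
  rw [this]
  exact mul_nonneg (rpow_nonneg hg.le _) (by linarith)

lemma strictMonoOn_thalerG (hγ1 : γ ≠ 1) : StrictMonoOn (thalerG γ) (Ioc 0 1) := by
  refine strictMonoOn_of_deriv_pos (convex_Ioc 0 1) (continuousOn_thalerG hγ1) ?_
  intro x hx
  have hx := interior_subset hx
  rw [(hasDerivAt_thalerG hγ1 hx).deriv]
  exact mul_pos (rpow_pos_of_pos (thalerG_pos hγ1 hx) _) (thalerH_pos hx.1)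

lemma thalerG_one (hγ1 : γ ≠ 1) : thalerG γ 1 = 2 := by
  have ha : (1 - γ) ≠ 0 := sub_ne_zero.2 hγ1.symm
  rw [thalerG, one_rpow, add_sub_cancel_left, ← rpow_mul (by norm_num), mul_one_div_cancel ha,
    rpow_one]
  norm_num

lemma thalerG_le_two_mul (hγ0 : 0 < γ) (hγ1 : γ ≠ 1) {x : ℝ} (hx : x ∈ Ioc (0 : ℝ) 1) :
    thalerG γ x ≤ 2 * x := by
  have := monotoneOn_thalerG_div hγ0 hγ1 hx (right_mem_Ioc.2 one_pos) hx.2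
  simp only [thalerG_one hγ1, div_one] at this
  rwa [div_le_iff₀ hx.1] at this

lemma self_lt_thalerG (hγ1 : γ ≠ 1) {x : ℝ} (hx : x ∈ Ioc (0 : ℝ) 1) : x < thalerG γ x := by
  have hg := thalerG_pos hγ1 hx
  by_contra! hle
  have h := thalerG_rpow hγ1 hx
  rcases lt_or_gt_of_ne hγ1 with h1 | h1
  · have := rpow_le_rpow hg.le hle (by linarith : 0 ≤ 1 - γ)
    have : 1 < (1 + x) ^ (1 - γ) := one_lt_rpow (by linarith [hx.1]) (by linarith)
    linarith
  · have := rpow_le_rpow_of_nonpos hg hle (by linarith : 1 - γ ≤ 0)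
    have : (1 + x) ^ (1 - γ) < 1 := rpow_lt_one_of_one_lt_of_neg (by linarith [hx.1]) (by linarith)
    linarith

/-- Expansion: the secant slope of `g` dominates `g x / x` at the left endpoint. -/
lemma mul_div_le_thalerG_sub (hγ0 : 0 < γ) (hγ1 : γ ≠ 1) {x x' : ℝ} (hx : 0 < x) (hxx : x ≤ x')
    (hx' : x' ≤ 1) : (x' - x) * (thalerG γ x / x) ≤ thalerG γ x' - thalerG γ x := by
  have h := monotoneOn_thalerG_div hγ0 hγ1 ⟨hx, hxx.trans hx'⟩ ⟨hx.trans_le hxx, hx'⟩ hxx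
  simp only at h
  rw [le_div_iff₀ (hx.trans_le hxx)] at h
  have : x * (thalerG γ x / x) = thalerG γ x := by field_simp
  linarith

/-- The inverse of `g` on `(0, 2]`. -/
def thalerGInv (γ z : ℝ) : ℝ := Function.invFunOn (thalerG γ) (Ioc 0 1) z

lemma exists_thalerG_eq (hγ0 : 0 < γ) (hγ1 : γ ≠ 1) {z : ℝ} (hz : z ∈ Ioc (0 : ℝ) 2) :
    ∃ x ∈ Ioc (0 : ℝ) 1, thalerG γ x = z := by
  have hz0 := hz.1
  have hz2 := hz.2
  have hmem : z / 2 ∈ Ioc (0 : ℝ) 1 := ⟨by linarith, by linarith⟩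
  have hsub : Icc (z / 2) 1 ⊆ Ioc (0 : ℝ) 1 := fun x hx => ⟨hmem.1.trans_le hx.1, hx.2⟩
  have h1 : thalerG γ (z / 2) ≤ z := by
    have := thalerG_le_two_mul hγ0 hγ1 hmem; linarith
  obtain ⟨x, hx, hxz⟩ := intermediate_value_Icc hmem.2 ((continuousOn_thalerG hγ1).mono hsub)
    ⟨h1, by rw [thalerG_one hγ1]; exact hz2⟩
  exact ⟨x, hsub hx, hxz⟩

lemma thalerGInv_mem (hγ0 : 0 < γ) (hγ1 : γ ≠ 1) {z : ℝ} (hz : z ∈ Ioc (0 : ℝ) 2) :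
    thalerGInv γ z ∈ Ioc (0 : ℝ) 1 :=
  Function.invFunOn_mem (exists_thalerG_eq hγ0 hγ1 hz)

lemma thalerG_thalerGInv (hγ0 : 0 < γ) (hγ1 : γ ≠ 1) {z : ℝ} (hz : z ∈ Ioc (0 : ℝ) 2) :
    thalerG γ (thalerGInv γ z) = z :=
  Function.invFunOn_eq (exists_thalerG_eq hγ0 hγ1 hz)

lemma thalerG_mem (hγ1 : γ ≠ 1) {x : ℝ} (hx : x ∈ Ioc (0 : ℝ) 1) :
    thalerG γ x ∈ Ioc (0 : ℝ) 2 :=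
  ⟨thalerG_pos hγ1 hx, by
    rw [← thalerG_one hγ1]
    exact (strictMonoOn_thalerG hγ1).monotoneOn hx (right_mem_Ioc.2 one_pos) hx.2⟩

lemma thalerGInv_thalerG (hγ0 : 0 < γ) (hγ1 : γ ≠ 1) {x : ℝ} (hx : x ∈ Ioc (0 : ℝ) 1) :
    thalerGInv γ (thalerG γ x) = x :=
  (strictMonoOn_thalerG hγ1).injOn (thalerGInv_mem hγ0 hγ1 (thalerG_mem hγ1 hx)) hx
    (thalerG_thalerGInv hγ0 hγ1 (thalerG_mem hγ1 hx))

lemma thalerGInv_lt_iff (hγ0 : 0 < γ) (hγ1 : γ ≠ 1) {z w : ℝ} (hz : z ∈ Ioc (0 : ℝ) 2)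
    (hw : w ∈ Ioc (0 : ℝ) 2) : thalerGInv γ z < thalerGInv γ w ↔ z < w := by
  rw [← (strictMonoOn_thalerG hγ1).lt_iff_lt (thalerGInv_mem hγ0 hγ1 hz)
    (thalerGInv_mem hγ0 hγ1 hw), thalerG_thalerGInv hγ0 hγ1 hz, thalerG_thalerGInv hγ0 hγ1 hw]

lemma thalerGInv_le_iff (hγ0 : 0 < γ) (hγ1 : γ ≠ 1) {z w : ℝ} (hz : z ∈ Ioc (0 : ℝ) 2)
    (hw : w ∈ Ioc (0 : ℝ) 2) : thalerGInv γ z ≤ thalerGInv γ w ↔ z ≤ w := by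
  rw [← not_lt, thalerGInv_lt_iff hγ0 hγ1 hw hz, not_lt]

lemma thalerGInv_lt_self (hγ0 : 0 < γ) (hγ1 : γ ≠ 1) {z : ℝ} (hz : z ∈ Ioc (0 : ℝ) 2) :
    thalerGInv γ z < z := by
  have := self_lt_thalerG hγ1 (thalerGInv_mem hγ0 hγ1 hz)
  rwa [thalerG_thalerGInv hγ0 hγ1 hz] at this

lemma abs_thalerGInv_sub_le (hγ0 : 0 < γ) (hγ1 : γ ≠ 1) {c : ℝ} (hc : c ∈ Ioc (0 : ℝ) 1) {z w : ℝ}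
    (hz : z ∈ Ioc (0 : ℝ) 2) (hw : w ∈ Ioc (0 : ℝ) 2) (hcz : c ≤ thalerGInv γ z)
    (hcw : c ≤ thalerGInv γ w) :
    |thalerGInv γ z - thalerGInv γ w| * (thalerG γ c / c) ≤ |z - w| := by
  wlog hzw : z ≤ w generalizing z w
  · rw [abs_sub_comm, abs_sub_comm z w]
    exact this hw hz hcw hcz (le_of_not_ge hzw)
  have hmz := thalerGInv_mem hγ0 hγ1 hz
  have hmw := thalerGInv_mem hγ0 hγ1 hw
  have hle := (thalerGInv_le_iff hγ0 hγ1 hz hw).2 hzw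
  have h1 := mul_div_le_thalerG_sub hγ0 hγ1 hmz.1 hle hmw.2
  have h2 := monotoneOn_thalerG_div hγ0 hγ1 hc hmz hcz
  simp only at h2
  rw [thalerG_thalerGInv hγ0 hγ1 hz, thalerG_thalerGInv hγ0 hγ1 hw] at h1
  rw [thalerG_thalerGInv hγ0 hγ1 hz] at h2
  rw [abs_sub_comm, abs_sub_comm z, abs_of_nonneg (by linarith), abs_of_nonneg (by linarith)]
  refine le_trans ?_ h1
  gcongr

lemma abs_thalerGInv_sub_le_one (hγ0 : 0 < γ) (hγ1 : γ ≠ 1) {z w : ℝ}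
    (hz : z ∈ Ioc (0 : ℝ) 2) (hw : w ∈ Ioc (0 : ℝ) 2) :
    |thalerGInv γ z - thalerGInv γ w| ≤ |z - w| := by
  have hmz := thalerGInv_mem hγ0 hγ1 hz
  have hmw := thalerGInv_mem hγ0 hγ1 hw
  have hc : min (thalerGInv γ z) (thalerGInv γ w) ∈ Ioc (0 : ℝ) 1 :=
    ⟨lt_min hmz.1 hmw.1, (min_le_left _ _).trans hmz.2⟩
  refine le_trans ?_ (abs_thalerGInv_sub_le hγ0 hγ1 hc hz hw (min_le_left _ _) (min_le_right _ _))
  refine le_mul_of_one_le_right (abs_nonneg _) ?_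
  rw [le_div_iff₀ hc.1, one_mul]
  exact (self_lt_thalerG hγ1 hc).le

lemma div_le_div_thalerGInv (hγ0 : 0 < γ) (hγ1 : γ ≠ 1) {z w : ℝ}
    (hz : z ∈ Ioc (0 : ℝ) 2) (hw : w ∈ Ioc (0 : ℝ) 2) (hzw : z ≤ w) :
    thalerGInv γ w / thalerGInv γ z ≤ w / z := by
  have hmz := thalerGInv_mem hγ0 hγ1 hz
  have hmw := thalerGInv_mem hγ0 hγ1 hw
  have h := monotoneOn_thalerG_div hγ0 hγ1 hmz hmw ((thalerGInv_le_iff hγ0 hγ1 hz hw).2 hzw)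
  simp only at h
  rw [thalerG_thalerGInv hγ0 hγ1 hz, thalerG_thalerGInv hγ0 hγ1 hw,
    div_le_div_iff₀ hmz.1 hmw.1] at h
  rw [div_le_div_iff₀ hmz.1 hz.1]
  linarith

end Branch

/-- Admissible parameters of the Thaler map: `γ > 1/2`, `γ ≠ 1`, and `xs` is the branch point. -/
structure ThalerParam (γ xs : ℝ) : Prop where
  half_lt : 1 / 2 < γ
  ne_one : γ ≠ 1
  pos : 0 < xs
  lt_one : xs < 1
  eq_two : xs ^ (1 - γ) + (1 + xs) ^ (1 - γ) = 2

/-- The `k`-th preimage of `z` along the branch through the neutral fixed point. -/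
def thalerBack (γ : ℝ) (k : ℕ) (z : ℝ) : ℝ := (thalerGInv γ)^[k] z

/-- The inverse branches of the return map. -/
def thalerBranch (γ : ℝ) (k : ℕ) (z : ℝ) : ℝ := thalerGInv γ (1 + thalerBack γ k z)

lemma thalerBack_zero (γ z : ℝ) : thalerBack γ 0 z = z := rfl

lemma thalerBack_succ (γ : ℝ) (k : ℕ) (z : ℝ) :
    thalerBack γ (k + 1) z = thalerGInv γ (thalerBack γ k z) :=
  Function.iterate_succ_apply' _ _ _

lemma thalerBack_succ' (γ : ℝ) (k : ℕ) (z : ℝ) :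
    thalerBack γ (k + 1) z = thalerBack γ k (thalerGInv γ z) :=
  Function.iterate_succ_apply _ _ _

lemma Ioc_zero_one_subset {z : ℝ} (hz : z ∈ Ioc (0 : ℝ) 1) : z ∈ Ioc (0 : ℝ) 2 :=
  ⟨hz.1, hz.2.trans one_le_two⟩

namespace ThalerParam

variable {γ xs : ℝ}

lemma one_mem (_ : ThalerParam γ xs) : (1 : ℝ) ∈ Ioc (0 : ℝ) 1 := right_mem_Ioc.2 one_pos

variable (hp : ThalerParam γ xs)

include hp

lemma gamma_pos : 0 < γ := by linarith [hp.half_lt]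

lemma mem : xs ∈ Ioc (0 : ℝ) 1 := ⟨hp.pos, hp.lt_one.le⟩

lemma thalerG_xs : thalerG γ xs = 1 := by
  rw [thalerG, hp.eq_two]; norm_num

lemma thalerGInv_one : thalerGInv γ 1 = xs := by
  rw [← hp.thalerG_xs]; exact thalerGInv_thalerG hp.gamma_pos hp.ne_one hp.mem

lemma back_mem {z : ℝ} (hz : z ∈ Ioc (0 : ℝ) 1) (k : ℕ) : thalerBack γ k z ∈ Ioc (0 : ℝ) 1 := by
  induction k with
  | zero => exact hz
  | succ k ih =>
    rw [thalerBack_succ]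
    exact thalerGInv_mem hp.gamma_pos hp.ne_one (Ioc_zero_one_subset ih)

lemma thalerG_back_succ {z : ℝ} (hz : z ∈ Ioc (0 : ℝ) 1) (k : ℕ) :
    thalerG γ (thalerBack γ (k + 1) z) = thalerBack γ k z := by
  rw [thalerBack_succ]
  exact thalerG_thalerGInv hp.gamma_pos hp.ne_one (Ioc_zero_one_subset (hp.back_mem hz k))

lemma back_lt_iff {z w : ℝ} (hz : z ∈ Ioc (0 : ℝ) 1) (hw : w ∈ Ioc (0 : ℝ) 1) (k : ℕ) :
    thalerBack γ k z < thalerBack γ k w ↔ z < w := by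
  induction k with
  | zero => rfl
  | succ k ih =>
    rw [thalerBack_succ, thalerBack_succ, thalerGInv_lt_iff hp.gamma_pos hp.ne_one
      (Ioc_zero_one_subset (hp.back_mem hz k)) (Ioc_zero_one_subset (hp.back_mem hw k)), ih]

lemma back_le_iff {z w : ℝ} (hz : z ∈ Ioc (0 : ℝ) 1) (hw : w ∈ Ioc (0 : ℝ) 1) (k : ℕ) :
    thalerBack γ k z ≤ thalerBack γ k w ↔ z ≤ w := by
  rw [← not_lt, hp.back_lt_iff hw hz, not_lt]

lemma abs_back_sub_le {z w : ℝ} (hz : z ∈ Ioc (0 : ℝ) 1) (hw : w ∈ Ioc (0 : ℝ) 1) (k : ℕ) :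
    |thalerBack γ k z - thalerBack γ k w| ≤ |z - w| := by
  induction k with
  | zero => exact le_rfl
  | succ k ih =>
    rw [thalerBack_succ, thalerBack_succ]
    exact (abs_thalerGInv_sub_le_one hp.gamma_pos hp.ne_one
      (Ioc_zero_one_subset (hp.back_mem hz k)) (Ioc_zero_one_subset (hp.back_mem hw k))).trans ih

lemma back_div_back_le {z w : ℝ} (hz : z ∈ Ioc (0 : ℝ) 1) (hw : w ∈ Ioc (0 : ℝ) 1) (hzw : z ≤ w)
    (k : ℕ) : thalerBack γ k w / thalerBack γ k z ≤ w / z := by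
  induction k with
  | zero => exact le_rfl
  | succ k ih =>
    rw [thalerBack_succ, thalerBack_succ]
    exact (div_le_div_thalerGInv hp.gamma_pos hp.ne_one
      (Ioc_zero_one_subset (hp.back_mem hz k)) (Ioc_zero_one_subset (hp.back_mem hw k))
      ((hp.back_le_iff hz hw k).2 hzw)).trans ih

lemma mem_of_mem {z : ℝ} (hz : z ∈ Ioc xs 1) : z ∈ Ioc (0 : ℝ) 1 := ⟨hp.pos.trans hz.1, hz.2⟩

lemma back_xs (k : ℕ) : thalerBack γ k xs = thalerBack γ (k + 1) 1 := by
  rw [thalerBack_succ', hp.thalerGInv_one]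

lemma back_succ_lt (k : ℕ) {z : ℝ} (hz : z ∈ Ioc (0 : ℝ) 1) :
    thalerBack γ (k + 1) z < thalerBack γ k z := by
  rw [thalerBack_succ]
  exact thalerGInv_lt_self hp.gamma_pos hp.ne_one (Ioc_zero_one_subset (hp.back_mem hz k))

lemma strictAnti_back {z : ℝ} (hz : z ∈ Ioc (0 : ℝ) 1) : StrictAnti fun k => thalerBack γ k z :=
  strictAnti_nat_of_succ_lt fun k => hp.back_succ_lt k hz

lemma back_mem_Ioc {z : ℝ} (hz : z ∈ Ioc xs 1) (k : ℕ) :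
    thalerBack γ k z ∈ Ioc (thalerBack γ (k + 1) 1) (thalerBack γ k 1) := by
  rw [← hp.back_xs]
  exact ⟨(hp.back_lt_iff hp.mem (hp.mem_of_mem hz) k).2 hz.1,
    (hp.back_le_iff (hp.mem_of_mem hz) hp.one_mem k).2 hz.2⟩

lemma back_succ_le_xs {z : ℝ} (hz : z ∈ Ioc (0 : ℝ) 1) (k : ℕ) : thalerBack γ (k + 1) z ≤ xs := by
  have h1 : thalerBack γ (k + 1) z ≤ thalerBack γ 1 z :=
    (hp.strictAnti_back hz).antitone (Nat.le_add_left 1 k)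
  have h2 := (hp.back_le_iff hz hp.one_mem 1).2 hz.2
  have h3 : thalerBack γ 1 1 = xs := by rw [← hp.back_xs 0, thalerBack_zero]
  linarith

lemma one_add_back_mem {z : ℝ} (hz : z ∈ Ioc (0 : ℝ) 1) (k : ℕ) :
    1 + thalerBack γ k z ∈ Ioc (0 : ℝ) 2 := by
  have := hp.back_mem hz k
  exact ⟨by linarith [this.1], by linarith [this.2]⟩

lemma branch_mem_Ioc {z : ℝ} (hz : z ∈ Ioc (0 : ℝ) 1) (k : ℕ) : thalerBranch γ k z ∈ Ioc xs 1 := by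
  have hm := hp.back_mem hz k
  have h := hp.one_add_back_mem hz k
  refine ⟨?_, (thalerGInv_mem hp.gamma_pos hp.ne_one h).2⟩
  rw [← hp.thalerGInv_one, thalerBranch, thalerGInv_lt_iff hp.gamma_pos hp.ne_one (by norm_num) h]
  linarith [hm.1]

lemma thalerG_branch {z : ℝ} (hz : z ∈ Ioc (0 : ℝ) 1) (k : ℕ) :
    thalerG γ (thalerBranch γ k z) = 1 + thalerBack γ k z :=
  thalerG_thalerGInv hp.gamma_pos hp.ne_one (hp.one_add_back_mem hz k)

lemma abs_branch_sub_le {z w : ℝ} (hz : z ∈ Ioc (0 : ℝ) 1) (hw : w ∈ Ioc (0 : ℝ) 1) (k : ℕ) :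
    |thalerBranch γ k z - thalerBranch γ k w| ≤ xs * |z - w| := by
  have h := abs_thalerGInv_sub_le hp.gamma_pos hp.ne_one hp.mem (hp.one_add_back_mem hz k)
    (hp.one_add_back_mem hw k) (hp.branch_mem_Ioc hz k).1.le (hp.branch_mem_Ioc hw k).1.le
  rw [hp.thalerG_xs, add_sub_add_left_eq_sub, mul_one_div, div_le_iff₀ hp.pos] at h
  calc _ ≤ |thalerBack γ k z - thalerBack γ k w| * xs := h
    _ ≤ |z - w| * xs := by
      have := hp.abs_back_sub_le hz hw k
      have := hp.pos
      gcongr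
    _ = _ := mul_comm _ _

lemma thalerT_branch {z : ℝ} (hz : z ∈ Ioc (0 : ℝ) 1) (k : ℕ) :
    thalerT γ xs (thalerBranch γ k z) = thalerBack γ k z := by
  have h := hp.branch_mem_Ioc hz k
  rw [thalerT, if_neg (not_le.2 (hp.pos.trans h.1)), if_neg (not_le.2 h.1), hp.thalerG_branch hz]
  ring

lemma thalerT_back_succ {z : ℝ} (hz : z ∈ Ioc (0 : ℝ) 1) (k : ℕ) :
    thalerT γ xs (thalerBack γ (k + 1) z) = thalerBack γ k z := by
  rw [thalerT, if_neg (not_le.2 (hp.back_mem hz _).1), if_pos (hp.back_succ_le_xs hz k),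
    hp.thalerG_back_succ hz]

lemma iterate_thalerT_branch {z : ℝ} (hz : z ∈ Ioc (0 : ℝ) 1) (j i : ℕ) :
    (thalerT γ xs)^[j + 1] (thalerBranch γ (i + j) z) = thalerBack γ i z := by
  induction j generalizing i with
  | zero => exact hp.thalerT_branch hz i
  | succ j ih =>
    have : i + (j + 1) = (i + 1) + j := by ring
    rw [Function.iterate_succ_apply', this, ih, hp.thalerT_back_succ hz]

lemma thalerTau_branch {z : ℝ} (hz : z ∈ Ioc xs 1) (k : ℕ) :
    thalerTau γ xs (thalerBranch γ k z) = k + 1 := by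
  have hz' := hp.mem_of_mem hz
  rw [thalerTau]
  refine IsLeast.csInf_eq ⟨⟨Nat.le_add_left 1 k, ?_⟩, ?_⟩
  · have := hp.iterate_thalerT_branch hz' k 0
    rw [zero_add] at this
    rw [this]; exact hz
  · rintro n ⟨hn1, hn⟩
    by_contra! hlt
    obtain ⟨j, rfl⟩ : ∃ j, n = j + 1 := ⟨n - 1, by omega⟩
    obtain ⟨i, hi⟩ : ∃ i, k = (i + 1) + j := ⟨k - j - 1, by omega⟩
    rw [hi, hp.iterate_thalerT_branch hz'] at hn
    exact absurd (hp.back_succ_le_xs hz' i) (not_le.2 hn.1)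

lemma thalerF_branch {z : ℝ} (hz : z ∈ Ioc xs 1) (k : ℕ) :
    thalerF γ xs (thalerBranch γ k z) = z := by
  rw [thalerF, hp.thalerTau_branch hz]
  have := hp.iterate_thalerT_branch (hp.mem_of_mem hz) k 0
  rwa [zero_add] at this

lemma tendsto_back : Tendsto (fun k => thalerBack γ k 1) atTop (𝓝 0) := by
  have hanti := (hp.strictAnti_back hp.one_mem).antitone
  have hbdd : BddBelow (range fun k => thalerBack γ k 1) :=
    ⟨0, by rintro _ ⟨k, rfl⟩; exact (hp.back_mem hp.one_mem k).1.le⟩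
  have ht := tendsto_atTop_ciInf hanti hbdd
  set L := ⨅ k, thalerBack γ k 1
  have hL0 : 0 ≤ L := ge_of_tendsto' ht fun k => (hp.back_mem hp.one_mem k).1.le
  rcases hL0.eq_or_lt with h | h
  · rwa [h]
  · exfalso
    have hL1 : L ≤ 1 := le_of_tendsto' ht fun k => (hp.back_mem hp.one_mem k).2
    have hLm : L ∈ Ioc (0 : ℝ) 1 := ⟨h, hL1⟩
    have h1 := (hasDerivAt_thalerG hp.ne_one hLm).continuousAt.tendsto.comp
      (ht.comp (tendsto_add_atTop_nat 1))
    have h2 : (thalerG γ ∘ (fun k => thalerBack γ k 1) ∘ fun k => k + 1) =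
        fun k => thalerBack γ k 1 := by
      funext k; exact hp.thalerG_back_succ hp.one_mem k
    rw [h2] at h1
    exact (self_lt_thalerG hp.ne_one hLm).ne (tendsto_nhds_unique ht h1)

lemma exists_back_eq {k : ℕ} {w : ℝ}
    (hw : w ∈ Ioc (thalerBack γ (k + 1) 1) (thalerBack γ k 1)) :
    ∃ z ∈ Ioc xs 1, thalerBack γ k z = w := by
  induction k generalizing w with
  | zero =>
    refine ⟨w, ?_, rfl⟩
    rwa [← hp.back_xs, thalerBack_zero, thalerBack_zero] at hw
  | succ k ih =>
    have hw0 : w ∈ Ioc (0 : ℝ) 1 := ⟨(hp.back_mem hp.one_mem _).1.trans hw.1,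
      hw.2.trans (hp.back_mem hp.one_mem _).2⟩
    have hmono := strictMonoOn_thalerG hp.ne_one
    have h1 := hmono (hp.back_mem hp.one_mem (k + 1 + 1)) hw0 hw.1
    have h2 := hmono.monotoneOn hw0 (hp.back_mem hp.one_mem (k + 1)) hw.2
    rw [hp.thalerG_back_succ hp.one_mem] at h1 h2
    obtain ⟨z, hz, hzw⟩ := ih ⟨h1, h2⟩
    refine ⟨z, hz, ?_⟩
    rw [thalerBack_succ, hzw, thalerGInv_thalerG hp.gamma_pos hp.ne_one hw0]

/-- The set of points of `Y` whose first return time is `k + 1`. -/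
lemma branch_image (k : ℕ) : thalerBranch γ k '' Ioc xs 1 =
    Ioc (thalerGInv γ (1 + thalerBack γ (k + 1) 1)) (thalerGInv γ (1 + thalerBack γ k 1)) := by
  have h1 := hp.one_add_back_mem hp.one_mem (k + 1)
  have h0 := hp.one_add_back_mem hp.one_mem k
  ext y
  constructor
  · rintro ⟨z, hz, rfl⟩
    have hb := hp.back_mem_Ioc hz k
    have hm := hp.one_add_back_mem (hp.mem_of_mem hz) k
    exact ⟨(thalerGInv_lt_iff hp.gamma_pos hp.ne_one h1 hm).2 (by linarith [hb.1]),
      (thalerGInv_le_iff hp.gamma_pos hp.ne_one hm h0).2 (by linarith [hb.2])⟩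
  · intro hy
    have hy0 : y ∈ Ioc (0 : ℝ) 1 := ⟨(thalerGInv_mem hp.gamma_pos hp.ne_one h1).1.trans hy.1,
      hy.2.trans (thalerGInv_mem hp.gamma_pos hp.ne_one h0).2⟩
    have hmono := strictMonoOn_thalerG hp.ne_one
    have g1 := hmono (thalerGInv_mem hp.gamma_pos hp.ne_one h1) hy0 hy.1
    have g0 := hmono.monotoneOn hy0 (thalerGInv_mem hp.gamma_pos hp.ne_one h0) hy.2
    rw [thalerG_thalerGInv hp.gamma_pos hp.ne_one h1] at g1
    rw [thalerG_thalerGInv hp.gamma_pos hp.ne_one h0] at g0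
    obtain ⟨z, hz, hzw⟩ := hp.exists_back_eq (k := k) (w := thalerG γ y - 1)
      ⟨by linarith, by linarith⟩
    refine ⟨z, hz, ?_⟩
    rw [thalerBranch, hzw, add_sub_cancel, thalerGInv_thalerG hp.gamma_pos hp.ne_one hy0]

lemma iUnion_branch_image : ⋃ k, thalerBranch γ k '' Ioc xs 1 = Ioc xs 1 := by
  refine Subset.antisymm (iUnion_subset fun k => ?_) ?_
  · rintro _ ⟨z, hz, rfl⟩
    exact hp.branch_mem_Ioc (hp.mem_of_mem hz) k
  · intro y hy
    have hy0 := hp.mem_of_mem hy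
    have h1 := strictMonoOn_thalerG hp.ne_one hp.mem hy0 hy.1
    rw [hp.thalerG_xs] at h1
    have h2 := (thalerG_mem hp.ne_one hy0).2
    have hex : ∃ k, thalerBack γ (k + 1) 1 < thalerG γ y - 1 :=
      ((hp.tendsto_back.comp (tendsto_add_atTop_nat 1)).eventually
        (gt_mem_nhds (by linarith : 0 < thalerG γ y - 1))).exists
    classical
    have hfind := Nat.find_spec hex
    have hle : thalerG γ y - 1 ≤ thalerBack γ (Nat.find hex) 1 := by
      rcases Nat.eq_zero_or_pos (Nat.find hex) with h | h
      · rw [h, thalerBack_zero]; linarith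
      · have := Nat.find_min hex (Nat.sub_lt h one_pos)
        rw [Nat.sub_add_cancel (Nat.one_le_iff_ne_zero.2 h.ne')] at this
        exact not_lt.1 this
    obtain ⟨z, hz, hzw⟩ := hp.exists_back_eq ⟨hfind, hle⟩
    refine mem_iUnion.2 ⟨Nat.find hex, z, hz, ?_⟩
    rw [thalerBranch, hzw, add_sub_cancel, thalerGInv_thalerG hp.gamma_pos hp.ne_one hy0]

lemma pairwise_disjoint_branch_image :
    Pairwise (Function.onFun Disjoint fun k => thalerBranch γ k '' Ioc xs 1) := by
  intro i j hij
  refine Set.disjoint_left.2 ?_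
  rintro _ ⟨z, hz, rfl⟩ ⟨w, hw, hzw⟩
  have h1 := hp.thalerTau_branch hz i
  rw [← hzw, hp.thalerTau_branch hw j] at h1
  omega

end ThalerParam

/-! ### Distribution of the return time -/

/-- The `μ_Y`-measure of the set of points with first return time `k + 1`. -/
def thalerMass (γ : ℝ) (k : ℕ) : ℝ :=
  ((1 + thalerBack γ k 1) ^ (1 - γ) - (1 + thalerBack γ (k + 1) 1) ^ (1 - γ)) / (2 ^ (1 - γ) - 1)

lemma two_rpow_sub_one_ne_zero {a : ℝ} (ha : a ≠ 0) : (2 : ℝ) ^ a - 1 ≠ 0 := by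
  intro h
  rw [sub_eq_zero, ← one_rpow a, rpow_left_inj two_pos.le one_pos.le ha] at h
  norm_num at h

lemma tendsto_one_add_rpow_sub_one_div (b : ℝ) :
    Tendsto (fun e : ℝ => ((1 + e) ^ b - 1) / e) (𝓝[≠] 0) (𝓝 b) := by
  have h : HasDerivAt (fun e : ℝ => (1 + e) ^ b) b 0 := by
    have h1 : HasDerivAt (fun e : ℝ => 1 + e) 1 0 := (hasDerivAt_id 0).const_add 1
    have := h1.rpow_const (p := b) (Or.inl (by norm_num))
    simpa using this
  have := h.tendsto_slope_zero
  simpa [div_eq_inv_mul] using this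

section Neutral

variable {γ : ℝ} (hγ0 : 0 < γ) (hγ1 : γ ≠ 1)

include hγ1 in
lemma thalerG_eq_mul {x : ℝ} (hx : x ∈ Ioc (0 : ℝ) 1) :
    0 < 1 + ((1 + x) ^ (1 - γ) - 1) / x ^ (1 - γ) ∧
    thalerG γ x = x * (1 + ((1 + x) ^ (1 - γ) - 1) / x ^ (1 - γ)) ^ (1 / (1 - γ)) := by
  have ha : (1 - γ) ≠ 0 := sub_ne_zero.2 hγ1.symm
  have hxa : 0 < x ^ (1 - γ) := rpow_pos_of_pos hx.1 _
  have hB := thalerG_base_pos hγ1 hx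
  have key : 1 + ((1 + x) ^ (1 - γ) - 1) / x ^ (1 - γ) =
      (x ^ (1 - γ) + (1 + x) ^ (1 - γ) - 1) / x ^ (1 - γ) := by field_simp; ring
  rw [key]
  refine ⟨div_pos hB hxa, ?_⟩
  rw [div_rpow hB.le hxa.le, ← rpow_mul hx.1.le, mul_one_div_cancel ha, rpow_one, thalerG,
    mul_div_cancel₀ _ hx.1.ne']

include hγ0 hγ1 in
lemma tendsto_thalerG_quotient (b : ℝ) :
    Tendsto (fun x : ℝ => ((1 + ((1 + x) ^ (1 - γ) - 1) / x ^ (1 - γ)) ^ b - 1) / x ^ γ)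
      (𝓝[>] 0) (𝓝 (b * (1 - γ))) := by
  have ha : (1 - γ) ≠ 0 := sub_ne_zero.2 hγ1.symm
  set e : ℝ → ℝ := fun x => ((1 + x) ^ (1 - γ) - 1) / x ^ (1 - γ) with he
  have h1 : Tendsto (fun x : ℝ => ((1 + x) ^ (1 - γ) - 1) / x) (𝓝[>] 0) (𝓝 (1 - γ)) :=
    (tendsto_one_add_rpow_sub_one_div (1 - γ)).mono_left
      (nhdsWithin_mono _ fun x hx => (mem_Ioi.1 hx).ne')
  have hex : ∀ x : ℝ, 0 < x → e x = ((1 + x) ^ (1 - γ) - 1) / x * x ^ γ := fun x hx => by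
    rw [he]; simp only
    rw [rpow_sub hx, rpow_one]
    have := (rpow_pos_of_pos hx γ).ne'
    field_simp
  have hxγ : Tendsto (fun x : ℝ => x ^ γ) (𝓝[>] 0) (𝓝 0) := by
    have : ContinuousAt (fun x : ℝ => x ^ γ) 0 := continuousAt_rpow_const _ _ (Or.inr hγ0.le)
    have := this.tendsto
    rw [zero_rpow hγ0.ne'] at this
    exact this.mono_left nhdsWithin_le_nhds
  have hpos : ∀ᶠ x : ℝ in 𝓝[>] 0, 0 < x := eventually_mem_nhdsWithin
  have he0 : Tendsto e (𝓝[>] 0) (𝓝 0) := by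
    have := h1.mul hxγ
    rw [mul_zero] at this
    exact this.congr' (hpos.mono fun x hx => (hex x hx).symm)
  have hne : ∀ x : ℝ, 0 < x → e x ≠ 0 := fun x hx => by
    refine div_ne_zero (sub_ne_zero.2 fun h => ?_) (rpow_pos_of_pos hx _).ne'
    have := (rpow_left_inj (by linarith) one_pos.le ha).1 (h.trans (one_rpow _).symm)
    linarith
  have he1 : Tendsto e (𝓝[>] 0) (𝓝[≠] 0) :=
    tendsto_nhdsWithin_iff.2 ⟨he0, hpos.mono fun x hx => hne x hx⟩
  have h2 := ((tendsto_one_add_rpow_sub_one_div b).comp he1).mul h1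
  refine h2.congr' (hpos.mono fun x hx => ?_)
  have hne' := hne x hx
  have hq : ((1 + x) ^ (1 - γ) - 1) / x = e x / x ^ γ := by
    rw [hex x hx, mul_div_cancel_right₀ _ (rpow_pos_of_pos hx γ).ne']
  simp only [Function.comp]
  rw [hq]
  change _ = ((1 + e x) ^ b - 1) / x ^ γ
  field_simp

include hγ0 hγ1 in
lemma tendsto_rpow_neg_sub_thalerG :
    Tendsto (fun x : ℝ => x ^ (-γ) - thalerG γ x ^ (-γ)) (𝓝[>] 0) (𝓝 γ) := by
  have ha : (1 - γ) ≠ 0 := sub_ne_zero.2 hγ1.symm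
  have h := (tendsto_thalerG_quotient hγ0 hγ1 (1 / (1 - γ) * -γ)).neg
  have hlim : -(1 / (1 - γ) * -γ * (1 - γ)) = γ := by field_simp
  rw [hlim] at h
  refine h.congr' ?_
  filter_upwards [Ioc_mem_nhdsGT (zero_lt_one (α := ℝ))] with x hx
  obtain ⟨h1, h2⟩ := thalerG_eq_mul hγ1 hx
  rw [h2, mul_rpow hx.1.le (rpow_nonneg h1.le _), ← rpow_mul h1.le, rpow_neg hx.1.le]
  have := (rpow_pos_of_pos hx.1 γ).ne'
  field_simp
  ring

include hγ0 hγ1 in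
lemma tendsto_thalerG_sub_div :
    Tendsto (fun x : ℝ => (thalerG γ x - x) / x ^ (1 + γ)) (𝓝[>] 0) (𝓝 1) := by
  have ha : (1 - γ) ≠ 0 := sub_ne_zero.2 hγ1.symm
  have h := tendsto_thalerG_quotient hγ0 hγ1 (1 / (1 - γ))
  rw [one_div_mul_cancel ha] at h
  refine h.congr' ?_
  filter_upwards [Ioc_mem_nhdsGT (zero_lt_one (α := ℝ))] with x hx
  obtain ⟨h1, h2⟩ := thalerG_eq_mul hγ1 hx
  rw [h2, rpow_add hx.1, rpow_one]
  have := (rpow_pos_of_pos hx.1 γ).ne'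
  have := hx.1.ne'
  field_simp

end Neutral

namespace ThalerParam

variable {γ xs : ℝ} (hp : ThalerParam γ xs)

include hp

lemma one_sub_ne_zero : 1 - γ ≠ 0 := sub_ne_zero.2 hp.ne_one.symm

lemma back_pos (k : ℕ) : 0 < thalerBack γ k 1 := (hp.back_mem hp.one_mem k).1

lemma tendsto_back_nhdsGT : Tendsto (fun k => thalerBack γ k 1) atTop (𝓝[>] 0) :=
  tendsto_nhdsWithin_iff.2 ⟨hp.tendsto_back, Eventually.of_forall fun k => hp.back_pos k⟩

lemma tendsto_back_rpow_neg_div :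
    Tendsto (fun k : ℕ => thalerBack γ k 1 ^ (-γ) / k) atTop (𝓝 γ) := by
  have h := (tendsto_rpow_neg_sub_thalerG hp.gamma_pos hp.ne_one).comp
    (hp.tendsto_back_nhdsGT.comp (tendsto_add_atTop_nat 1))
  have h2 := h.cesaro
  have h3 : Tendsto (fun n : ℕ => (n : ℝ)⁻¹ * 1) atTop (𝓝 (0 * 1)) :=
    tendsto_inv_atTop_nhds_zero_nat.mul_const 1
  have h4 := h2.add h3
  rw [zero_mul, add_zero] at h4
  refine h4.congr fun n => ?_
  have hs : ∑ i ∈ Finset.range n, ((fun x : ℝ => x ^ (-γ) - thalerG γ x ^ (-γ)) ∘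
      (fun k => thalerBack γ k 1) ∘ fun k => k + 1) i = thalerBack γ n 1 ^ (-γ) - 1 := by
    have : ∀ i, ((fun x : ℝ => x ^ (-γ) - thalerG γ x ^ (-γ)) ∘
      (fun k => thalerBack γ k 1) ∘ fun k => k + 1) i =
        thalerBack γ (i + 1) 1 ^ (-γ) - thalerBack γ i 1 ^ (-γ) := fun i => by
      simp only [Function.comp, hp.thalerG_back_succ hp.one_mem]
    simp_rw [this]
    rw [Finset.sum_range_sub fun i => thalerBack γ i 1 ^ (-γ), thalerBack_zero, one_rpow]
  rw [hs]; ring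

lemma tendsto_back_rpow_mul :
    Tendsto (fun k : ℕ => thalerBack γ k 1 ^ γ * k) atTop (𝓝 γ⁻¹) := by
  refine (hp.tendsto_back_rpow_neg_div.inv₀ hp.gamma_pos.ne').congr fun k => ?_
  rw [rpow_neg (hp.back_pos k).le, inv_div, div_inv_eq_mul, mul_comm]

lemma tendsto_back_succ_rpow_mul :
    Tendsto (fun k : ℕ => thalerBack γ (k + 1) 1 ^ γ * ((k : ℝ) + 1)) atTop (𝓝 γ⁻¹) := by
  refine (hp.tendsto_back_rpow_mul.comp (tendsto_add_atTop_nat 1)).congr fun k => ?_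
  simp

lemma tendsto_back_mul_rpow :
    Tendsto (fun k : ℕ => thalerBack γ k 1 * (k : ℝ) ^ γ⁻¹) atTop (𝓝 (γ⁻¹ ^ γ⁻¹)) := by
  have hγ := hp.gamma_pos
  refine (hp.tendsto_back_rpow_mul.rpow_const (p := γ⁻¹) (Or.inr (by positivity))).congr
    fun k => ?_
  rw [mul_rpow (rpow_nonneg (hp.back_pos k).le _) k.cast_nonneg, ← rpow_mul (hp.back_pos k).le,
    mul_inv_cancel₀ hγ.ne', rpow_one]

lemma thalerMass_nonneg (k : ℕ) : 0 ≤ thalerMass γ k := by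
  have h1 := hp.back_pos (k + 1)
  have h2 := hp.back_succ_lt k hp.one_mem
  rw [thalerMass]
  rcases lt_or_gt_of_ne hp.ne_one with h | h
  · refine div_nonneg (sub_nonneg.2 (rpow_le_rpow (by linarith) (by linarith) (by linarith)))
      (sub_nonneg.2 (one_le_rpow one_le_two (by linarith)))
  · refine div_nonneg_of_nonpos
      (sub_nonpos.2 (rpow_le_rpow_of_nonpos (by linarith) (by linarith) (by linarith)))
      (sub_nonpos.2 (rpow_le_one_of_one_le_of_nonpos one_le_two (by linarith)))

lemma tendsto_thalerMass_mul :
    Tendsto (fun k : ℕ => thalerMass γ k * ((k : ℝ) + 1) ^ (γ⁻¹ + 1)) atTop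
      (𝓝 ((1 - γ) / (2 ^ (1 - γ) - 1) * γ⁻¹ ^ (γ⁻¹ + 1))) := by
  have hγ := hp.gamma_pos
  have hd : HasStrictDerivAt (fun e : ℝ => (1 + e) ^ (1 - γ)) (1 - γ) 0 := by
    have h1 : HasStrictDerivAt (fun e : ℝ => 1 + e) 1 0 := (hasStrictDerivAt_id 0).const_add 1
    have := (hasStrictDerivAt_rpow_const (x := 1 + 0) (p := 1 - γ)
      (Or.inl (by norm_num))).comp (0 : ℝ) h1
    simpa [Function.comp_def] using this
  have hX := hp.tendsto_back
  have hX1 : Tendsto (fun k => thalerBack γ (k + 1) 1) atTop (𝓝 0) :=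
    hX.comp (tendsto_add_atTop_nat 1)
  have hne : ∀ k, thalerBack γ k 1 - thalerBack γ (k + 1) 1 ≠ 0 := fun k =>
    (sub_pos.2 (hp.back_succ_lt k hp.one_mem)).ne'
  have h1 : Tendsto (fun k : ℕ => ((1 + thalerBack γ k 1) ^ (1 - γ) -
      (1 + thalerBack γ (k + 1) 1) ^ (1 - γ)) / (thalerBack γ k 1 - thalerBack γ (k + 1) 1))
      atTop (𝓝 (1 - γ)) := by
    have hlo := hd.hasStrictFDerivAt.isLittleO
    have hpair : Tendsto (fun k => (thalerBack γ k 1, thalerBack γ (k + 1) 1)) atTop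
        (𝓝 ((0 : ℝ), (0 : ℝ))) := hX.prodMk_nhds hX1
    have h := (hlo.comp_tendsto hpair).tendsto_div_nhds_zero
    have h' := h.add_const (1 - γ)
    rw [zero_add] at h'
    refine h'.congr fun k => ?_
    have := hne k
    simp only [Function.comp, ContinuousLinearMap.toSpanSingleton_apply, smul_eq_mul]
    field_simp
    ring
  have h2 : Tendsto (fun k : ℕ => (thalerBack γ k 1 - thalerBack γ (k + 1) 1) /
      thalerBack γ (k + 1) 1 ^ (1 + γ)) atTop (𝓝 1) := by
    refine ((tendsto_thalerG_sub_div hp.gamma_pos hp.ne_one).comp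
      (hp.tendsto_back_nhdsGT.comp (tendsto_add_atTop_nat 1))).congr fun k => ?_
    simp only [Function.comp, hp.thalerG_back_succ hp.one_mem]
  have h3 : Tendsto (fun k : ℕ => thalerBack γ (k + 1) 1 ^ (1 + γ) * ((k : ℝ) + 1) ^ (γ⁻¹ + 1))
      atTop (𝓝 (γ⁻¹ ^ (γ⁻¹ + 1))) := by
    refine (hp.tendsto_back_succ_rpow_mul.rpow_const (p := γ⁻¹ + 1)
      (Or.inr (by positivity))).congr fun k => ?_
    have hb := (hp.back_pos (k + 1)).le
    rw [mul_rpow (rpow_nonneg hb _) (by positivity), ← rpow_mul hb, mul_add, mul_one,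
      mul_inv_cancel₀ hγ.ne']
  have h4 := ((h1.div_const (2 ^ (1 - γ) - 1)).mul h2).mul h3
  rw [mul_one] at h4
  refine h4.congr fun k => ?_
  have := hne k
  have := (rpow_pos_of_pos (hp.back_pos (k + 1)) (1 + γ)).ne'
  have := two_rpow_sub_one_ne_zero hp.one_sub_ne_zero
  rw [thalerMass]
  field_simp

lemma hasSum_thalerMass : HasSum (thalerMass γ) 1 := by
  rw [hasSum_iff_tendsto_nat_of_nonneg hp.thalerMass_nonneg]
  have hne := two_rpow_sub_one_ne_zero hp.one_sub_ne_zero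
  have hsum : ∀ n, ∑ k ∈ Finset.range n, thalerMass γ k =
      (2 ^ (1 - γ) - (1 + thalerBack γ n 1) ^ (1 - γ)) / (2 ^ (1 - γ) - 1) := fun n => by
    simp only [thalerMass]
    rw [← Finset.sum_div, Finset.sum_range_sub', thalerBack_zero]
    norm_num
  simp_rw [hsum]
  have h : Tendsto (fun n => (1 + thalerBack γ n 1) ^ (1 - γ)) atTop (𝓝 ((1 + 0) ^ (1 - γ))) :=
    (hp.tendsto_back.const_add 1).rpow_const (Or.inl (by norm_num))
  rw [add_zero, one_rpow] at h
  have := (h.const_sub (2 ^ (1 - γ))).div_const (2 ^ (1 - γ) - 1)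
  rwa [div_self hne] at this

lemma summable_thalerMass_mul_rpow {β : ℝ} (hβ : β < γ⁻¹) :
    Summable fun k : ℕ => thalerMass γ k * ((k : ℝ) + 1) ^ β := by
  obtain ⟨M, hM⟩ := hp.tendsto_thalerMass_mul.bddAbove_range
  have hs : Summable fun k : ℕ => ((k + 1 : ℕ) : ℝ) ^ (β - (γ⁻¹ + 1)) :=
    (summable_nat_add_iff 1).2 (Real.summable_nat_rpow.2 (by linarith))
  refine (hs.mul_left M).of_nonneg_of_le
    (fun k => mul_nonneg (hp.thalerMass_nonneg k) (by positivity)) fun k => ?_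
  have hk : (0 : ℝ) < (k : ℝ) + 1 := by positivity
  have h1 : thalerMass γ k * ((k : ℝ) + 1) ^ (γ⁻¹ + 1) ≤ M := hM ⟨k, rfl⟩
  have h2 : ((k : ℝ) + 1) ^ β = ((k : ℝ) + 1) ^ (γ⁻¹ + 1) * ((k : ℝ) + 1) ^ (β - (γ⁻¹ + 1)) := by
    rw [← rpow_add hk]; congr 1; ring
  rw [h2, ← mul_assoc, Nat.cast_succ]
  gcongr

lemma hasSum_mul_thalerMass (hγ : γ < 1) :
    HasSum (fun k : ℕ => ((k : ℝ) + 1) * thalerMass γ k) (1 - 2 ^ (γ - 1))⁻¹ := by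
  have ha : 0 < 1 - γ := sub_pos.2 hγ
  have hne := two_rpow_sub_one_ne_zero hp.one_sub_ne_zero
  rw [hasSum_iff_tendsto_nat_of_nonneg fun k =>
    mul_nonneg (by positivity) (hp.thalerMass_nonneg k)]
  set X := fun k => thalerBack γ k 1 with hX
  have hsum : ∀ n : ℕ, ∑ k ∈ Finset.range (n + 1), ((k : ℝ) + 1) * thalerMass γ k =
      (2 ^ (1 - γ) - X n ^ (1 - γ) - ((n : ℝ) + 1) * ((1 + X (n + 1)) ^ (1 - γ) - 1)) /
        (2 ^ (1 - γ) - 1) := fun n => by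
    induction n with
    | zero =>
      simp only [hX, zero_add, Finset.sum_range_one, Nat.cast_zero, one_mul, thalerMass,
        thalerBack_zero, one_rpow]
      norm_num
    | succ n ih =>
      have hr := thalerG_rpow hp.ne_one (hp.back_mem hp.one_mem (n + 1))
      rw [hp.thalerG_back_succ hp.one_mem] at hr
      rw [Finset.sum_range_succ, ih, thalerMass]
      simp only [hX, hr]
      push_cast
      field_simp
      ring
  refine (tendsto_add_atTop_iff_nat 1).1 ?_
  simp_rw [hsum]
  have h1 : Tendsto (fun n => X n ^ (1 - γ)) atTop (𝓝 0) := by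
    have := hp.tendsto_back.rpow_const (p := 1 - γ) (Or.inr ha.le)
    rwa [zero_rpow ha.ne'] at this
  have h2 : Tendsto (fun n : ℕ => (n : ℝ) * ((1 + X n) ^ (1 - γ) - 1)) atTop (𝓝 0) := by
    have hγ1 : 1 < γ⁻¹ := (one_lt_inv₀ hp.gamma_pos).2 hγ
    have h3 : Tendsto (fun n : ℕ => X n * (n : ℝ) ^ γ⁻¹ * (n : ℝ) ^ (-(γ⁻¹ - 1))) atTop
        (𝓝 (γ⁻¹ ^ γ⁻¹ * 0)) := hp.tendsto_back_mul_rpow.mul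
      ((tendsto_rpow_neg_atTop (sub_pos.2 hγ1)).comp tendsto_natCast_atTop_atTop)
    rw [mul_zero] at h3
    refine squeeze_zero' (Eventually.of_forall fun n => ?_)
      ((eventually_gt_atTop 0).mono fun n hn => ?_) h3
    · have : 0 < X n := hp.back_pos n
      exact mul_nonneg (by positivity) (sub_nonneg.2 (one_le_rpow (by linarith) ha.le))
    · have hn0 : (0 : ℝ) < n := by exact_mod_cast hn
      have hXn : 0 < X n := hp.back_pos n
      have hb := rpow_one_add_le_one_add_mul_self (s := X n) (by linarith) ha.le
        (by linarith [hp.gamma_pos])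
      have : X n * (n : ℝ) ^ γ⁻¹ * (n : ℝ) ^ (-(γ⁻¹ - 1)) = n * X n := by
        rw [mul_assoc, ← rpow_add hn0]
        have : γ⁻¹ + -(γ⁻¹ - 1) = 1 := by ring
        rw [this, rpow_one, mul_comm]
      rw [this]
      have : (1 - γ) * X n ≤ X n := by nlinarith [hp.gamma_pos]
      exact mul_le_mul_of_nonneg_left (by linarith) hn0.le
  have h3 := h2.comp (tendsto_add_atTop_nat 1)
  have h4 := ((h1.const_sub (2 ^ (1 - γ))).sub h3).div_const (2 ^ (1 - γ) - 1)
  have hlim : ((2 : ℝ) ^ (1 - γ) - 0 - 0) / (2 ^ (1 - γ) - 1) = (1 - 2 ^ (γ - 1))⁻¹ := by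
    have : (2 : ℝ) ^ (γ - 1) = (2 ^ (1 - γ))⁻¹ := by
      rw [← rpow_neg two_pos.le]; congr 1; ring
    rw [this]
    have hpos : (0 : ℝ) < 2 ^ (1 - γ) := by positivity
    field_simp
    ring
  rw [hlim] at h4
  refine h4.congr fun n => ?_
  simp [Function.comp]

end ThalerParam

/-! ### Weights of the transfer operator and bounded distortion -/

/-- `x ^ γ * h(x) - 1`, with `h` the invariant density. -/
def thalerRatio (γ x : ℝ) : ℝ := (x / (1 + x)) ^ γ

/-- The weights of the transfer operator of the return map with respect to `μ_Y`. -/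
def thalerWeight (γ : ℝ) (k : ℕ) (z : ℝ) : ℝ :=
  thalerRatio γ (thalerBack γ k z) /
    ∏ j ∈ Finset.range (k + 1), (1 + thalerRatio γ (thalerBack γ j z))

section Ratio

variable {γ : ℝ}

lemma thalerRatio_pos {x : ℝ} (hx : 0 < x) : 0 < thalerRatio γ x :=
  rpow_pos_of_pos (div_pos hx (by linarith)) _

lemma thalerRatio_le (hγ0 : 0 < γ) {x y : ℝ} (hx : 0 < x) (hxy : x ≤ y) :
    thalerRatio γ x ≤ thalerRatio γ y := by
  refine rpow_le_rpow (by positivity) ?_ hγ0.le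
  rw [div_le_div_iff₀ (by linarith) (by linarith)]
  nlinarith

lemma thalerRatio_eq {x : ℝ} (hx : 0 < x) : thalerRatio γ x = x ^ γ * (1 + x) ^ (-γ) := by
  rw [thalerRatio, div_rpow hx.le (by linarith), rpow_neg (by linarith), div_eq_mul_inv]

lemma rpow_mul_thalerH {x : ℝ} (hx : 0 < x) : x ^ γ * thalerH γ x = 1 + thalerRatio γ x := by
  rw [thalerH, thalerRatio_eq hx, mul_add, ← rpow_add hx, add_neg_cancel, rpow_zero, add_comm x]

lemma thalerRatio_sub_le (hγ0 : 0 < γ) {x y : ℝ} (hx : 0 < x) (hxy : x ≤ y) :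
    thalerRatio γ y - thalerRatio γ x ≤ y ^ γ - x ^ γ := by
  have hy := hx.trans_le hxy
  rw [thalerRatio_eq hx, thalerRatio_eq hy]
  have h1 : (1 + y) ^ (-γ) ≤ (1 + x) ^ (-γ) :=
    rpow_le_rpow_of_nonpos (by linarith) (by linarith) (by linarith)
  have h2 : (1 + y) ^ (-γ) ≤ 1 := rpow_le_one_of_one_le_of_nonpos (by linarith) (by linarith)
  have h3 : x ^ γ ≤ y ^ γ := rpow_le_rpow hx.le hxy hγ0.le
  have h4 : 0 < x ^ γ := rpow_pos_of_pos hx _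
  nlinarith

lemma thalerRatio_le_mul (hγ0 : 0 < γ) {x y : ℝ} (hx : 0 < x) (hxy : x ≤ y) :
    thalerRatio γ y ≤ thalerRatio γ x * (y / x) ^ γ := by
  have hy := hx.trans_le hxy
  rw [thalerRatio, thalerRatio, ← mul_rpow (by positivity) (by positivity)]
  refine rpow_le_rpow (by positivity) ?_ hγ0.le
  have : x / (1 + x) * (y / x) = y / (1 + x) := by field_simp
  rw [this]
  gcongr

/-- Cauchy's mean value theorem for `g ^ γ` against `x ^ γ`. -/
lemma exists_thalerG_rpow_sub_eq (hγ0 : 0 < γ) (hγ1 : γ ≠ 1) {c d : ℝ} (hc : 0 < c) (hcd : c < d)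
    (hd : d ≤ 1) : ∃ x ∈ Ioo c d, thalerG γ d ^ γ - thalerG γ c ^ γ =
      (d ^ γ - c ^ γ) * ((thalerG γ x / x) ^ (2 * γ - 1) * (1 + thalerRatio γ x)) := by
  have hmem : ∀ x ∈ Icc c d, x ∈ Ioc (0 : ℝ) 1 := fun x hx =>
    ⟨hc.trans_le hx.1, hx.2.trans hd⟩
  have hf : ∀ x ∈ Icc c d, HasDerivAt (fun x : ℝ => x ^ γ) (γ * x ^ (γ - 1)) x := fun x hx =>
    hasDerivAt_rpow_const (Or.inl (hmem x hx).1.ne')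
  have hg : ∀ x ∈ Icc c d, HasDerivAt (fun x : ℝ => thalerG γ x ^ γ)
      (thalerG γ x ^ γ * thalerH γ x * γ * thalerG γ x ^ (γ - 1)) x := fun x hx =>
    (hasDerivAt_thalerG hγ1 (hmem x hx)).rpow_const (Or.inl (thalerG_pos hγ1 (hmem x hx)).ne')
  obtain ⟨x, hx, h⟩ := exists_ratio_hasDerivAt_eq_ratio_slope _ _ hcd
    (fun x hx => (hf x hx).continuousAt.continuousWithinAt)
    (fun x hx => hf x (Ioo_subset_Icc_self hx)) _ _
    (fun x hx => (hg x hx).continuousAt.continuousWithinAt)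
    (fun x hx => hg x (Ioo_subset_Icc_self hx))
  refine ⟨x, hx, ?_⟩
  have hxm := hmem x (Ioo_subset_Icc_self hx)
  have hx0 := hxm.1
  have hG := thalerG_pos hγ1 hxm
  have hx1 : 0 < x ^ (γ - 1) := rpow_pos_of_pos hx0 _
  rw [← rpow_mul_thalerH hx0, div_rpow hG.le hx0.le]
  have e1 : thalerG γ x ^ (2 * γ - 1) = thalerG γ x ^ γ * thalerG γ x ^ (γ - 1) := by
    rw [← rpow_add hG]; congr 1; ring
  have e2 : x ^ (2 * γ - 1) = x ^ γ * x ^ (γ - 1) := by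
    rw [← rpow_add hx0]; congr 1; ring
  rw [e1, e2]
  have hxγ : 0 < x ^ γ := rpow_pos_of_pos hx0 _
  field_simp
  have := mul_right_cancel₀ hγ0.ne' (a := (thalerG γ d ^ γ - thalerG γ c ^ γ) * x ^ (γ - 1))
    (c := (d ^ γ - c ^ γ) * thalerG γ x ^ γ * thalerG γ x ^ (γ - 1) * thalerH γ x)
    (by linear_combination h)
  linear_combination this

lemma thalerG_rpow_sub_mul_le (hγ : 1 / 2 < γ) (hγ1 : γ ≠ 1) {c d c' d' : ℝ} (hc : 0 < c)
    (hcd : c < d) (hdc : d ≤ c') (hcd' : c' < d') (hd' : d' ≤ 1) :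
    (thalerG γ d ^ γ - thalerG γ c ^ γ) * (d' ^ γ - c' ^ γ) ≤
      (thalerG γ d' ^ γ - thalerG γ c' ^ γ) * (d ^ γ - c ^ γ) := by
  have hγ0 : 0 < γ := by linarith
  obtain ⟨x, hx, h1⟩ := exists_thalerG_rpow_sub_eq hγ0 hγ1 hc hcd (by linarith)
  obtain ⟨y, hy, h2⟩ := exists_thalerG_rpow_sub_eq hγ0 hγ1 (by linarith) hcd' hd'
  have hx0 : x ∈ Ioc (0 : ℝ) 1 := ⟨by linarith [hx.1], by linarith [hx.2]⟩
  have hy0 : y ∈ Ioc (0 : ℝ) 1 := ⟨by linarith [hy.1], by linarith [hy.2]⟩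
  have hxy : x ≤ y := by linarith [hx.2, hy.1]
  have hS : (thalerG γ x / x) ^ (2 * γ - 1) * (1 + thalerRatio γ x) ≤
      (thalerG γ y / y) ^ (2 * γ - 1) * (1 + thalerRatio γ y) := by
    have h3 := thalerRatio_pos (γ := γ) hx0.1
    have h5 := div_pos (thalerG_pos hγ1 hx0) hx0.1
    have h6 := div_pos (thalerG_pos hγ1 hy0) hy0.1
    refine mul_le_mul (rpow_le_rpow h5.le (monotoneOn_thalerG_div hγ0 hγ1 hx0 hy0 hxy)
      (by linarith)) (by linarith [thalerRatio_le hγ0 hx0.1 hxy]) (by linarith)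
      (rpow_nonneg h6.le _)
  rw [h1, h2]
  have hd1 : 0 ≤ d ^ γ - c ^ γ := sub_nonneg.2 (rpow_le_rpow hc.le hcd.le hγ0.le)
  have hd2 : 0 ≤ d' ^ γ - c' ^ γ :=
    sub_nonneg.2 (rpow_le_rpow (by linarith) hcd'.le hγ0.le)
  have := mul_le_mul_of_nonneg_left hS (mul_nonneg hd1 hd2)
  linarith

end Ratio

lemma one_add_sum_le_prod_one_add {r : ℕ → ℝ} (hr : ∀ j, 0 ≤ r j) (n : ℕ) :
    1 + ∑ j ∈ Finset.range n, r j ≤ ∏ j ∈ Finset.range n, (1 + r j) := by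
  induction n with
  | zero => simp
  | succ n ih =>
    rw [Finset.sum_range_succ, Finset.prod_range_succ]
    have h1 : 0 ≤ ∑ j ∈ Finset.range n, r j := Finset.sum_nonneg fun j _ => hr j
    nlinarith [hr n]

namespace ThalerParam

variable {γ xs : ℝ} (hp : ThalerParam γ xs)

include hp

lemma ratio_back_pos {z : ℝ} (hz : z ∈ Ioc (0 : ℝ) 1) (k : ℕ) :
    0 < thalerRatio γ (thalerBack γ k z) := thalerRatio_pos (hp.back_mem hz k).1

lemma prod_ratio_pos {z : ℝ} (hz : z ∈ Ioc (0 : ℝ) 1) (n : ℕ) :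
    0 < ∏ j ∈ Finset.range n, (1 + thalerRatio γ (thalerBack γ j z)) :=
  Finset.prod_pos fun j _ => by linarith [hp.ratio_back_pos hz j]

lemma weight_pos {z : ℝ} (hz : z ∈ Ioc (0 : ℝ) 1) (k : ℕ) : 0 < thalerWeight γ k z :=
  div_pos (hp.ratio_back_pos hz k) (hp.prod_ratio_pos hz _)

lemma sum_weight {z : ℝ} (hz : z ∈ Ioc (0 : ℝ) 1) (n : ℕ) :
    ∑ k ∈ Finset.range n, thalerWeight γ k z =
      1 - (∏ j ∈ Finset.range n, (1 + thalerRatio γ (thalerBack γ j z)))⁻¹ := by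
  induction n with
  | zero => simp
  | succ n ih =>
    have h1 := hp.prod_ratio_pos hz n
    have h2 := hp.ratio_back_pos hz n
    rw [Finset.sum_range_succ, ih, thalerWeight, Finset.prod_range_succ]
    field_simp
    ring

lemma not_summable_back_rpow : ¬ Summable fun k : ℕ => thalerBack γ (k + 1) 1 ^ γ := by
  intro hs
  have h1 : (fun k : ℕ => 1 / ((k + 1 : ℕ) : ℝ)) =O[atTop]
      fun k : ℕ => thalerBack γ (k + 1) 1 ^ γ := by
    have hinv := hp.tendsto_back_succ_rpow_mul.inv₀ (inv_ne_zero hp.gamma_pos.ne')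
    have := (Asymptotics.isBigO_refl (fun k : ℕ => thalerBack γ (k + 1) 1 ^ γ) atTop).mul
      (hinv.isBigO_one ℝ)
    refine (this.congr (fun k => ?_) fun k => ?_)
    · have := (rpow_pos_of_pos (hp.back_pos (k + 1)) γ).ne'
      have : ((k : ℝ) + 1) ≠ 0 := by positivity
      push_cast
      field_simp
    · simp
  exact not_summable_one_div_natCast ((summable_nat_add_iff 1).1 (summable_of_isBigO_nat hs h1))

lemma tendsto_prod_ratio {z : ℝ} (hz : z ∈ Ioc xs 1) :
    Tendsto (fun n => ∏ j ∈ Finset.range n, (1 + thalerRatio γ (thalerBack γ j z)))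
      atTop atTop := by
  have hz0 := hp.mem_of_mem hz
  have hns : ¬ Summable fun j => thalerRatio γ (thalerBack γ j z) := by
    intro hs
    refine hp.not_summable_back_rpow (.of_nonneg_of_le
      (fun k => rpow_nonneg (hp.back_pos _).le _) (fun k => ?_) (hs.mul_left (2 ^ γ)))
    have h1 := hp.back_pos (k + 1)
    have h2 := (hp.back_mem_Ioc hz k).1
    have h3 := (hp.back_mem hz0 k).2
    rw [thalerRatio, ← mul_rpow (by norm_num) (div_nonneg (by linarith) (by linarith))]
    refine rpow_le_rpow h1.le ?_ hp.gamma_pos.le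
    rw [← mul_div_assoc, le_div_iff₀ (by linarith)]
    nlinarith
  have h := (not_summable_iff_tendsto_nat_atTop_of_nonneg
    fun j => (hp.ratio_back_pos hz0 j).le).1 hns
  exact tendsto_atTop_mono
    (fun n => one_add_sum_le_prod_one_add (fun j => (hp.ratio_back_pos hz0 j).le) n)
    (tendsto_atTop_add_const_left _ 1 h)

lemma hasSum_weight {z : ℝ} (hz : z ∈ Ioc xs 1) : HasSum (fun k => thalerWeight γ k z) 1 := by
  have hz0 := hp.mem_of_mem hz
  rw [hasSum_iff_tendsto_nat_of_nonneg fun k => (hp.weight_pos hz0 k).le]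
  simp_rw [hp.sum_weight hz0]
  have := (hp.tendsto_prod_ratio hz).inv_tendsto_atTop.const_sub 1
  rwa [sub_zero] at this

lemma weight_zero_ge {z : ℝ} (hz : z ∈ Ioc xs 1) :
    thalerRatio γ xs / (1 + thalerRatio γ xs) ≤ thalerWeight γ 0 z := by
  have h1 := thalerRatio_pos (γ := γ) hp.pos
  have h2 := thalerRatio_le hp.gamma_pos hp.pos hz.1.le
  simp only [thalerWeight, zero_add, Finset.prod_range_one, thalerBack_zero]
  rw [div_le_div_iff₀ (by linarith) (by linarith)]
  nlinarith

lemma rpow_sub_le {z w : ℝ} (hz : z ∈ Ioc xs 1) (hw : w ∈ Ioc xs 1) (hzw : z ≤ w) :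
    w ^ γ - z ^ γ ≤ γ / xs * (w - z) := by
  have hz0 := (hp.mem_of_mem hz).1
  have hw0 := (hp.mem_of_mem hw).1
  have hγ := hp.gamma_pos
  have hxs := hp.pos
  have h1 : w ^ γ ≤ 1 := rpow_le_one hw0.le hw.2 hγ.le
  have h2 : w ^ γ ≤ z ^ γ * exp (γ / xs * (w - z)) := by
    have : w ≤ z * exp ((w - z) / xs) := by
      have h3 := add_one_le_exp ((w - z) / xs)
      have h4 : (w - z) / z ≤ (w - z) / xs :=
        div_le_div_of_nonneg_left (by linarith) hxs hz.1.le
      have h5 : w = z * ((w - z) / z + 1) := by field_simp; ring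
      calc w = z * ((w - z) / z + 1) := h5
        _ ≤ _ := by gcongr; linarith
    calc w ^ γ ≤ (z * exp ((w - z) / xs)) ^ γ := rpow_le_rpow hw0.le this hγ.le
      _ = _ := by
        rw [mul_rpow hz0.le (exp_pos _).le, ← exp_mul]
        congr 2; ring
  have h3 := add_one_le_exp (-(γ / xs * (w - z)))
  have h4 : w ^ γ * exp (-(γ / xs * (w - z))) ≤ z ^ γ := by
    rw [exp_neg, ← div_eq_mul_inv, div_le_iff₀ (exp_pos _)]
    exact h2
  have h5 : 0 ≤ γ / xs * (w - z) := mul_nonneg (by positivity) (by linarith)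
  have h6 : 0 < w ^ γ := rpow_pos_of_pos hw0 _
  nlinarith

lemma back_rpow_sub_le {z w : ℝ} (hz : z ∈ Ioc xs 1) (hw : w ∈ Ioc xs 1) (hzw : z < w) (j : ℕ) :
    (thalerBack γ j w ^ γ - thalerBack γ j z ^ γ) *
        (thalerBack γ 1 1 ^ γ - thalerBack γ 2 1 ^ γ) ≤
      (w ^ γ - z ^ γ) * (thalerBack γ (j + 1) 1 ^ γ - thalerBack γ (j + 2) 1 ^ γ) := by
  have hz0 := hp.mem_of_mem hz
  have hw0 := hp.mem_of_mem hw
  have hγ := hp.gamma_pos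
  have hpos : ∀ {x y : ℝ}, x ∈ Ioc (0 : ℝ) 1 → x < y → 0 < y ^ γ - x ^ γ := fun hx hxy =>
    sub_pos.2 (rpow_lt_rpow hx.1.le hxy hγ)
  have hX := fun k => hpos (hp.back_mem hp.one_mem (k + 1)) (hp.back_succ_lt k hp.one_mem)
  have hV := fun k => hpos (hp.back_mem hz0 k) ((hp.back_lt_iff hz0 hw0 k).2 hzw)
  induction j with
  | zero => simp [thalerBack_zero]
  | succ j ih =>
    have h := thalerG_rpow_sub_mul_le hp.half_lt hp.ne_one (hp.back_pos (j + 1 + 2))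
      (hp.back_succ_lt (j + 2) hp.one_mem) (hp.back_mem_Ioc hz (j + 1)).1.le
      ((hp.back_lt_iff hz0 hw0 (j + 1)).2 hzw) (hp.back_mem hw0 (j + 1)).2
    rw [hp.thalerG_back_succ hp.one_mem, hp.thalerG_back_succ hz0, hp.thalerG_back_succ hw0,
      show j + 1 + 2 = (j + 2) + 1 from rfl, hp.thalerG_back_succ hp.one_mem] at h
    have hA := hX (j + 1)
    have h1 : 0 < thalerBack γ 1 1 ^ γ - thalerBack γ 2 1 ^ γ := hX 1
    have hB := hX (j + 2)
    have hd := hpos hz0 hzw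
    refine le_of_mul_le_mul_right ?_ hA
    rw [show j + 1 + 2 = (j + 2) + 1 from rfl]
    have m1 := mul_le_mul_of_nonneg_right h h1.le
    have m2 := mul_le_mul_of_nonneg_right ih hB.le
    simp only [show j + 2 = j + 1 + 1 from rfl] at *
    linarith

lemma sum_back_rpow_sub_le : ∃ E : ℝ, 0 ≤ E ∧ ∀ z ∈ Ioc xs 1, ∀ w ∈ Ioc xs 1, z ≤ w → ∀ n,
    ∑ j ∈ Finset.range n, (thalerBack γ j w ^ γ - thalerBack γ j z ^ γ) ≤ E * (w - z) := by
  have hγ := hp.gamma_pos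
  have hc : 0 < thalerBack γ 1 1 ^ γ - thalerBack γ 2 1 ^ γ :=
    sub_pos.2 (rpow_lt_rpow (hp.back_pos _).le (hp.back_succ_lt 1 hp.one_mem) hγ)
  set C := thalerBack γ 1 1 ^ γ - thalerBack γ 2 1 ^ γ
  have hxs := hp.pos
  refine ⟨γ / xs / C, by positivity, fun z hz w hw hzw n => ?_⟩
  rcases hzw.eq_or_lt with rfl | hlt
  · simp
  have h1 : (∑ j ∈ Finset.range n, (thalerBack γ j w ^ γ - thalerBack γ j z ^ γ)) * C ≤
      (w ^ γ - z ^ γ) * 1 := by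
    rw [Finset.sum_mul]
    refine (Finset.sum_le_sum fun j _ => hp.back_rpow_sub_le hz hw hlt j).trans ?_
    rw [← Finset.mul_sum]
    refine mul_le_mul_of_nonneg_left ?_
      (sub_nonneg.2 (rpow_le_rpow (hp.mem_of_mem hz).1.le hzw hγ.le))
    rw [Finset.sum_range_sub' fun j => thalerBack γ (j + 1) 1 ^ γ]
    have h2 : thalerBack γ (0 + 1) 1 ^ γ ≤ 1 :=
      rpow_le_one (hp.back_pos _).le (hp.back_mem hp.one_mem _).2 hγ.le
    have h3 := rpow_nonneg (hp.back_pos (n + 1)).le γ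
    linarith
  rw [mul_one, ← le_div_iff₀ hc] at h1
  refine h1.trans ?_
  rw [div_mul_eq_mul_div]
  exact div_le_div_of_nonneg_right (hp.rpow_sub_le hz hw hzw) hc.le

/-- Bounded distortion of the return map. -/
lemma weight_distortion : ∃ D : ℝ, 0 ≤ D ∧ ∀ k, ∀ z ∈ Ioc xs 1, ∀ w ∈ Ioc xs 1,
    thalerWeight γ k z ≤ thalerWeight γ k w * exp (D * |z - w|) := by
  obtain ⟨E, hE, hsum⟩ := hp.sum_back_rpow_sub_le
  have hγ := hp.gamma_pos
  have hxs := hp.pos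
  have hD : 0 ≤ γ / xs := by positivity
  refine ⟨γ / xs + E, by positivity, fun k z hz w hw => ?_⟩
  have hz0 := hp.mem_of_mem hz
  have hw0 := hp.mem_of_mem hw
  have hle : ∀ {u v : ℝ}, u ∈ Ioc xs 1 → v ∈ Ioc xs 1 → u ≤ v → ∀ j,
      thalerRatio γ (thalerBack γ j u) ≤ thalerRatio γ (thalerBack γ j v) :=
    fun hu hv huv j => thalerRatio_le hγ (hp.back_mem (hp.mem_of_mem hu) j).1
      ((hp.back_le_iff (hp.mem_of_mem hu) (hp.mem_of_mem hv) j).2 huv)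
  rcases le_total z w with hzw | hzw
  · have hprod : ∏ j ∈ Finset.range (k + 1), (1 + thalerRatio γ (thalerBack γ j w)) ≤
        (∏ j ∈ Finset.range (k + 1), (1 + thalerRatio γ (thalerBack γ j z))) *
          exp (E * (w - z)) := by
      refine le_trans ?_ (mul_le_mul_of_nonneg_left (exp_le_exp.2 (hsum z hz w hw hzw (k + 1)))
        (hp.prod_ratio_pos hz0 _).le)
      rw [exp_sum, ← Finset.prod_mul_distrib]
      refine Finset.prod_le_prod (fun j _ => by linarith [hp.ratio_back_pos hw0 j]) fun j _ => ?_
      have h1 := hp.ratio_back_pos hz0 j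
      have h2 := thalerRatio_sub_le hγ (hp.back_mem hz0 j).1
        ((hp.back_le_iff hz0 hw0 j).2 hzw)
      have h3 := add_one_le_exp (thalerBack γ j w ^ γ - thalerBack γ j z ^ γ)
      have h4 := hle hz hw hzw j
      nlinarith
    have hexp : exp (E * (w - z)) ≤ exp ((γ / xs + E) * |z - w|) := by
      rw [abs_sub_comm, abs_of_nonneg (by linarith)]
      exact exp_le_exp.2 (mul_le_mul_of_nonneg_right (by linarith) (by linarith))
    refine le_trans ?_ (mul_le_mul_of_nonneg_left hexp (hp.weight_pos hw0 k).le)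
    rw [thalerWeight, thalerWeight, div_mul_eq_mul_div,
      div_le_div_iff₀ (hp.prod_ratio_pos hz0 _) (hp.prod_ratio_pos hw0 _)]
    have h5 := hle hz hw hzw k
    have h6 := hp.ratio_back_pos hz0 k
    have h7 := hp.prod_ratio_pos hw0 (k + 1)
    calc _ ≤ thalerRatio γ (thalerBack γ k w) *
          ((∏ j ∈ Finset.range (k + 1), (1 + thalerRatio γ (thalerBack γ j z))) *
          exp (E * (w - z))) := mul_le_mul h5 hprod h7.le (h6.le.trans h5)
      _ = _ := by ring
  · have h1 : thalerRatio γ (thalerBack γ k z) ≤ thalerRatio γ (thalerBack γ k w) *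
        exp ((γ / xs + E) * |z - w|) := by
      refine (thalerRatio_le_mul hγ (hp.back_mem hw0 k).1
        ((hp.back_le_iff hw0 hz0 k).2 hzw)).trans ?_
      refine mul_le_mul_of_nonneg_left ?_ (hp.ratio_back_pos hw0 k).le
      have h2 := hp.back_div_back_le hw0 hz0 hzw k
      have h3 : z / w ≤ exp ((z - w) / xs) := by
        have h3 := add_one_le_exp ((z - w) / xs)
        have h4 : (z - w) / w ≤ (z - w) / xs :=
          div_le_div_of_nonneg_left (by linarith) hxs hw.1.le
        have h5 : z / w = (z - w) / w + 1 := by have := hw0.1.ne'; field_simp; ring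
        linarith
      have h4 : 0 ≤ thalerBack γ k z / thalerBack γ k w :=
        div_nonneg (hp.back_mem hz0 k).1.le (hp.back_mem hw0 k).1.le
      refine (rpow_le_rpow h4 (h2.trans h3) hγ.le).trans ?_
      rw [← exp_mul, abs_of_nonneg (by linarith)]
      refine exp_le_exp.2 ?_
      have : (z - w) / xs * γ = γ / xs * (z - w) := by ring
      rw [this]
      exact mul_le_mul_of_nonneg_right (by linarith) (by linarith)
    have h2 : ∏ j ∈ Finset.range (k + 1), (1 + thalerRatio γ (thalerBack γ j w)) ≤
        ∏ j ∈ Finset.range (k + 1), (1 + thalerRatio γ (thalerBack γ j z)) :=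
      Finset.prod_le_prod (fun j _ => by linarith [hp.ratio_back_pos hw0 j]) fun j _ => by
        linarith [hle hw hz hzw j]
    have h3 := hp.prod_ratio_pos hw0 (k + 1)
    have h4 := hp.prod_ratio_pos hz0 (k + 1)
    have h5 := hp.ratio_back_pos hz0 k
    rw [thalerWeight, thalerWeight, div_mul_eq_mul_div, div_le_div_iff₀ h4 h3]
    exact mul_le_mul h1 h2 h3.le (h5.le.trans h1)

end ThalerParam

/-! ### Change of variables along the branches -/

/-- The branches of the return map, as functions on the whole line. -/
def thalerForward (γ : ℝ) (k : ℕ) (y : ℝ) : ℝ := (thalerG γ)^[k] (thalerG γ y - 1)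

lemma measurable_thalerH (γ : ℝ) : Measurable (thalerH γ) := by
  unfold thalerH; fun_prop

lemma ae_thalerMuY_mem (γ xs : ℝ) : ∀ᵐ z ∂(thalerMuY γ xs), z ∈ Ioc xs 1 := by
  rw [thalerMuY]
  exact Measure.ae_smul_measure (ae_restrict_mem measurableSet_Ioc) _

lemma integral_thalerMuY (γ xs : ℝ) (G : ℝ → ℂ) :
    ∫ y, G y ∂(thalerMuY γ xs) = ∫ y in Ioc xs 1, G y ∂(thalerMuY γ xs) := by
  rw [Measure.restrict_eq_self_of_ae_mem (ae_thalerMuY_mem γ xs)]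

namespace ThalerParam

variable {γ xs : ℝ} (hp : ThalerParam γ xs)

include hp

lemma iterate_thalerG_back {z : ℝ} (hz : z ∈ Ioc (0 : ℝ) 1) (k : ℕ) :
    (thalerG γ)^[k] (thalerBack γ k z) = z := by
  induction k with
  | zero => rfl
  | succ k ih => rw [Function.iterate_succ_apply, hp.thalerG_back_succ hz, ih]

lemma thalerForward_branch {z : ℝ} (hz : z ∈ Ioc (0 : ℝ) 1) (k : ℕ) :
    thalerForward γ k (thalerBranch γ k z) = z := by
  rw [thalerForward, hp.thalerG_branch hz, add_sub_cancel_left, hp.iterate_thalerG_back hz]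

lemma hasDerivAt_iterate_thalerG {z : ℝ} (hz : z ∈ Ioc (0 : ℝ) 1) (k : ℕ) :
    HasDerivAt (thalerG γ)^[k]
      ((∏ j ∈ Finset.range (k + 1), (1 + thalerRatio γ (thalerBack γ j z))) /
        (thalerBack γ k z ^ γ * thalerH γ z)) (thalerBack γ k z) := by
  induction k with
  | zero =>
    have h1 : 0 < z ^ γ * thalerH γ z := by
      rw [rpow_mul_thalerH hz.1]; linarith [thalerRatio_pos (γ := γ) hz.1]
    simp only [Function.iterate_zero, zero_add, Finset.prod_range_one, thalerBack_zero]
    rw [← rpow_mul_thalerH hz.1, div_self h1.ne']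
    exact hasDerivAt_id z
  | succ k ih =>
    rw [Function.iterate_succ]
    have hm := hp.back_mem hz (k + 1)
    have hg := hasDerivAt_thalerG hp.ne_one hm
    rw [hp.thalerG_back_succ hz] at hg
    rw [← hp.thalerG_back_succ hz k] at ih
    have h := ih.comp (thalerBack γ (k + 1) z) hg
    rw [hp.thalerG_back_succ hz] at h
    refine h.congr_deriv ?_
    have h1 := rpow_pos_of_pos (hp.back_mem hz k).1 γ
    have h2 := rpow_pos_of_pos hm.1 γ
    have h3 := thalerH_pos (γ := γ) hz.1
    rw [Finset.prod_range_succ _ (k + 1), ← rpow_mul_thalerH hm.1]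
    field_simp

lemma hasDerivAt_thalerForward {z : ℝ} (hz : z ∈ Ioc (0 : ℝ) 1) (k : ℕ) :
    HasDerivAt (thalerForward γ k)
      (thalerH γ (thalerBranch γ k z) / (thalerH γ z * thalerWeight γ k z))
      (thalerBranch γ k z) := by
  have hm := hp.mem_of_mem (hp.branch_mem_Ioc hz k)
  have hg := (hasDerivAt_thalerG hp.ne_one hm).sub_const 1
  have hi := hp.hasDerivAt_iterate_thalerG hz k
  have he : thalerBack γ k z = thalerG γ (thalerBranch γ k z) - 1 := by
    rw [hp.thalerG_branch hz]; ring
  rw [he] at hi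
  have h := hi.comp (thalerBranch γ k z) hg
  rw [← he, hp.thalerG_branch hz] at h
  refine h.congr_deriv ?_
  have hb := (hp.back_mem hz k).1
  have h1 := rpow_pos_of_pos hb γ
  have h2 := thalerH_pos (γ := γ) hz.1
  have h3 := hp.prod_ratio_pos hz (k + 1)
  have h4 : 0 < (1 + thalerBack γ k z) ^ γ := rpow_pos_of_pos (by linarith) _
  rw [thalerWeight, thalerRatio_eq hb, rpow_neg (by linarith)]
  field_simp

lemma measurableSet_branch_image (k : ℕ) : MeasurableSet (thalerBranch γ k '' Ioc xs 1) := by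
  rw [hp.branch_image]; exact measurableSet_Ioc

/-- Change of variables for the return map on the set of points with return time `k + 1`. -/
lemma setIntegral_branch_image (k : ℕ) (G : ℝ → ℂ) :
    ∫ y in thalerBranch γ k '' Ioc xs 1, (thalerH γ y : ℂ) * G y =
      ∫ z in Ioc xs 1, (thalerH γ z : ℂ) * ((thalerWeight γ k z : ℂ) * G (thalerBranch γ k z)) := by
  have himg : thalerForward γ k '' (thalerBranch γ k '' Ioc xs 1) = Ioc xs 1 := by
    rw [image_image]
    refine (image_congr fun z hz => hp.thalerForward_branch (hp.mem_of_mem hz) k).trans ?_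
    exact image_id' _
  have hinj : InjOn (thalerForward γ k) (thalerBranch γ k '' Ioc xs 1) := by
    rintro _ ⟨z, hz, rfl⟩ _ ⟨w, hw, rfl⟩ h
    rw [hp.thalerForward_branch (hp.mem_of_mem hz), hp.thalerForward_branch (hp.mem_of_mem hw)] at h
    rw [h]
  have hder : ∀ y ∈ thalerBranch γ k '' Ioc xs 1, HasDerivWithinAt (thalerForward γ k)
      (thalerH γ y / (thalerH γ (thalerForward γ k y) * thalerWeight γ k (thalerForward γ k y)))
      (thalerBranch γ k '' Ioc xs 1) y := by
    rintro _ ⟨z, hz, rfl⟩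
    rw [hp.thalerForward_branch (hp.mem_of_mem hz)]
    exact (hp.hasDerivAt_thalerForward (hp.mem_of_mem hz) k).hasDerivWithinAt
  have h := integral_image_eq_integral_abs_deriv_smul (hp.measurableSet_branch_image k) hder hinj
    fun z => (thalerH γ z : ℂ) * ((thalerWeight γ k z : ℂ) * G (thalerBranch γ k z))
  rw [himg] at h
  rw [h]
  refine setIntegral_congr_fun (hp.measurableSet_branch_image k) ?_
  rintro _ ⟨z, hz, rfl⟩
  have hz0 := hp.mem_of_mem hz
  have h1 := thalerH_pos (γ := γ) hz0.1
  have h2 := hp.weight_pos hz0 k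
  have h3 := thalerH_pos (γ := γ) (hp.mem_of_mem (hp.branch_mem_Ioc hz0 k)).1
  simp only [hp.thalerForward_branch hz0]
  rw [abs_of_pos (by positivity), Complex.real_smul]
  push_cast
  have h1' : (thalerH γ z : ℂ) ≠ 0 := by exact_mod_cast h1.ne'
  have h2' : (thalerWeight γ k z : ℂ) ≠ 0 := by exact_mod_cast h2.ne'
  field_simp

lemma continuousOn_thalerH : ContinuousOn (thalerH γ) (Icc xs 1) := by
  intro x hx
  have h0 := hp.pos.trans_le hx.1
  unfold thalerH
  exact ((continuousAt_rpow_const _ _ (Or.inl h0.ne')).add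
    ((continuousAt_id.add continuousAt_const).rpow_const
      (Or.inl (by change x + 1 ≠ 0; linarith)))).continuousWithinAt

lemma integral_thalerH {c d : ℝ} (hc : xs ≤ c) (hcd : c ≤ d) (hd : d ≤ 1) :
    ∫ x in Ioc c d, thalerH γ x =
      (thalerG γ d ^ (1 - γ) - thalerG γ c ^ (1 - γ)) / (1 - γ) := by
  have ha := hp.one_sub_ne_zero
  have hsub : uIcc c d ⊆ Icc xs 1 := by
    rw [uIcc_of_le hcd]; exact Icc_subset_Icc hc hd
  have hpos := hp.pos
  have hder : ∀ x ∈ uIcc c d, HasDerivAt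
      (fun x : ℝ => (x ^ (1 - γ) + (1 + x) ^ (1 - γ) - 1) / (1 - γ)) (thalerH γ x) x := by
    intro x hx
    have h0 : 0 < x := hpos.trans_le (hsub hx).1
    have h1 : HasDerivAt (fun x : ℝ => x ^ (1 - γ)) ((1 - γ) * x ^ (1 - γ - 1)) x :=
      hasDerivAt_rpow_const (Or.inl h0.ne')
    have h2 : HasDerivAt (fun x : ℝ => (1 + x) ^ (1 - γ)) (1 * (1 - γ) * (1 + x) ^ (1 - γ - 1)) x :=
      ((hasDerivAt_id x).const_add 1).rpow_const (Or.inl (by simp only [id]; linarith))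
    refine (((h1.add h2).sub_const 1).div_const (1 - γ)).congr_deriv ?_
    rw [thalerH, show 1 - γ - 1 = -γ by ring, add_comm x]
    field_simp
  rw [← intervalIntegral.integral_of_le hcd, intervalIntegral.integral_eq_sub_of_hasDerivAt hder
    ((hp.continuousOn_thalerH.mono hsub).intervalIntegrable)]
  rw [thalerG_rpow hp.ne_one ⟨hpos.trans_le hc, hcd.trans hd⟩,
    thalerG_rpow hp.ne_one ⟨hpos.trans_le (hc.trans hcd), hd⟩]
  ring

lemma integral_thalerH_univ : ∫ x in Ioc xs 1, thalerH γ x = (2 ^ (1 - γ) - 1) / (1 - γ) := by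
  rw [hp.integral_thalerH le_rfl hp.lt_one.le le_rfl, thalerG_one hp.ne_one, hp.thalerG_xs,
    one_rpow]

lemma total_pos : 0 < ((2 : ℝ) ^ (1 - γ) - 1) / (1 - γ) := by
  rcases lt_or_gt_of_ne hp.ne_one with h | h
  · exact div_pos (sub_pos.2 (one_lt_rpow one_lt_two (by linarith))) (by linarith)
  · exact div_pos_of_neg_of_neg
      (sub_neg.2 (rpow_lt_one_of_one_lt_of_neg one_lt_two (by linarith))) (by linarith)

lemma thalerMu_restrict : (thalerMu γ).restrict (Ioc xs 1) =
    (volume.restrict (Ioc xs 1)).withDensity fun x => ENNReal.ofReal (thalerH γ x) := by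
  rw [thalerMu, restrict_withDensity measurableSet_Ioc, Measure.restrict_restrict measurableSet_Ioc,
    inter_eq_left.2 (Ioc_subset_Icc_self.trans (Icc_subset_Icc_left hp.pos.le))]

lemma thalerMu_Ioc : thalerMu γ (Ioc xs 1) = ENNReal.ofReal ((2 ^ (1 - γ) - 1) / (1 - γ)) := by
  have h : thalerMu γ (Ioc xs 1) = (thalerMu γ).restrict (Ioc xs 1) univ := by simp
  rw [h, hp.thalerMu_restrict, withDensity_apply _ MeasurableSet.univ, Measure.restrict_univ,
    ← hp.integral_thalerH_univ, ofReal_integral_eq_lintegral_ofReal]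
  · exact (hp.continuousOn_thalerH.integrableOn_Icc).mono_set Ioc_subset_Icc_self
  · filter_upwards [ae_restrict_mem measurableSet_Ioc] with x hx
    exact (thalerH_pos (hp.pos.trans hx.1)).le

lemma isProbabilityMeasure : IsProbabilityMeasure (thalerMuY γ xs) := by
  refine ⟨?_⟩
  rw [thalerMuY, Measure.smul_apply, Measure.restrict_apply_univ, hp.thalerMu_Ioc, smul_eq_mul]
  exact ENNReal.inv_mul_cancel (by simpa using hp.total_pos) ENNReal.ofReal_ne_top

lemma setIntegral_thalerMuY {A : Set ℝ} (hA : MeasurableSet A) (hAY : A ⊆ Ioc xs 1) (G : ℝ → ℂ) :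
    ∫ y in A, G y ∂(thalerMuY γ xs) =
      (((2 ^ (1 - γ) - 1) / (1 - γ) : ℝ) : ℂ)⁻¹ * ∫ y in A, (thalerH γ y : ℂ) * G y := by
  rw [thalerMuY, Measure.restrict_smul, integral_smul_measure, hp.thalerMu_restrict,
    restrict_withDensity hA, Measure.restrict_restrict hA, inter_eq_left.2 hAY,
    integral_withDensity_eq_integral_toReal_smul (by
      exact (measurable_thalerH γ).ennreal_ofReal)
    (Eventually.of_forall fun x => ENNReal.ofReal_lt_top), hp.thalerMu_Ioc, ENNReal.toReal_inv,
    ENNReal.toReal_ofReal hp.total_pos.le, Complex.real_smul, Complex.ofReal_inv]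
  congr 1
  refine setIntegral_congr_fun hA fun y hy => ?_
  rw [ENNReal.toReal_ofReal (thalerH_pos (hp.pos.trans (hAY hy).1)).le, Complex.real_smul]

lemma branch_image_subset (k : ℕ) : thalerBranch γ k '' Ioc xs 1 ⊆ Ioc xs 1 := by
  rintro _ ⟨z, hz, rfl⟩
  exact hp.branch_mem_Ioc (hp.mem_of_mem hz) k

lemma setIntegral_thalerMuY_branch (k : ℕ) (G : ℝ → ℂ) :
    ∫ y in thalerBranch γ k '' Ioc xs 1, G y ∂(thalerMuY γ xs) =
      ∫ z, (thalerWeight γ k z : ℂ) * G (thalerBranch γ k z) ∂(thalerMuY γ xs) := by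
  rw [hp.setIntegral_thalerMuY (hp.measurableSet_branch_image k) (hp.branch_image_subset k),
    hp.setIntegral_branch_image, integral_thalerMuY,
    hp.setIntegral_thalerMuY measurableSet_Ioc subset_rfl]

lemma setIntegral_thalerMuY_branch_const (k : ℕ) (c : ℂ) :
    ∫ _ in thalerBranch γ k '' Ioc xs 1, c ∂(thalerMuY γ xs) = (thalerMass γ k : ℂ) * c := by
  have h1 := hp.one_add_back_mem hp.one_mem (k + 1)
  have h0 := hp.one_add_back_mem hp.one_mem k
  have hlt := hp.back_succ_lt k hp.one_mem
  rw [hp.setIntegral_thalerMuY (hp.measurableSet_branch_image k) (hp.branch_image_subset k),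
    hp.branch_image, integral_mul_const, integral_complex_ofReal, hp.integral_thalerH,
    thalerG_thalerGInv hp.gamma_pos hp.ne_one h0, thalerG_thalerGInv hp.gamma_pos hp.ne_one h1,
    thalerMass, ← mul_assoc, ← Complex.ofReal_inv, ← Complex.ofReal_mul]
  · congr 2
    have := hp.one_sub_ne_zero
    have := two_rpow_sub_one_ne_zero this
    field_simp
  · rw [← hp.thalerGInv_one, thalerGInv_le_iff hp.gamma_pos hp.ne_one (by norm_num) h1]
    linarith [hp.back_pos (k + 1)]
  · rw [thalerGInv_le_iff hp.gamma_pos hp.ne_one h1 h0]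
    linarith
  · exact (thalerGInv_mem hp.gamma_pos hp.ne_one h0).2

end ThalerParam

/-! ### The return map as a return system -/

lemma measurable_thalerT (γ xs : ℝ) : Measurable (thalerT γ xs) := by
  have hg : Measurable (thalerG γ) := by unfold thalerG; fun_prop
  unfold thalerT
  exact Measurable.ite measurableSet_Iic measurable_const
    (Measurable.ite measurableSet_Iic hg (hg.sub_const 1))

lemma measurable_thalerTau (γ xs : ℝ) : Measurable (thalerTau γ xs) := by
  classical
  have hS : ∀ n : ℕ, MeasurableSet {y | 1 ≤ n ∧ (thalerT γ xs)^[n] y ∈ Ioc xs 1} := fun n =>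
    (MeasurableSet.const _).inter (((measurable_thalerT γ xs).iterate n) measurableSet_Ioc)
  have hlt : ∀ n : ℕ, MeasurableSet {y | thalerTau γ xs y < n} := by
    intro n
    have : {y | thalerTau γ xs y < n} =
        (⋃ m ∈ Iio n, {y | 1 ≤ m ∧ (thalerT γ xs)^[m] y ∈ Ioc xs 1}) ∪
        ({_y | 0 < n} ∩ ⋂ m : ℕ, {y | 1 ≤ m ∧ (thalerT γ xs)^[m] y ∈ Ioc xs 1}ᶜ) := by
      ext y
      simp only [mem_union, mem_iUnion, mem_inter_iff, mem_iInter, mem_compl_iff, mem_Iio,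
        mem_ofPred_eq, exists_prop]
      constructor
      · intro h
        by_cases hne : ∃ m, 1 ≤ m ∧ (thalerT γ xs)^[m] y ∈ Ioc xs 1
        · exact Or.inl ⟨_, h, Nat.sInf_mem hne⟩
        · exact Or.inr ⟨(Nat.zero_le _).trans_lt h, fun m hm => hne ⟨m, hm⟩⟩
      · rintro (⟨m, hm, h⟩ | ⟨hn, h⟩)
        · exact (Nat.sInf_le h).trans_lt hm
        · have : {m : ℕ | 1 ≤ m ∧ (thalerT γ xs)^[m] y ∈ Ioc xs 1} = ∅ :=
            eq_empty_of_forall_notMem h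
          rwa [thalerTau, this, Nat.sInf_empty]
    rw [this]
    exact (MeasurableSet.biUnion (to_countable _) fun m _ => hS m).union
      ((MeasurableSet.const _).inter (MeasurableSet.iInter fun m => (hS m).compl))
  exact measurable_of_Iio hlt

lemma measurable_thalerF (γ xs : ℝ) : Measurable (thalerF γ xs) := by
  have h : Measurable fun z : ℕ × ℝ => (thalerT γ xs)^[z.1] z.2 :=
    measurable_from_prod_countable_right fun n => (measurable_thalerT γ xs).iterate n
  exact h.comp ((measurable_thalerTau γ xs).prodMk measurable_id)

lemma aestronglyMeasurable_thalerMuY {γ xs : ℝ} {G : ℝ → ℂ} (hG : ContinuousOn G (Ioc xs 1)) :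
    AEStronglyMeasurable G (thalerMuY γ xs) := by
  rw [← Measure.restrict_eq_self_of_ae_mem (ae_thalerMuY_mem γ xs)]
  exact hG.aestronglyMeasurable measurableSet_Ioc

namespace ThalerParam

variable {γ xs : ℝ} (hp : ThalerParam γ xs)

include hp

lemma abs_sub_le_one {z w : ℝ} (hz : z ∈ Ioc xs 1) (hw : w ∈ Ioc xs 1) : |z - w| ≤ 1 := by
  have := hp.pos
  rw [abs_le]
  constructor <;> linarith [hz.1, hz.2, hw.1, hw.2]

lemma abs_weight_sub_le {D : ℝ} (hD : 0 ≤ D)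
    (hdist : ∀ k, ∀ z ∈ Ioc xs 1, ∀ w ∈ Ioc xs 1,
      thalerWeight γ k z ≤ thalerWeight γ k w * exp (D * |z - w|)) {M : ℝ} (k : ℕ)
    (hM : ∀ z ∈ Ioc xs 1, thalerWeight γ k z ≤ M) {z w : ℝ} (hz : z ∈ Ioc xs 1)
    (hw : w ∈ Ioc xs 1) : |thalerWeight γ k z - thalerWeight γ k w| ≤ D * M * |z - w| := by
  have key : ∀ z ∈ Ioc xs 1, ∀ w ∈ Ioc xs 1,
      thalerWeight γ k z - thalerWeight γ k w ≤ D * M * |z - w| := by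
    intro z hz w hw
    have h0 := (hp.weight_pos (hp.mem_of_mem hz) k).le
    have h := mul_le_mul_of_nonneg_right (hdist k z hz w hw) (exp_pos (-(D * |z - w|))).le
    rw [mul_assoc, ← exp_add, add_neg_cancel, exp_zero, mul_one] at h
    have h1 := add_one_le_exp (-(D * |z - w|))
    have h2 := mul_le_mul_of_nonneg_left h1 h0
    have h3 : 0 ≤ D * |z - w| := by positivity
    have h4 := mul_le_mul_of_nonneg_right (hM z hz) h3
    nlinarith
  rw [abs_le]
  constructor
  · have := key w hw z hz
    rw [abs_sub_comm] at this
    linarith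
  · exact key z hz w hw

lemma continuousOn_weight (k : ℕ) : ContinuousOn (thalerWeight γ k) (Ioc xs 1) := by
  obtain ⟨D, hD, hdist⟩ := hp.weight_distortion
  have h1 : (1 : ℝ) ∈ Ioc xs 1 := ⟨hp.lt_one, le_rfl⟩
  have hM : ∀ z ∈ Ioc xs 1, thalerWeight γ k z ≤ thalerWeight γ k 1 * exp D := by
    intro z hz
    refine (hdist k z hz 1 h1).trans ?_
    have := (hp.weight_pos hp.one_mem k).le
    have := hp.abs_sub_le_one hz h1
    gcongr
    nlinarith
  refine (LipschitzOnWith.of_dist_le_mul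
    (K := (D * (thalerWeight γ k 1 * exp D)).toNNReal) fun z hz w hw => ?_).continuousOn
  rw [Real.coe_toNNReal _ (mul_nonneg hD
    (mul_nonneg (hp.weight_pos hp.one_mem k).le (exp_pos _).le))]
  exact hp.abs_weight_sub_le hD hdist k hM hz hw

lemma continuousOn_branch (k : ℕ) : ContinuousOn (thalerBranch γ k) (Ioc xs 1) := by
  refine (LipschitzOnWith.of_dist_le_mul (K := xs.toNNReal) fun z hz w hw => ?_).continuousOn
  rw [Real.coe_toNNReal _ hp.pos.le]
  exact hp.abs_branch_sub_le (hp.mem_of_mem hz) (hp.mem_of_mem hw) k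

lemma integrable_of_bound {G : ℝ → ℂ} (hG : AEStronglyMeasurable G (thalerMuY γ xs)) {B : ℝ}
    (hB : ∀ z ∈ Ioc xs 1, ‖G z‖ ≤ B) : Integrable G (thalerMuY γ xs) := by
  have := hp.isProbabilityMeasure
  refine Integrable.of_bound hG B ?_
  filter_upwards [ae_thalerMuY_mem γ xs] with z hz using hB z hz

lemma integral_weight (k : ℕ) :
    ∫ z, (thalerWeight γ k z : ℂ) ∂(thalerMuY γ xs) = (thalerMass γ k : ℂ) := by
  have h := hp.setIntegral_thalerMuY_branch k fun _ => 1
  rw [hp.setIntegral_thalerMuY_branch_const] at h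
  simpa using h.symm

lemma weight_le_mass {D : ℝ} (hD : 0 ≤ D)
    (hdist : ∀ k, ∀ z ∈ Ioc xs 1, ∀ w ∈ Ioc xs 1,
      thalerWeight γ k z ≤ thalerWeight γ k w * exp (D * |z - w|)) (k : ℕ) {z : ℝ}
    (hz : z ∈ Ioc xs 1) : thalerWeight γ k z ≤ exp D * thalerMass γ k := by
  have := hp.isProbabilityMeasure
  have hle : ∀ z ∈ Ioc xs 1, ∀ w ∈ Ioc xs 1,
      thalerWeight γ k z ≤ exp D * thalerWeight γ k w := by
    intro z hz w hw
    refine (hdist k z hz w hw).trans ?_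
    rw [mul_comm]
    have := (hp.weight_pos (hp.mem_of_mem hw) k).le
    have := hp.abs_sub_le_one hz hw
    gcongr
    nlinarith
  have hi := hp.integral_weight k
  rw [integral_complex_ofReal, Complex.ofReal_inj] at hi
  have hintg : Integrable (thalerWeight γ k) (thalerMuY γ xs) := by
    have h := hp.integrable_of_bound (G := fun z => (thalerWeight γ k z : ℂ))
      (aestronglyMeasurable_thalerMuY
        (Complex.continuous_ofReal.comp_continuousOn (hp.continuousOn_weight k)))
      (B := exp D * thalerWeight γ k 1) (fun w hw => by
        rw [Complex.norm_real, norm_of_nonneg (hp.weight_pos (hp.mem_of_mem hw) k).le]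
        exact hle w hw 1 ⟨hp.lt_one, le_rfl⟩)
    exact h.re
  have h : ∫ _, thalerWeight γ k z ∂(thalerMuY γ xs) ≤
      ∫ w, exp D * thalerWeight γ k w ∂(thalerMuY γ xs) := by
    refine integral_mono_ae (integrable_const _) (hintg.const_mul _) ?_
    filter_upwards [ae_thalerMuY_mem γ xs] with w hw using hle z hz w hw
  rw [integral_const_mul, hi] at h
  simpa using h

/-- Disintegration of an integral over `Y` along the branches of the return map. -/
lemma hasSum_setIntegral_branch {G : ℝ → ℂ} (hG : Integrable G (thalerMuY γ xs)) :
    HasSum (fun k => ∫ y in thalerBranch γ k '' Ioc xs 1, G y ∂(thalerMuY γ xs))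
      (∫ y, G y ∂(thalerMuY γ xs)) := by
  have h := hasSum_integral_iUnion hp.measurableSet_branch_image
    hp.pairwise_disjoint_branch_image hG.integrableOn
  rwa [hp.iUnion_branch_image, ← integral_thalerMuY] at h

lemma hasSum_thalerMass_mul {c : ℕ → ℂ} {B : ℝ} (hc : ∀ k, ‖c k‖ ≤ B) :
    HasSum (fun k => (thalerMass γ k : ℂ) * c (k + 1))
      (∫ y, c (thalerTau γ xs y) ∂(thalerMuY γ xs)) := by
  have hm : Measurable fun y => c (thalerTau γ xs y) :=
    (measurable_from_top (f := c)).comp (measurable_thalerTau γ xs)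
  have h := hp.hasSum_setIntegral_branch
    (hp.integrable_of_bound hm.aestronglyMeasurable fun z _ => hc (thalerTau γ xs z))
  convert h using 2 with k
  rw [← hp.setIntegral_thalerMuY_branch_const]
  refine setIntegral_congr_fun (hp.measurableSet_branch_image k) ?_
  rintro _ ⟨z, hz, rfl⟩
  simp only [hp.thalerTau_branch hz]

lemma integral_eq_integral_branchTransfer {c : ℕ → ℂ} {u Φ : ℝ → ℂ} {B : ℝ} {q : ℕ → ℝ}
    (hq : Summable q) (hwq : ∀ k, ∀ z ∈ Ioc xs 1, thalerWeight γ k z ≤ q k)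
    (hc : ∀ k, ‖c k‖ ≤ B) (hu : ContinuousOn u (Ioc xs 1)) (huB : ∀ z ∈ Ioc xs 1, ‖u z‖ ≤ B)
    (hΦ : Measurable Φ) (hΦ1 : ∀ z, ‖Φ z‖ ≤ 1) :
    ∫ z, c (thalerTau γ xs z) * u z * Φ (thalerF γ xs z) ∂(thalerMuY γ xs) =
      ∫ z, branchTransfer (thalerWeight γ) (thalerBranch γ) c u z * Φ z ∂(thalerMuY γ xs) := by
  have := hp.isProbabilityMeasure
  have hB : 0 ≤ B := (norm_nonneg _).trans (hc 0)
  have hm : Measurable fun y => c (thalerTau γ xs y) :=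
    (measurable_from_top (f := c)).comp (measurable_thalerTau γ xs)
  have hl := hp.hasSum_setIntegral_branch
    (G := fun z => c (thalerTau γ xs z) * u z * Φ (thalerF γ xs z))
    (hp.integrable_of_bound ((hm.aestronglyMeasurable.mul (aestronglyMeasurable_thalerMuY hu)).mul
      (hΦ.comp (measurable_thalerF γ xs)).aestronglyMeasurable) (B := B * B * 1) fun z hz => by
        rw [norm_mul, norm_mul]
        have h1 := hc (thalerTau γ xs z)
        have h2 := huB z hz
        have h3 := hΦ1 (thalerF γ xs z)
        gcongr)
  have hterm : ∀ k, ∫ y in thalerBranch γ k '' Ioc xs 1,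
      c (thalerTau γ xs y) * u y * Φ (thalerF γ xs y) ∂(thalerMuY γ xs) =
      ∫ z, (thalerWeight γ k z : ℂ) * (c (k + 1) * u (thalerBranch γ k z)) * Φ z
        ∂(thalerMuY γ xs) := by
    intro k
    rw [hp.setIntegral_thalerMuY_branch]
    refine integral_congr_ae ?_
    filter_upwards [ae_thalerMuY_mem γ xs] with z hz
    rw [hp.thalerTau_branch hz, hp.thalerF_branch hz, mul_assoc, mul_assoc, mul_assoc]
  simp only [hterm] at hl
  have hr : HasSum (fun k => ∫ z, (thalerWeight γ k z : ℂ) *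
      (c (k + 1) * u (thalerBranch γ k z)) * Φ z ∂(thalerMuY γ xs))
      (∫ z, branchTransfer (thalerWeight γ) (thalerBranch γ) c u z * Φ z ∂(thalerMuY γ xs)) := by
    have hbound : ∀ k, ∀ z ∈ Ioc xs 1, ‖(thalerWeight γ k z : ℂ) *
        (c (k + 1) * u (thalerBranch γ k z))‖ ≤ q k * (B * B) := by
      intro k z hz
      have h0 := (hp.weight_pos (hp.mem_of_mem hz) k).le
      rw [norm_mul, norm_mul, Complex.norm_real, norm_of_nonneg h0]
      have h1 := hwq k z hz
      have h2 := hc (k + 1)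
      have h3 := huB _ (hp.branch_mem_Ioc (hp.mem_of_mem hz) k)
      have := h0.trans h1
      gcongr
    refine hasSum_integral_of_dominated_convergence (fun k _ => q k * (B * B)) ?_ ?_ ?_ ?_ ?_
    · intro k
      refine (aestronglyMeasurable_thalerMuY ?_).mul hΦ.aestronglyMeasurable
      exact (Complex.continuous_ofReal.comp_continuousOn (hp.continuousOn_weight k)).mul
        (continuousOn_const.mul (hu.comp (hp.continuousOn_branch k) fun z hz =>
          hp.branch_mem_Ioc (hp.mem_of_mem hz) k))
    · intro k
      filter_upwards [ae_thalerMuY_mem γ xs] with z hz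
      rw [norm_mul]
      exact (mul_le_of_le_one_right (norm_nonneg _) (hΦ1 z)).trans (hbound k z hz)
    · exact Eventually.of_forall fun _ => hq.mul_right _
    · exact integrable_const _
    · filter_upwards [ae_thalerMuY_mem γ xs] with z hz
      exact (Summable.of_norm_bounded (hq.mul_right (B * B))
        fun k => hbound k z hz).hasSum.mul_right _
  exact hl.unique hr

/-- The return map of the Thaler map is a return system whose weights are dominated by a multiple
of the return time distribution. -/
theorem exists_returnSystem : ∃ C : ℝ, ReturnSystem (thalerMuY γ xs) (Ioc xs 1) (thalerF γ xs)
    (thalerTau γ xs) (thalerWeight γ) (thalerBranch γ) (fun k => C * thalerMass γ k) xs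
    (thalerRatio γ xs / (1 + thalerRatio γ xs)) := by
  obtain ⟨D, hD, hdist⟩ := hp.weight_distortion
  have hr := thalerRatio_pos (γ := γ) hp.pos
  have hmass := fun k => hp.thalerMass_nonneg k
  have hle : ∀ k, ∀ z ∈ Ioc xs 1, thalerWeight γ k z ≤ (1 + D) * exp D * thalerMass γ k := by
    intro k z hz
    refine (hp.weight_le_mass hD hdist k hz).trans ?_
    have := mul_nonneg (exp_pos D).le (hmass k)
    nlinarith
  have hsum : Summable fun k => (1 + D) * exp D * thalerMass γ k :=
    hp.hasSum_thalerMass.summable.mul_left _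
  refine ⟨(1 + D) * exp D, ?_⟩
  exact
    { measurableSet := measurableSet_Ioc
      ae_mem := ae_thalerMuY_mem γ xs
      measurable_map := measurable_thalerF γ xs
      measurable_time := measurable_thalerTau γ xs
      abs_sub_le_one := fun z hz w hw => hp.abs_sub_le_one hz hw
      weight_nonneg := fun k z hz => (hp.weight_pos (hp.mem_of_mem hz) k).le
      weight_hasSum := fun z hz => hp.hasSum_weight hz
      branch_mem := fun k z hz => hp.branch_mem_Ioc (hp.mem_of_mem hz) k
      branch_contract := fun k z hz w hw =>
        hp.abs_branch_sub_le (hp.mem_of_mem hz) (hp.mem_of_mem hw) k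
      rate_nonneg := hp.pos.le
      rate_lt_one := hp.lt_one
      weight_le := hle
      weight_lipschitz := fun k z hz w hw => by
        refine (hp.abs_weight_sub_le hD hdist k
          (fun z hz => hp.weight_le_mass hD hdist k hz) hz hw).trans ?_
        have := mul_nonneg (exp_pos D).le (hmass k)
        refine mul_le_mul_of_nonneg_right ?_ (abs_nonneg _)
        linarith
      dominating_nonneg := fun k => by
        have := hmass k
        positivity
      dominating_summable := hsum
      minorant_pos := by positivity
      minorant_lt_one := by rw [div_lt_one (by positivity)]; linarith
      minorant_le := fun z hz => hp.weight_zero_ge hz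
      duality := fun c u Φ B hc hu huB hΦ hΦ1 =>
        hp.integral_eq_integral_branchTransfer hsum hle hc hu huB hΦ hΦ1 }

end ThalerParam

/-! ### The stable limit law -/

lemma cos_mul_pi_div_two_mul_Gamma_pos {α : ℝ} (hα : α ∈ Ioo (0 : ℝ) 1 ∪ Ioo (1 : ℝ) 2) :
    0 < Real.Gamma (1 - α) * Real.cos (α * π / 2) := by
  have hπ := Real.pi_pos
  rcases hα with ⟨h0, h1⟩ | ⟨h1, h2⟩
  · exact mul_pos (Real.Gamma_pos_of_pos (by linarith))
      (Real.cos_pos_of_mem_Ioo ⟨by nlinarith, by nlinarith⟩)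
  · have hg := Real.Gamma_add_one (s := 1 - α) (by linarith)
    have hg2 : 0 < Real.Gamma (1 - α + 1) := Real.Gamma_pos_of_pos (by linarith)
    have hneg : Real.Gamma (1 - α) < 0 := by
      by_contra! h
      nlinarith
    exact mul_pos_of_neg_of_neg hneg
      (Real.cos_neg_of_pi_div_two_lt_of_lt (by nlinarith) (by nlinarith))

lemma stableDa_pos {α : ℝ} (hα : α ∈ Ioo (0 : ℝ) 1 ∪ Ioo (1 : ℝ) 2) : 0 < stableDa α := by
  have h0 : 0 < α := by rcases hα with h | h <;> linarith [h.1]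
  have hc : 0 < (1 - α⁻¹) / ((2 : ℝ) ^ (1 - α⁻¹) - 1) := by
    rcases hα with ⟨_, h⟩ | ⟨h, _⟩
    · have h1 : 1 - α⁻¹ < 0 := by linarith [(one_lt_inv₀ h0).2 h]
      exact div_pos_of_neg_of_neg h1
        (sub_neg.2 (rpow_lt_one_of_one_lt_of_neg one_lt_two h1))
    · have h1 : 0 < 1 - α⁻¹ := by linarith [inv_lt_one_of_one_lt₀ h]
      exact div_pos h1 (sub_pos.2 (one_lt_rpow one_lt_two h1))
  exact mul_pos (mul_pos (rpow_pos_of_pos h0 _) hc) (cos_mul_pi_div_two_mul_Gamma_pos hα)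

/-- The error between the characteristic function of the Birkhoff sum and the power of the
characteristic function of one return time vanishes under stable normalization. -/
lemma tendsto_stable_error {α β : ℝ} (hα : 0 < α) (hβ : α / 2 < β) (C a : ℝ) :
    Tendsto (fun n : ℕ => C * (|a * (n : ℝ) ^ (-α⁻¹)| ^ β +
      n * (|a * (n : ℝ) ^ (-α⁻¹)| ^ β) ^ 2)) atTop (𝓝 0) := by
  have hβ0 : 0 < β := by linarith
  have hpow : ∀ {e : ℝ}, e < 0 → Tendsto (fun n : ℕ => (n : ℝ) ^ e) atTop (𝓝 0) := fun {e} he => by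
    have := (tendsto_rpow_neg_atTop (y := -e) (by linarith)).comp
      (tendsto_natCast_atTop_atTop (R := ℝ))
    simpa [Function.comp_def] using this
  have hαi : 0 < α⁻¹ := inv_pos.2 hα
  have h1 := (hpow (e := -α⁻¹ * β) (by nlinarith)).const_mul (|a| ^ β)
  have he : 1 + (-α⁻¹ * β) * 2 < 0 := by
    have : α⁻¹ * (α / 2) < α⁻¹ * β := mul_lt_mul_of_pos_left hβ hαi
    rw [← mul_div_assoc, inv_mul_cancel₀ hα.ne'] at this
    linarith
  have h2 := (hpow he).const_mul ((|a| ^ β) ^ 2)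
  have h3 := ((h1.add h2).const_mul C)
  simp only [mul_zero, add_zero] at h3
  refine h3.congr' ?_
  filter_upwards [eventually_gt_atTop 0] with n hn
  have hn0 : (0 : ℝ) < n := by exact_mod_cast hn
  rw [abs_mul, abs_of_pos (rpow_pos_of_pos hn0 _),
    mul_rpow (abs_nonneg _) (rpow_pos_of_pos hn0 _).le,
    ← rpow_mul hn0.le, rpow_add hn0, rpow_one, rpow_mul hn0.le _ 2, rpow_two]
  ring

lemma cexp_birkhoff_eq_prod (t c ℓ : ℝ) (n : ℕ) (f : ℕ → ℝ) :
    Complex.exp (Complex.I * (t : ℂ) *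
      ((c * ((∑ j ∈ Finset.range n, f j) - n * ℓ) : ℝ) : ℂ)) =
    ∏ j ∈ Finset.range n, Complex.exp (Complex.I * ((t * c * (f j - ℓ) : ℝ) : ℂ)) := by
  rw [← Complex.exp_sum, ← Finset.mul_sum, ← Complex.ofReal_sum, ← Finset.mul_sum,
    Finset.sum_sub_distrib, Finset.sum_const, Finset.card_range, nsmul_eq_mul]
  congr 1
  push_cast
  ring

/-- Theorem 2.4, via characteristic functions: Fix `α ∈ (0,1) ∪ (1,2)`,
`γ = 1/α`.  With `τ_j(y) = τ(F^j y)` the successive return times of `y ∈ Y` to `Y`,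
for every `t ∈ ℝ` the characteristic function of
`n^(−γ)·d_α^(−γ)·(Σ_{j<n} τ_j − n ℓ_α)` under `μ_Y` converges to
`exp(−|t|^α (1 − i sgn(t) tan(απ/2)))`, the characteristic function of the one-sided
stable law `X_{α,1,1}`. -/
theorem thaler_stable_law_one_sided (α : ℝ)
    (hα : α ∈ Set.Ioo (0 : ℝ) 1 ∪ Set.Ioo (1 : ℝ) 2)
    (xs : ℝ) (hxs : xs ∈ Set.Ioo (0 : ℝ) 1)
    (hxseq : xs ^ (1 - α⁻¹) + (1 + xs) ^ (1 - α⁻¹) = 2) :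
    ∀ t : ℝ,
      Tendsto
        (fun n : ℕ =>
          ∫ y, Complex.exp (Complex.I * (t : ℂ) *
            (((n : ℝ) ^ (-α⁻¹) * stableDa α ^ (-α⁻¹) *
              ((∑ j ∈ Finset.range n, (thalerTau α⁻¹ xs ((thalerF α⁻¹ xs)^[j] y) : ℝ))
                - n * stableLa α) : ℝ) : ℂ)) ∂(thalerMuY α⁻¹ xs))
        atTop
        (nhds (Complex.exp (-((|t| ^ α : ℝ) : ℂ) *
          (1 - Complex.I * ((Real.sign t : ℝ) : ℂ) *
            ((Real.tan (α * π / 2) : ℝ) : ℂ))))) := by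
  intro t
  have hα0 : 0 < α := by rcases hα with h | h <;> linarith [h.1]
  have hα2 : α < 2 := by rcases hα with h | h <;> linarith [h.2]
  have hne : α⁻¹ ≠ 1 := by
    rw [Ne, inv_eq_one]
    rintro rfl
    rcases hα with h | h
    · exact h.2.false
    · exact h.1.false
  have hp : ThalerParam α⁻¹ xs :=
    { half_lt := by
        rw [one_div]
        exact (inv_lt_inv₀ two_pos hα0).2 hα2
      ne_one := hne
      pos := hxs.1
      lt_one := hxs.2
      eq_two := hxseq }
  have := hp.isProbabilityMeasure
  obtain ⟨K, S⟩ := hp.exists_returnSystem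
  obtain ⟨β, hβ2, hβ⟩ : ∃ β, α / 2 < β ∧ β < min α 1 :=
    exists_between (lt_min (by linarith) (by linarith))
  have hβα := hβ.trans_le (min_le_left _ _)
  have hβ1 := hβ.trans_le (min_le_right _ _)
  have hsum : Summable fun k : ℕ => K * thalerMass α⁻¹ k * ((k : ℝ) + 1) ^ β := by
    simp only [mul_assoc]
    exact (hp.summable_thalerMass_mul_rpow (by rwa [inv_inv])).mul_left K
  obtain ⟨C, hC⟩ := S.exists_norm_integral_prod_sub_pow_le (stableLa α) (by linarith) hβ1.le hsum
  have hd := stableDa_pos hα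
  have hGc := cos_mul_pi_div_two_mul_Gamma_pos hα
  have hmain := tendsto_charFun_pow (P := thalerMass α⁻¹) (ℓ := stableLa α) (d := stableDa α) hα0
    (fun k => hp.thalerMass_nonneg k) hp.hasSum_thalerMass
    (by simpa only [inv_inv] using hp.tendsto_thalerMass_mul)
    (by
      rcases hα with ⟨_, h⟩ | ⟨h, _⟩
      · exact Or.inl ⟨h, if_pos h⟩
      · refine Or.inr ⟨h, hα2, ?_⟩
        rw [stableLa, if_neg (not_lt.2 h.le)]
        exact hp.hasSum_mul_thalerMass (inv_lt_one_of_one_lt₀ h))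
    hd
    (by
      rw [stableDa, stableGa, rpow_add_one hα0.ne']
      field_simp)
    (right_ne_zero_of_mul hGc.ne') t
  simp only [cexp_birkhoff_eq_prod t]
  rcases eq_or_ne t 0 with rfl | ht
  · simp [zero_rpow hα0.ne']
  have hone : ∀ s : ℝ, ∫ z, Complex.exp (Complex.I *
      ((s * ((thalerTau α⁻¹ xs z : ℝ) - stableLa α) : ℝ) : ℂ)) ∂(thalerMuY α⁻¹ xs) =
      ∑' k : ℕ, (thalerMass α⁻¹ k : ℂ) *
        Complex.exp (Complex.I * ((s * ((k : ℝ) + 1 - stableLa α) : ℝ) : ℂ)) := by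
    intro s
    have h := hp.hasSum_thalerMass_mul (B := 1)
      (c := fun k : ℕ => Complex.exp (Complex.I * ((s * ((k : ℝ) - stableLa α) : ℝ) : ℂ)))
      fun k => by rw [mul_comm, Complex.norm_exp_ofReal_mul_I]
    rw [← h.tsum_eq]
    simp only [Nat.cast_add, Nat.cast_one]
  have herr := tendsto_stable_error hα0 hβ2 C (t * stableDa α ^ (-α⁻¹))
  refine (tendsto_iff_of_dist ?_).1 hmain
  refine squeeze_zero' (Eventually.of_forall fun n => dist_nonneg) ?_ herr
  filter_upwards [eventually_gt_atTop 0] with n hn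
  have hn0 : (0 : ℝ) < n := by exact_mod_cast hn
  have hs : t * ((n : ℝ) ^ (-α⁻¹) * stableDa α ^ (-α⁻¹)) ≠ 0 :=
    mul_ne_zero ht (mul_pos (rpow_pos_of_pos hn0 _) (rpow_pos_of_pos hd _)).ne'
  have h := hC _ hs n
  rw [hone] at h
  rw [dist_comm, dist_eq_norm]
  refine h.trans_eq ?_
  rw [show t * ((n : ℝ) ^ (-α⁻¹) * stableDa α ^ (-α⁻¹)) =
    t * stableDa α ^ (-α⁻¹) * (n : ℝ) ^ (-α⁻¹) by ring]
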